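/- Reverse Hölder inequality, Case 1 (estimate (41) in the proof of Theorem 1.4, Case 1, for classical solutions). Let n ≥ 3, Ω ⊆ ℝⁿ a domain, 2 ≤ k ≤ n, f : Ω×ℝ×ℝⁿ → ℝ positive and C^{1,1}_loc, H₁ : Ω×ℝ → ℝ C^{1,1}_loc with H₁ ≥ 0, and H(x,z,ξ) := H₁(x,z)|ξ|²I. Fix concentric balls with closure(B_{2R}) ⊂ Ω and M > 0, and set β := kn/(kn−2k+2). Then there is a constant C, depending only on n, k, R, f, H₁ and M, such that for every u ∈ C²(Ω) satisfying σ_k(A_H[u]) = f(x,u,∇u)^k and λ(A_H[u]) ∈ Γ_k^+ on Ω, every constant C₁ ∈ [0,M] with Δu + C₁ ≥ 1 and |∇²u| ≤ Δu + C₁ pointwise on B_{2R}, and with sup_{B_{2R}}(|u|+|∇u|) ≤ M and ∫_{B_{2R}}(Δu+C₁)^{kn/2} ≤ M, one has for all q > kn/2 − k + 1 and all ρ ∈ (0,R/3]: (∫_{B_{R+ρ}} (Δu+C₁)^{βq})^{1/β} ≤ (Cq/ρ²) ∫_{B_{R+3ρ}} (Δu+C₁)^{q+k−1}. -/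

import Mathlib

open MeasureTheory Metric Set Matrix

noncomputable section

/-- The `k`-th elementary symmetric polynomial of the eigenvalues of an `n × n` real
matrix, defined via the coefficients of the characteristic polynomial. -/
def esymmMat {n : ℕ} (k : ℕ) (A : Matrix (Fin n) (Fin n) ℝ) : ℝ :=
  (-1 : ℝ) ^ k * A.charpoly.coeff (n - k)

/-- `λ(A) ∈ Γ_k^+`, i.e. `σ_j(A) > 0` for all `1 ≤ j ≤ k`. -/
def GammaPlus {n : ℕ} (k : ℕ) (A : Matrix (Fin n) (Fin n) ℝ) : Prop :=
  ∀ j : ℕ, 1 ≤ j → j ≤ k → 0 < esymmMat j A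

/-- The Newton tensors `T_0(A) = I`, `T_j(A) = σ_j(A) I - T_{j-1}(A) A`. -/
def newtonT {n : ℕ} : ℕ → Matrix (Fin n) (Fin n) ℝ → Matrix (Fin n) (Fin n) ℝ
  | 0, _ => 1
  | (j + 1), A => esymmMat (j + 1) A • (1 : Matrix (Fin n) (Fin n) ℝ) - newtonT j A * A

/-- `i`-th partial derivative. -/
def pd {n : ℕ} (i : Fin n) (w : (Fin n → ℝ) → ℝ) (x : Fin n → ℝ) : ℝ :=
  fderiv ℝ w x (Pi.single i 1)

/-- Gradient as a vector. -/
def grad {n : ℕ} (w : (Fin n → ℝ) → ℝ) (x : Fin n → ℝ) : Fin n → ℝ :=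
  fun i => pd i w x

/-- Hessian matrix. -/
def hess {n : ℕ} (w : (Fin n → ℝ) → ℝ) (x : Fin n → ℝ) : Matrix (Fin n) (Fin n) ℝ :=
  Matrix.of fun i j => pd i (pd j w) x

/-- Squared Euclidean norm of a vector. -/
def normSq {n : ℕ} (ξ : Fin n → ℝ) : ℝ := ∑ i, ξ i ^ 2

/-- Euclidean norm of a vector. -/
def vnorm {n : ℕ} (ξ : Fin n → ℝ) : ℝ := Real.sqrt (∑ i, ξ i ^ 2)

/-- Operator norm of a matrix, viewed as a linear map between Euclidean spaces. -/
def matNorm {n : ℕ} (M : Matrix (Fin n) (Fin n) ℝ) : ℝ :=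
  ‖LinearMap.toContinuousLinearMap (Matrix.toEuclideanLin M)‖

/-- Laplacian. -/
def lapl {n : ℕ} (w : (Fin n → ℝ) → ℝ) (x : Fin n → ℝ) : ℝ := ∑ l, pd l (pd l w) x

/-- `W^{2,p}` norm (with classical derivatives) on a set. -/
def W2pNorm {n : ℕ} (p : ℝ) (w : (Fin n → ℝ) → ℝ) (B : Set (Fin n → ℝ)) : ℝ :=
  (∫ x in B, (|w x| ^ p + vnorm (grad w x) ^ p + matNorm (hess w x) ^ p)) ^ (1 / p)

/-- `C^{1,1}_loc` on a set: continuously differentiable with locally Lipschitz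
first derivatives. -/
def C11On {E F : Type*} [NormedAddCommGroup E] [NormedSpace ℝ E]
    [NormedAddCommGroup F] [NormedSpace ℝ F] (f : E → F) (s : Set E) : Prop :=
  ContDiffOn ℝ 1 f s ∧
    ∀ x ∈ s, ∃ (K : NNReal) (t : Set E), t ∈ nhdsWithin x s ∧
      LipschitzOnWith K (fderivWithin ℝ f s) t

/-- First order difference quotient `∇_l^h`. -/
def dq {n : ℕ} (l : Fin n) (h : ℝ) (w : (Fin n → ℝ) → ℝ) (x : Fin n → ℝ) : ℝ :=
  (w (x + h • (Pi.single l 1 : Fin n → ℝ)) - w x) / h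

/-- Second order difference quotient `Δ_{ll}^h`. -/
def ddq {n : ℕ} (l : Fin n) (h : ℝ) (w : (Fin n → ℝ) → ℝ) (x : Fin n → ℝ) : ℝ :=
  (w (x + h • (Pi.single l 1 : Fin n → ℝ)) - 2 * w x + w (x - h • (Pi.single l 1 : Fin n → ℝ))) / h ^ 2

/-- `L^s` seminorm (as an extended real number) of a function on a set. -/
def lpN {n : ℕ} (s : ℝ) (w : (Fin n → ℝ) → ℝ) (S : Set (Fin n → ℝ)) : ENNReal :=
  (∫⁻ x in S, ENNReal.ofReal (|w x| ^ s)) ^ (1 / s)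

end

namespace RH

/-- elementary symmetric function of the numbers `l i`, `i ∈ s`. -/
noncomputable def es {ι : Type*} (s : Finset ι) (j : ℕ) (l : ι → ℝ) : ℝ :=
  ∑ t ∈ s.powersetCard j, ∏ i ∈ t, l i

section
set_option linter.unusedSectionVars false
variable {ι : Type*} [DecidableEq ι]

@[simp] lemma es_zero (s : Finset ι) (l : ι → ℝ) : es s 0 l = 1 := by simp [es]

lemma es_insert {s : Finset ι} {i : ι} (hi : i ∉ s) (j : ℕ) (l : ι → ℝ) :
    es (insert i s) (j + 1) l = es s (j + 1) l + l i * es s j l := by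
  unfold es
  rw [Finset.powersetCard_succ_insert hi, Finset.sum_union, Finset.sum_image]
  · rw [Finset.mul_sum]
    congr 1
    apply Finset.sum_congr rfl
    intro t ht
    rw [Finset.prod_insert]
    intro h
    exact hi ((Finset.mem_powersetCard.1 ht).1 h)
  · intro a ha b hb hab
    have h1 : i ∉ a := fun h => hi ((Finset.mem_powersetCard.1 ha).1 h)
    have h2 : i ∉ b := fun h => hi ((Finset.mem_powersetCard.1 hb).1 h)
    rw [← Finset.erase_insert h1, ← Finset.erase_insert h2]
    exact congrArg (fun t => t.erase i) hab
  · rw [Finset.disjoint_left]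
    intro a ha hb
    obtain ⟨b, hb, rfl⟩ := Finset.mem_image.1 hb
    exact hi ((Finset.mem_powersetCard.1 ha).1 (Finset.mem_insert_self _ _))

lemma es_erase {s : Finset ι} {i : ι} (hi : i ∈ s) (j : ℕ) (l : ι → ℝ) :
    es s (j + 1) l = es (s.erase i) (j + 1) l + l i * es (s.erase i) j l := by
  conv_lhs => rw [← Finset.insert_erase hi]
  exact es_insert (Finset.notMem_erase i s) j l

lemma es_empty (j : ℕ) (l : ι → ℝ) : es (∅ : Finset ι) (j + 1) l = 0 := by
  unfold es
  rw [Finset.powersetCard_eq_empty.2 (by simp)]; simp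

lemma sum_mul_es_erase (s : Finset ι) (l : ι → ℝ) : ∀ j : ℕ,
    ∑ i ∈ s, l i * es (s.erase i) j l = (j + 1) * es s (j + 1) l := by
  induction s using Finset.induction_on with
  | empty => intro j; simp [es_empty]
  | insert a s ha ih =>
    intro j
    rw [Finset.sum_insert ha, Finset.erase_insert ha]
    have key : ∀ i ∈ s, (insert a s).erase i = insert a (s.erase i) := by
      intro i hi
      rw [Finset.erase_insert_of_ne]
      rintro rfl; exact ha hi
    rw [Finset.sum_congr rfl (fun i hi => by rw [key i hi])]
    have hna : ∀ i, a ∉ s.erase i := fun i h => ha (Finset.mem_of_mem_erase h)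
    cases j with
    | zero =>
      have := ih 0
      simp only [es_zero] at this ⊢
      rw [es_insert ha, es_zero, this]
      push_cast; ring
    | succ j =>
      have h1 := ih (j + 1)
      have h2 := ih j
      rw [es_insert ha]
      simp_rw [fun i => es_insert (hna i) j l, mul_add]
      rw [Finset.sum_add_distrib, h1]
      have : ∑ x ∈ s, l x * (l a * es (s.erase x) j l) = l a * ((j + 1) * es s (j + 1) l) := by
        rw [← h2, Finset.mul_sum]
        apply Finset.sum_congr rfl; intros; ring
      rw [this]
      push_cast; ring

open Polynomial in
lemma splits_derivative {p : ℝ[X]} (hp : p.Splits) : (derivative p).Splits := by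
  rw [splits_iff_card_roots] at hp ⊢
  have h1 := card_roots_le_derivative p
  have h2 := natDegree_derivative_le p
  have h3 := card_roots' (derivative p)
  omega

open Polynomial in
lemma splits_iterate {p : ℝ[X]} (hp : p.Splits) (m : ℕ) : (derivative^[m] p).Splits := by
  induction m with
  | zero => simpa
  | succ m ih => rw [Function.iterate_succ_apply']; exact splits_derivative ih

open Polynomial in
lemma splits_laguerre {p : ℝ[X]} (hp : p.Splits) (x : ℝ) :
    p.eval x * (derivative (derivative p)).eval x ≤ ((derivative p).eval x) ^ 2 := by
  unfold Splits at hp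
  induction hp using Submonoid.closure_induction with
  | mem p hp =>
    rcases hp with ⟨a, rfl⟩ | ⟨a, rfl⟩ <;> simp
  | one => simp
  | mul p q _ _ hp hq =>
    simp only [derivative_mul, eval_mul, derivative_add, eval_add]
    nlinarith [mul_nonneg (sq_nonneg (p.eval x)) (sub_nonneg.2 hq),
      mul_nonneg (sq_nonneg (q.eval x)) (sub_nonneg.2 hp)]

open Polynomial in
lemma newton_weak (s : Finset ι) (l : ι → ℝ) (j : ℕ) :
    0 < es s (j + 2) l * es s j l → es s (j + 2) l * es s j l ≤ es s (j + 1) l ^ 2 := by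
  intro hpos
  by_cases hj : j + 2 ≤ s.card
  · obtain ⟨m, hm⟩ := Nat.exists_eq_add_of_le hj
    set p : ℝ[X] := ∏ i ∈ s, (X + C (l i)) with hp
    have hs : p.Splits := Splits.prod (fun i _ => Splits.X_add_C _)
    have h := splits_laguerre (splits_iterate hs m) 0
    rw [← coeff_zero_eq_eval_zero, ← coeff_zero_eq_eval_zero, ← coeff_zero_eq_eval_zero,
      coeff_derivative, coeff_derivative, coeff_derivative, coeff_iterate_derivative,
      coeff_iterate_derivative, coeff_iterate_derivative, hp,
      Finset.prod_X_add_C_coeff, Finset.prod_X_add_C_coeff, Finset.prod_X_add_C_coeff] at h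
    · have e0 : s.card - (0 + m) = j + 2 := by omega
      have e1 : s.card - (0 + 1 + m) = j + 1 := by omega
      have e2 : s.card - (0 + 1 + 1 + m) = j := by omega
      rw [e0, e1, e2] at h
      change (0 + m).descFactorial m • es s (j + 2) l * ((0 + 1 + 1 + m).descFactorial m • es s j l *
        _ * _) ≤ ((0 + 1 + m).descFactorial m • es s (j + 1) l * _) ^ 2 at h
      have d0 : (0 + m).descFactorial m = m.factorial := by simp [Nat.descFactorial_self]
      have d1 : (0 + 1 + m).descFactorial m = (m + 1) * m.factorial := by
        have := Nat.factorial_mul_descFactorial (n := 1 + m) (k := m) (by omega)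
        have e : 1 + m - m = 1 := by omega
        rw [e, Nat.factorial_one, one_mul] at this
        simp only [zero_add]
        rw [this, add_comm, Nat.factorial_succ]
      have d2 : 2 * (0 + 1 + 1 + m).descFactorial m = (m + 2) * ((m + 1) * m.factorial) := by
        have := Nat.factorial_mul_descFactorial (n := 2 + m) (k := m) (by omega)
        have e : 2 + m - m = 2 := by omega
        rw [e] at this
        simp only [zero_add]
        rw [show (1 + 1 + m) = 2 + m by ring]
        rw [show Nat.factorial 2 = 2 by rfl] at this
        rw [this, add_comm, Nat.factorial_succ, Nat.factorial_succ]
      have d2' : 2 * ((0 + 1 + 1 + m).descFactorial m : ℝ) = (m + 2) * ((m + 1) * m.factorial) := by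
        exact_mod_cast d2
      rw [d0, d1] at h
      simp only [nsmul_eq_mul] at h
      push_cast at h
      have hF : (0 : ℝ) < m.factorial := by exact_mod_cast Nat.factorial_pos m
      have h' : (m.factorial : ℝ) ^ 2 * (m + 1) * ((m + 2) * (es s (j + 2) l * es s j l))
          ≤ (m.factorial : ℝ) ^ 2 * (m + 1) * ((m + 1) * es s (j + 1) l ^ 2) := by
        have e : (m.factorial : ℝ) ^ 2 * (m + 1) * ((m + 2) * (es s (j + 2) l * es s j l))
          = (m.factorial * es s (j + 2) l) * ((2 * ((0 + 1 + 1 + m).descFactorial m : ℝ)) * es s j l) := by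
          rw [d2']; ring
        rw [e]
        calc _ = _ := ?_
          _ ≤ _ := h
          _ = _ := ?_
        · ring
        · ring
      have h2 := le_of_mul_le_mul_left h' (by positivity)
      have hm0 : (0 : ℝ) ≤ m := Nat.cast_nonneg m
      nlinarith
    all_goals omega
  · have : es s (j + 2) l = 0 := by
      unfold es
      rw [Finset.powersetCard_eq_empty.2 (by omega)]; simp
    rw [this] at hpos ⊢; simp at hpos

/-- The Gårding cone for vectors. -/
def GV (s : Finset ι) (k : ℕ) (l : ι → ℝ) : Prop := ∀ j, j ≤ k → 0 < es s j l

lemma GV.mono {s : Finset ι} {k m : ℕ} {l : ι → ℝ} (h : GV s k l) (hm : m ≤ k) : GV s m l :=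
  fun j hj => h j (hj.trans hm)

lemma GV.erase {s : Finset ι} {k : ℕ} {l : ι → ℝ} (h : GV s (k + 1) l) {i : ι} (hi : i ∈ s) :
    GV (s.erase i) k l := by
  intro j
  induction j with
  | zero => intro _; simp
  | succ j ih =>
    intro hj
    have h0 := ih (by omega)
    by_contra hneg
    push Not at hneg
    have h1 := h (j + 1) (by omega)
    have h2 := h (j + 2) (by omega)
    rw [es_erase hi] at h1 h2
    set a := es (s.erase i) j l
    set b := es (s.erase i) (j + 1) l
    set c := es (s.erase i) (j + 2) l with hc
    have hl : 0 < l i := by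
      by_contra hl; push Not at hl
      nlinarith
    have hcpos : 0 < c := by
      have : (0 : ℝ) ≤ - (l i * b) := by nlinarith
      have h2' : 0 < c + l i * b := h2
      linarith
    have hN := newton_weak (s.erase i) l j (mul_pos hcpos h0)
    change c * a ≤ b ^ 2 at hN
    have h2' : 0 < c + l i * b := h2
    nlinarith

/-- quotient `σ_{j+1}/σ_j`. -/
noncomputable def qq (s : Finset ι) (j : ℕ) (l : ι → ℝ) : ℝ := es s (j + 1) l / es s j l

lemma qq_formula {s : Finset ι} {j : ℕ} {l : ι → ℝ} (h : GV s (j + 1) l) :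
    (j + 2) * qq s (j + 1) l = ∑ i ∈ s, (l i - l i ^ 2 / (l i + qq (s.erase i) j l)) := by
  have hs := sum_mul_es_erase s l (j + 1)
  unfold qq
  have h1 := h (j + 1) le_rfl
  have : ((j : ℝ) + 2) * (es s (j + 1 + 1) l / es s (j + 1) l) =
      (∑ i ∈ s, l i * es (s.erase i) (j + 1) l) / es s (j + 1) l := by
    rw [hs]; push_cast; ring
  rw [this, Finset.sum_div]
  apply Finset.sum_congr rfl
  intro i hi
  have h0 := (h.erase hi) j le_rfl
  have he := es_erase hi j l
  have hne : l i + es (s.erase i) (j + 1) l / es (s.erase i) j l = es s (j + 1) l / es (s.erase i) j l := by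
    rw [he]; field_simp; ring
  rw [hne]
  field_simp
  rw [he]; ring

lemma den_pos {s : Finset ι} {j : ℕ} {l : ι → ℝ} (h : GV s (j + 1) l) {i : ι} (hi : i ∈ s) :
    0 < l i + qq (s.erase i) j l := by
  have h0 := (h.erase hi) j le_rfl
  have he := es_erase hi j l
  have hne : l i + qq (s.erase i) j l = es s (j + 1) l / es (s.erase i) j l := by
    unfold qq; rw [he]; field_simp; ring
  rw [hne]
  exact div_pos (h _ le_rfl) h0

lemma sq_div_add {a b y z Y : ℝ} (hy : 0 < y) (hz : 0 < z) (hY : y + z ≤ Y) :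
    (a + b) ^ 2 / Y ≤ a ^ 2 / y + b ^ 2 / z := by
  have : (a + b) ^ 2 / Y ≤ (a + b) ^ 2 / (y + z) := by
    apply div_le_div_of_nonneg_left (sq_nonneg _) (by linarith) hY
  refine this.trans ?_
  rw [div_add_div _ _ hy.ne' hz.ne', div_le_div_iff₀ (by linarith) (by positivity)]
  nlinarith [sq_nonneg (a * z - b * y), mul_pos hy hz]

lemma es_one_add (s : Finset ι) (l m : ι → ℝ) : es s 1 (l + m) = es s 1 l + es s 1 m := by
  have h := sum_mul_es_erase s (l + m) 0
  have h1 := sum_mul_es_erase s l 0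
  have h2 := sum_mul_es_erase s m 0
  simp only [es_zero, mul_one, Pi.add_apply, Finset.sum_add_distrib, Nat.cast_zero, zero_add,
    one_mul] at h h1 h2
  rw [← h, ← h1, ← h2]

lemma superadd (j : ℕ) : ∀ (s : Finset ι) (l m : ι → ℝ), GV s j l → GV s j m →
    GV s j (l + m) ∧ qq s j l + qq s j m ≤ qq s j (l + m) := by
  induction j with
  | zero =>
    intro s l m _ _
    refine ⟨?_, ?_⟩
    · intro j hj
      have : j = 0 := by omega
      subst this; simp
    · simp [qq, es_one_add]
  | succ j ih =>
    intro s l m hl hm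
    obtain ⟨h1, h2⟩ := ih s l m (hl.mono (by omega)) (hm.mono (by omega))
    have hpos : 0 < es s (j + 1) (l + m) := by
      have q1 : 0 < qq s j l := div_pos (hl _ le_rfl) (hl _ (by omega))
      have q2 : 0 < qq s j m := div_pos (hm _ le_rfl) (hm _ (by omega))
      have q3 : 0 < qq s j (l + m) := by linarith
      have := mul_pos q3 (h1 j le_rfl)
      unfold qq at this
      rwa [div_mul_cancel₀ _ (h1 j le_rfl).ne'] at this
    have hG : GV s (j + 1) (l + m) := by
      intro i hi
      rcases Nat.lt_or_ge i (j + 1) with h | h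
      · exact h1 i (by omega)
      · have : i = j + 1 := by omega
        rw [this]; exact hpos
    refine ⟨hG, ?_⟩
    have hj : (0 : ℝ) < j + 2 := by positivity
    refine le_of_mul_le_mul_left ?_ hj
    rw [mul_add, qq_formula hl, qq_formula hm, qq_formula hG, ← Finset.sum_add_distrib]
    apply Finset.sum_le_sum
    intro i hi
    have hd1 := den_pos hl hi
    have hd2 := den_pos hm hi
    have hih := (ih (s.erase i) l m (hl.erase hi) (hm.erase hi)).2
    have := sq_div_add (a := l i) (b := m i) (Y := (l + m) i + qq (s.erase i) j (l + m)) hd1 hd2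
      (by simp only [Pi.add_apply]; linarith)
    simp only [Pi.add_apply] at this ⊢
    linarith

lemma es_eq_prod_qq {s : Finset ι} {k : ℕ} {l : ι → ℝ} (h : GV s k l) :
    es s k l = ∏ j ∈ Finset.range k, qq s j l := by
  induction k with
  | zero => simp
  | succ k ih =>
    rw [Finset.prod_range_succ, ← ih (h.mono (by omega))]
    unfold qq
    rw [mul_div_cancel₀ _ (h k (by omega)).ne']

lemma es_smul (s : Finset ι) (k : ℕ) (c : ℝ) (l : ι → ℝ) : es s k (c • l) = c ^ k * es s k l := by
  unfold es
  rw [Finset.mul_sum]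
  apply Finset.sum_congr rfl
  intro t ht
  simp [Finset.prod_mul_distrib, (Finset.mem_powersetCard.1 ht).2]

lemma es_hasDerivAt (l m : ι → ℝ) (s : Finset ι) : ∀ k : ℕ,
    HasDerivAt (fun t : ℝ => es s (k + 1) (l + t • m)) (∑ i ∈ s, m i * es (s.erase i) k l) 0 := by
  induction s using Finset.induction_on with
  | empty => intro k; simp only [es_empty]; simpa using hasDerivAt_const (0 : ℝ) (0 : ℝ)
  | insert a s ha ih =>
    intro k
    simp only [es_insert ha]
    have hlin : HasDerivAt (fun t : ℝ => (l + t • m) a) (m a) 0 := by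
      simp only [Pi.add_apply, Pi.smul_apply, smul_eq_mul]
      simpa using ((hasDerivAt_id (0 : ℝ)).mul_const (m a)).const_add (l a)
    have key : ∀ i ∈ s, (insert a s).erase i = insert a (s.erase i) := by
      intro i hi
      rw [Finset.erase_insert_of_ne]
      rintro rfl; exact ha hi
    have hna : ∀ i, a ∉ s.erase i := fun i h => ha (Finset.mem_of_mem_erase h)
    cases k with
    | zero =>
      simp only [es_zero]
      have := (ih 0).add (hlin.mul_const (1 : ℝ))
      refine this.congr_deriv ?_
      rw [Finset.sum_insert ha]
      simp [add_comm]
    | succ k =>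
      have := (ih (k + 1)).add (hlin.mul (ih k))
      refine this.congr_deriv ?_
      rw [Finset.sum_insert ha, Finset.erase_insert ha]
      have e1 : ∑ i ∈ s, m i * es ((insert a s).erase i) (k + 1) l =
          ∑ i ∈ s, (m i * es (s.erase i) (k + 1) l + m i * (l a * es (s.erase i) k l)) :=
        Finset.sum_congr rfl (fun i hi => by rw [key i hi, es_insert (hna i) k l, mul_add])
      rw [e1, Finset.sum_add_distrib]
      simp only [zero_smul, add_zero]
      rw [Finset.mul_sum]
      have : ∑ x ∈ s, m x * (l a * es (s.erase x) k l) = ∑ x ∈ s, l a * (m x * es (s.erase x) k l) := by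
        apply Finset.sum_congr rfl; intros; ring
      rw [this]; ring

lemma one_add_sum_le_prod {α : Type*} (s : Finset α) (x : α → ℝ) (hx : ∀ i ∈ s, 0 ≤ x i) :
    1 + ∑ i ∈ s, x i ≤ ∏ i ∈ s, (1 + x i) := by
  classical
  induction s using Finset.induction_on with
  | empty => simp
  | insert a s ha ih =>
    rw [Finset.sum_insert ha, Finset.prod_insert ha]
    have h1 := ih (fun i hi => hx i (Finset.mem_insert_of_mem hi))
    have h2 := hx a (Finset.mem_insert_self _ _)
    have h3 : 0 ≤ ∑ i ∈ s, x i := Finset.sum_nonneg (fun i hi => hx i (Finset.mem_insert_of_mem hi))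
    nlinarith

/-- Gårding's inequality for vectors. -/
lemma garding_vec {s : Finset ι} {k : ℕ} {l m : ι → ℝ} (hl : GV s (k + 1) l) (hm : GV s (k + 1) m)
    {a b : ℝ} (ha : 0 < a) (hb : 0 < b) (hla : es s (k + 1) l = a ^ (k + 1))
    (hmb : es s (k + 1) m = b ^ (k + 1)) :
    (k + 1) * a ^ k * b ≤ ∑ i ∈ s, m i * es (s.erase i) k l := by
  have hql : ∀ j ∈ Finset.range (k + 1), 0 < qq s j l := fun j hj => by
    have := Finset.mem_range.1 hj
    exact div_pos (hl _ (by omega)) (hl _ (by omega))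
  have hqm : ∀ j ∈ Finset.range (k + 1), 0 < qq s j m := fun j hj => by
    have := Finset.mem_range.1 hj
    exact div_pos (hm _ (by omega)) (hm _ (by omega))
  set S := ∑ j ∈ Finset.range (k + 1), qq s j m / qq s j l with hS
  -- AM-GM
  have amgm : (k + 1) * (b / a) ≤ S := by
    have h := Real.geom_mean_le_arith_mean (Finset.range (k + 1)) (fun _ => 1)
      (fun j => qq s j m / qq s j l) (fun _ _ => zero_le_one) (by simp; positivity)
      (fun j hj => (div_pos (hqm j hj) (hql j hj)).le)
    simp only [Real.rpow_one, Finset.sum_const, Finset.card_range, nsmul_eq_mul, mul_one, one_mul] at h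
    rw [Finset.prod_div_distrib, ← es_eq_prod_qq hm, ← es_eq_prod_qq hl, hla, hmb, ← div_pow,
      Real.pow_rpow_inv_natCast (by positivity) (by omega), le_div_iff₀ (by positivity)] at h
    push_cast at h
    rw [mul_comm]; exact h
  -- difference quotient
  have hdq : ∀ t : ℝ, 0 < t → es s (k + 1) l * S ≤
      t⁻¹ • (es s (k + 1) (l + t • m) - es s (k + 1) (l + (0 : ℝ) • m)) := by
    intro t ht
    have hGt : GV s (k + 1) (t • m) := by
      intro j hj
      rw [es_smul]; exact mul_pos (pow_pos ht _) (hm j hj)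
    have hsup := superadd (k + 1) s l (t • m) hl hGt
    have e : es s (k + 1) l * (1 + t * S) ≤ es s (k + 1) (l + t • m) := by
      rw [es_eq_prod_qq hl, es_eq_prod_qq hsup.1]
      calc _ ≤ (∏ j ∈ Finset.range (k + 1), qq s j l) *
            ∏ j ∈ Finset.range (k + 1), (1 + t * (qq s j m / qq s j l)) := by
              apply mul_le_mul_of_nonneg_left _ (Finset.prod_nonneg fun j hj => (hql j hj).le)
              have := one_add_sum_le_prod (Finset.range (k + 1))
                (fun j => t * (qq s j m / qq s j l))
                (fun j hj => by have := hql j hj; have := hqm j hj; positivity)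
              rwa [← Finset.mul_sum] at this
        _ = ∏ j ∈ Finset.range (k + 1), (qq s j l + t * qq s j m) := by
            rw [← Finset.prod_mul_distrib]
            apply Finset.prod_congr rfl
            intro j hj
            have := hql j hj
            field_simp
        _ ≤ _ := by
            apply Finset.prod_le_prod
            · intro j hj; have := hql j hj; have := hqm j hj; positivity
            · intro j hj
              have hj' := Finset.mem_range.1 hj
              have h3 := (superadd j s l (t • m) (hl.mono (by omega)) (hGt.mono (by omega))).2
              have h4 : qq s j (t • m) = t * qq s j m := by
                unfold qq
                rw [es_smul, es_smul, pow_succ]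
                have := (hm j (by omega)).ne'
                field_simp
              rw [← h4]; exact h3
    rw [zero_smul, add_zero, smul_eq_mul, inv_mul_eq_div, le_div_iff₀ ht]
    linarith
  have hder := (es_hasDerivAt l m s k).tendsto_slope_zero_right
  have hlim : es s (k + 1) l * S ≤ ∑ i ∈ s, m i * es (s.erase i) k l := by
    refine ge_of_tendsto hder ?_
    filter_upwards [self_mem_nhdsWithin] with t ht
    have := hdq t ht
    simpa using this
  refine le_trans ?_ hlim
  rw [hla]
  calc _ = a ^ (k + 1) * ((k + 1) * (b / a)) := by rw [pow_succ]; field_simp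
    _ ≤ _ := mul_le_mul_of_nonneg_left amgm (by positivity)

lemma qq_le {s : Finset ι} {j : ℕ} {l : ι → ℝ} (h : GV s (j + 1) l) :
    (j + 2) * qq s (j + 1) l ≤ es s 1 l := by
  rw [qq_formula h]
  have h1 := sum_mul_es_erase s l 0
  simp only [es_zero, mul_one, Nat.cast_zero, zero_add, one_mul] at h1
  rw [← h1]
  apply Finset.sum_le_sum
  intro i hi
  have := den_pos h hi
  have : 0 ≤ l i ^ 2 / (l i + qq (s.erase i) j l) := by positivity
  linarith

/-- lower bound for `σ_{k;i}`. -/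
lemma es_erase_lower {s : Finset ι} {k : ℕ} {l : ι → ℝ} (h : GV s (k + 1) l) {i : ι} (hi : i ∈ s)
    {L : ℝ} (hL : ∀ j ∈ s, |l j| ≤ L) :
    es s (k + 1) l ≤ (s.card + 1) * L * es (s.erase i) k l := by
  have h0 := (h.erase hi) k le_rfl
  have hL0 : 0 ≤ L := (abs_nonneg _).trans (hL i hi)
  have hli : l i ≤ L := (le_abs_self _).trans (hL i hi)
  rw [es_erase hi]
  rcases le_or_gt (es (s.erase i) (k + 1) l) 0 with hneg | hpos
  · have : (0 : ℝ) ≤ s.card := Nat.cast_nonneg _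
    nlinarith [mul_nonneg (mul_nonneg this hL0) h0.le, mul_le_mul_of_nonneg_right hli h0.le]
  · have hG : GV (s.erase i) (k + 1) l := by
      intro j hj
      rcases Nat.lt_or_ge j (k + 1) with h' | h'
      · exact (h.erase hi) j (by omega)
      · have : j = k + 1 := by omega
        rw [this]; exact hpos
    have hs1 : es (s.erase i) 1 l ≤ s.card * L := by
      have h1 := sum_mul_es_erase (s.erase i) l 0
      simp only [es_zero, mul_one, Nat.cast_zero, zero_add, one_mul] at h1
      rw [← h1]
      calc _ ≤ ∑ j ∈ s.erase i, L := Finset.sum_le_sum fun j hj =>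
            (le_abs_self _).trans (hL j (Finset.mem_of_mem_erase hj))
        _ = (s.erase i).card * L := by simp
        _ ≤ _ := by gcongr; exact Finset.erase_subset _ _
    have hq : qq (s.erase i) k l ≤ es (s.erase i) 1 l := by
      cases k with
      | zero => simp [qq]
      | succ k =>
        have := qq_le (hG.mono (m := k + 1) (by omega))
        have hp : 0 < qq (s.erase i) (k + 1) l := div_pos hpos h0
        have hk : (0 : ℝ) ≤ k := Nat.cast_nonneg _
        nlinarith
    have : es (s.erase i) (k + 1) l = qq (s.erase i) k l * es (s.erase i) k l := by
      unfold qq; rw [div_mul_cancel₀ _ h0.ne']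
    rw [this]
    have h2 : qq (s.erase i) k l ≤ s.card * L := hq.trans hs1
    nlinarith [mul_le_mul_of_nonneg_right h2 h0.le, mul_le_mul_of_nonneg_right hli h0.le]

end
end RH

namespace RH
section
set_option linter.unusedSectionVars false
variable {n : ℕ}

lemma esymmMat_zero (A : Matrix (Fin n) (Fin n) ℝ) : esymmMat 0 A = 1 := by
  have h : A.charpoly.coeff A.charpoly.natDegree = 1 := A.charpoly_monic
  have h2 := A.charpoly_natDegree_eq_dim
  simp only [Fintype.card_fin] at h2
  rw [h2] at h
  unfold esymmMat
  rw [pow_zero, one_mul, Nat.sub_zero]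
  exact h

lemma newtonT_comm (A : Matrix (Fin n) (Fin n) ℝ) (j : ℕ) : newtonT j A * A = A * newtonT j A := by
  induction j with
  | zero => simp [newtonT]
  | succ j ih =>
    simp only [newtonT, sub_mul, mul_sub, Matrix.smul_mul, Matrix.mul_smul, Matrix.one_mul, Matrix.mul_one]
    rw [ih, Matrix.mul_assoc, ih]

lemma newtonT_symm {A : Matrix (Fin n) (Fin n) ℝ} (hA : Aᵀ = A) (j : ℕ) :
    (newtonT j A)ᵀ = newtonT j A := by
  induction j with
  | zero => simp [newtonT]
  | succ j ih =>
    simp only [newtonT, Matrix.transpose_sub, Matrix.transpose_smul, Matrix.transpose_one,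
      Matrix.transpose_mul, hA, ih]
    rw [newtonT_comm]

/-- partial sums of the characteristic polynomial -/
noncomputable def PP (A : Matrix (Fin n) (Fin n) ℝ) (m : ℕ) (t : ℝ) : ℝ :=
  ∑ j ∈ Finset.range (m + 1), (-1) ^ j * esymmMat j A * t ^ (m - j)

noncomputable def QQ (A : Matrix (Fin n) (Fin n) ℝ) (m : ℕ) (t : ℝ) : Matrix (Fin n) (Fin n) ℝ :=
  ∑ j ∈ Finset.range m, ((-1) ^ j * t ^ (m - 1 - j)) • newtonT j A

lemma PP_succ (A : Matrix (Fin n) (Fin n) ℝ) (m : ℕ) (t : ℝ) :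
    PP A (m + 1) t = t * PP A m t + (-1) ^ (m + 1) * esymmMat (m + 1) A := by
  unfold PP
  rw [Finset.sum_range_succ, Finset.mul_sum]
  congr 1
  · apply Finset.sum_congr rfl
    intro j hj
    have := Finset.mem_range.1 hj
    rw [show m + 1 - j = (m - j) + 1 by omega, pow_succ]; ring
  · simp

lemma QQ_succ (A : Matrix (Fin n) (Fin n) ℝ) (m : ℕ) (t : ℝ) :
    QQ A (m + 1) t = t • QQ A m t + ((-1) ^ m : ℝ) • newtonT m A := by
  unfold QQ
  rw [Finset.sum_range_succ, Finset.smul_sum]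
  congr 1
  · apply Finset.sum_congr rfl
    intro j hj
    have := Finset.mem_range.1 hj
    rw [show m + 1 - 1 - j = (m - 1 - j) + 1 by omega, pow_succ, smul_smul]
    congr 1; ring
  · simp

lemma mul_QQ (A : Matrix (Fin n) (Fin n) ℝ) (m : ℕ) (t : ℝ) :
    (t • (1 : Matrix (Fin n) (Fin n) ℝ) - A) * QQ A m t =
      PP A m t • (1 : Matrix (Fin n) (Fin n) ℝ) - ((-1) ^ m : ℝ) • newtonT m A := by
  induction m with
  | zero => simp [QQ, PP, newtonT, esymmMat_zero]
  | succ m ih =>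
    rw [QQ_succ, mul_add, Matrix.mul_smul, ih, PP_succ]
    simp only [newtonT, Matrix.mul_smul, sub_mul, Matrix.smul_mul, Matrix.one_mul, newtonT_comm]
    simp only [smul_sub, smul_smul, add_smul, pow_succ]
    module

lemma newtonT_sum (A : Matrix (Fin n) (Fin n) ℝ) (m : ℕ) :
    newtonT m A = ((-1) ^ m : ℝ) •
      ∑ j ∈ Finset.range (m + 1), ((-1) ^ j * esymmMat j A) • A ^ (m - j) := by
  induction m with
  | zero => simp [newtonT, esymmMat_zero]
  | succ m ih =>
    have e : (∑ j ∈ Finset.range (m + 1), ((-1) ^ j * esymmMat j A) • A ^ (m - j)) * A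
        = ∑ j ∈ Finset.range (m + 1), ((-1) ^ j * esymmMat j A) • A ^ (m + 1 - j) := by
      rw [Finset.sum_mul]
      apply Finset.sum_congr rfl
      intro j hj
      have := Finset.mem_range.1 hj
      rw [show m + 1 - j = (m - j) + 1 by omega, pow_succ, Matrix.smul_mul]
    rw [newtonT, Finset.sum_range_succ, ih, Matrix.smul_mul, e]
    simp only [Nat.sub_self, pow_zero]
    set S := ∑ j ∈ Finset.range (m + 1), ((-1) ^ j * esymmMat j A) • A ^ (m + 1 - j)
    rw [smul_add, smul_smul, ← mul_assoc, ← pow_add, ← two_mul, pow_mul]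
    simp only [pow_succ]
    norm_num
    module

lemma coeff_eq (A : Matrix (Fin n) (Fin n) ℝ) (j : ℕ) :
    (-1 : ℝ) ^ j * esymmMat j A = A.charpoly.coeff (n - j) := by
  unfold esymmMat
  rw [← mul_assoc, ← pow_add, ← two_mul, pow_mul]; norm_num

lemma newtonT_n (A : Matrix (Fin n) (Fin n) ℝ) : newtonT n A = 0 := by
  rw [newtonT_sum]
  have h := A.aeval_self_charpoly
  rw [Polynomial.aeval_eq_sum_range, A.charpoly_natDegree_eq_dim, Fintype.card_fin,
    ← Finset.sum_range_reflect] at h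
  have : ∑ j ∈ Finset.range (n + 1), ((-1 : ℝ) ^ j * esymmMat j A) • A ^ (n - j) = 0 := by
    rw [← h]
    apply Finset.sum_congr rfl
    intro j hj
    rw [coeff_eq]
    congr 2
  rw [this, smul_zero]

lemma PP_n (A : Matrix (Fin n) (Fin n) ℝ) (t : ℝ) :
    PP A n t = (t • (1 : Matrix (Fin n) (Fin n) ℝ) - A).det := by
  have h : A.charpoly.eval t = (t • (1 : Matrix (Fin n) (Fin n) ℝ) - A).det := by
    rw [Matrix.eval_charpoly]
    congr 1
    rw [Matrix.smul_one_eq_diagonal]; rfl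
  rw [← h, Polynomial.eval_eq_sum_range, A.charpoly_natDegree_eq_dim, Fintype.card_fin,
    ← Finset.sum_range_reflect]
  unfold PP
  apply Finset.sum_congr rfl
  intro j hj
  rw [coeff_eq]
  congr 2

lemma adj_expand (A : Matrix (Fin n) (Fin n) ℝ) {t : ℝ}
    (ht : (t • (1 : Matrix (Fin n) (Fin n) ℝ) - A).det ≠ 0) :
    (t • (1 : Matrix (Fin n) (Fin n) ℝ) - A).adjugate = QQ A n t := by
  have h := mul_QQ A n t
  rw [newtonT_n, smul_zero, sub_zero, PP_n] at h
  have h2 := congrArg (fun M => (t • (1 : Matrix (Fin n) (Fin n) ℝ) - A).adjugate * M) h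
  simp only [← Matrix.mul_assoc, Matrix.adjugate_mul, Matrix.smul_mul, Matrix.one_mul,
    Matrix.mul_smul, Matrix.mul_one] at h2
  exact (smul_right_injective _ ht h2).symm

lemma det_deriv (N B : Matrix (Fin n) (Fin n) ℝ) (hN : N.det ≠ 0) :
    HasDerivAt (fun s : ℝ => (N + s • B).det) (N.adjugate * B).trace 0 := by
  have e : ∀ s : ℝ, (N + s • B).det = N.det * (1 + s • (N⁻¹ * B)).det := by
    intro s
    rw [← Matrix.det_mul, Matrix.mul_add, Matrix.mul_one, Matrix.mul_smul, ← Matrix.mul_assoc,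
      Matrix.mul_nonsing_inv _ (isUnit_iff_ne_zero.2 hN), Matrix.one_mul]
  have e2 : (N.adjugate * B).trace = N.det * (N⁻¹ * B).trace := by
    rw [Matrix.inv_def, Matrix.smul_mul, Matrix.trace_smul, smul_eq_mul, ← mul_assoc,
      Ring.mul_inverse_cancel _ (isUnit_iff_ne_zero.2 hN), one_mul]
  simp_rw [e]
  rw [e2]
  apply HasDerivAt.const_mul
  have e3 : (fun s : ℝ => (1 + s • (N⁻¹ * B)).det) = fun s => _ :=
    funext fun s => Matrix.det_one_add_smul s (N⁻¹ * B)
  rw [e3]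
  set p := ((1 + (Polynomial.X : Polynomial ℝ) • (N⁻¹ * B).map Polynomial.C).det.divX.divX)
  have h := ((((hasDerivAt_id (0 : ℝ)).const_mul (N⁻¹ * B).trace).const_add 1).add
    ((p.hasDerivAt 0).mul ((hasDerivAt_id (0 : ℝ)).pow 2)))
  refine h.congr_deriv ?_
  simp

open Polynomial in
lemma coeff_unique (c c' : ℕ → ℝ) (S : Set ℝ) (hS : S.Finite)
    (h : ∀ t ∉ S, ∑ j ∈ Finset.range n, c j * t ^ (n - 1 - j) = ∑ j ∈ Finset.range n, c' j * t ^ (n - 1 - j)) :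
    ∀ j < n, c j = c' j := by
  set p : ℝ[X] := ∑ j ∈ Finset.range n, C (c j - c' j) * X ^ (n - 1 - j) with hp
  have hp0 : p = 0 := by
    apply eq_zero_of_infinite_isRoot
    refine Set.Infinite.mono ?_ hS.infinite_compl
    intro t ht
    have := h t ht
    simp only [Set.mem_setOf_eq, IsRoot, hp, eval_finset_sum, eval_mul, eval_C, eval_pow, eval_X,
      sub_mul, Finset.sum_sub_distrib]
    linarith
  intro i hi
  have hc : p.coeff (n - 1 - i) = c i - c' i := by
    rw [hp, finset_sum_coeff]
    simp only [coeff_C_mul, coeff_X_pow]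
    rw [Finset.sum_eq_single i]
    · simp
    · intro b hb hbi
      have := Finset.mem_range.1 hb
      rw [if_neg (by omega), mul_zero]
    · intro h; exact absurd (Finset.mem_range.2 hi) h
  rw [hp0, coeff_zero] at hc
  linarith

lemma finite_roots (A : Matrix (Fin n) (Fin n) ℝ) :
    {t : ℝ | (t • (1 : Matrix (Fin n) (Fin n) ℝ) - A).det = 0}.Finite := by
  have h := Polynomial.finite_setOf_isRoot A.charpoly_monic.ne_zero
  refine h.subset ?_
  intro t ht
  have h : A.charpoly.eval t = (t • (1 : Matrix (Fin n) (Fin n) ℝ) - A).det := by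
    rw [Matrix.eval_charpoly]
    congr 1
    rw [Matrix.smul_one_eq_diagonal]; rfl
  simp only [Set.mem_setOf_eq, Polynomial.IsRoot] at ht ⊢
  rw [h, ht]

lemma trace_QQ_mul (A B : Matrix (Fin n) (Fin n) ℝ) (t : ℝ) :
    (QQ A n t * B).trace = ∑ j ∈ Finset.range n, ((-1) ^ j * (newtonT j A * B).trace) * t ^ (n - 1 - j) := by
  unfold QQ
  rw [Finset.sum_mul, Matrix.trace_sum]
  apply Finset.sum_congr rfl
  intro j _
  rw [Matrix.smul_mul, Matrix.trace_smul, smul_eq_mul]; ring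

lemma trace_newtonT (A : Matrix (Fin n) (Fin n) ℝ) {j : ℕ} (hj : j < n) :
    (newtonT j A).trace = ((n : ℝ) - j) * esymmMat j A := by
  have key := coeff_unique (n := n) (fun j => (-1) ^ j * (newtonT j A).trace)
    (fun j => (-1) ^ j * (((n : ℝ) - j) * esymmMat j A)) _ (finite_roots A) ?_ j hj
  · have h1 : ((-1 : ℝ) ^ j) ≠ 0 := by positivity
    exact mul_left_cancel₀ h1 key
  intro t ht
  have hd := det_deriv (t • (1 : Matrix (Fin n) (Fin n) ℝ) - A) 1 ht
  rw [adj_expand A ht, trace_QQ_mul] at hd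
  simp only [Matrix.mul_one] at hd
  have e : ∀ s : ℝ, (t • (1 : Matrix (Fin n) (Fin n) ℝ) - A + s • 1).det = PP A n (t + s) := by
    intro s
    rw [PP_n]; congr 1; module
  simp_rw [e] at hd
  have hd2 : HasDerivAt (fun s : ℝ => PP A n (t + s))
      (∑ j ∈ Finset.range (n + 1), (-1) ^ j * esymmMat j A * (((n - j : ℕ) : ℝ) * t ^ (n - j - 1))) 0 := by
    unfold PP
    apply HasDerivAt.fun_sum
    intro j _
    apply HasDerivAt.const_mul
    have := ((hasDerivAt_id (0 : ℝ)).const_add t).pow (n - j)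
    refine this.congr_deriv ?_
    simp
  have := hd.unique hd2
  rw [this, Finset.sum_range_succ]
  simp only [Nat.sub_self, Nat.cast_zero, zero_mul, mul_zero, add_zero]
  apply Finset.sum_congr rfl
  intro i hi
  have := Finset.mem_range.1 hi
  rw [Nat.cast_sub this.le, show n - i - 1 = n - 1 - i by omega]; ring

lemma trace_newtonT_mul (A : Matrix (Fin n) (Fin n) ℝ) {j : ℕ} (hj : j < n) :
    (newtonT j A * A).trace = ((j : ℝ) + 1) * esymmMat (j + 1) A := by
  have h := trace_newtonT A hj
  have h1 : (newtonT (j + 1) A).trace = ((n : ℝ) - (j + 1)) * esymmMat (j + 1) A := by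
    rcases Nat.lt_or_ge (j + 1) n with h | h
    · rw [trace_newtonT A h]; push_cast; ring
    · have e : j + 1 = n := by omega
      have hz : newtonT (j + 1) A = 0 := by rw [e]; exact newtonT_n A
      have hc : (n : ℝ) = j + 1 := by exact_mod_cast e.symm
      rw [hz, hc]; simp
  rw [newtonT, Matrix.trace_sub, Matrix.trace_smul, Matrix.trace_one, Fintype.card_fin, smul_eq_mul] at h1
  linarith

lemma esymmMat_succ (A : Matrix (Fin n) (Fin n) ℝ) {j : ℕ} (hj : j < n) :
    esymmMat (j + 1) A = (∑ a, ∑ b, newtonT j A a b * A b a) / ((j : ℝ) + 1) := by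
  have h := trace_newtonT_mul A hj
  rw [eq_div_iff (by positivity), mul_comm, ← h]
  simp [Matrix.trace, Matrix.mul_apply]

lemma newtonT_succ_apply (A : Matrix (Fin n) (Fin n) ℝ) (j : ℕ) (a b : Fin n) :
    newtonT (j + 1) A a b = esymmMat (j + 1) A * (1 : Matrix (Fin n) (Fin n) ℝ) a b -
      ∑ c, newtonT j A a c * A c b := by
  simp [newtonT, Matrix.mul_apply]

lemma contDiff_newtonT {E : Type*} [NormedAddCommGroup E] [NormedSpace ℝ E] {m : WithTop ℕ∞}
    {A : E → Matrix (Fin n) (Fin n) ℝ} (hA : ∀ a b, ContDiff ℝ m (fun x => A x a b)) :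
    ∀ j, j ≤ n → (∀ a b, ContDiff ℝ m (fun x => newtonT j (A x) a b)) ∧
      ContDiff ℝ m (fun x => esymmMat j (A x)) := by
  intro j
  induction j with
  | zero =>
    intro _
    simp only [newtonT, esymmMat_zero]
    exact ⟨fun a b => contDiff_const, contDiff_const⟩
  | succ j ih =>
    intro hj
    obtain ⟨h1, h2⟩ := ih (by omega)
    have h3 : ContDiff ℝ m (fun x => esymmMat (j + 1) (A x)) := by
      simp_rw [fun x => esymmMat_succ (A x) (show j < n by omega)]
      exact (ContDiff.sum fun a _ => ContDiff.sum fun b _ => (h1 a b).mul (hA b a)).div_const _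
    refine ⟨fun a b => ?_, h3⟩
    simp_rw [newtonT_succ_apply]
    exact (h3.mul contDiff_const).sub (ContDiff.sum fun c _ => (h1 a c).mul (hA c b))

lemma bound_newtonT (j : ℕ) (hj : j ≤ n) : ∃ C : ℝ, 1 ≤ C ∧ ∀ (A : Matrix (Fin n) (Fin n) ℝ) (v : ℝ),
    0 ≤ v → (∀ a b, |A a b| ≤ v) →
      (∀ a b, |newtonT j A a b| ≤ C * v ^ j) ∧ |esymmMat j A| ≤ C * v ^ j := by
  induction j with
  | zero =>
    refine ⟨1, le_rfl, fun A v hv hA => ⟨fun a b => ?_, ?_⟩⟩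
    · simp only [newtonT, Matrix.one_apply]; split_ifs <;> simp
    · simp [esymmMat_zero]
  | succ j ih =>
    obtain ⟨C, hC, h⟩ := ih (by omega)
    refine ⟨n * n * C + n * C + 1, ?_, fun A v hv hA => ?_⟩
    · have : (0:ℝ) ≤ n * n * C + n * C := by positivity
      linarith
    obtain ⟨h1, h2⟩ := h A v hv hA
    have hm : ∀ a b c d, |newtonT j A a b * A c d| ≤ C * v ^ (j + 1) := by
      intro a b c d
      rw [abs_mul, pow_succ, ← mul_assoc]
      exact mul_le_mul (h1 a b) (hA c d) (abs_nonneg _) (by positivity)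
    have h3 : |esymmMat (j + 1) A| ≤ n * n * C * v ^ (j + 1) := by
      rw [esymmMat_succ A (by omega), abs_div]
      have h4 : |∑ a, ∑ b, newtonT j A a b * A b a| ≤ n * n * C * v ^ (j + 1) := by
        calc _ ≤ ∑ a : Fin n, ∑ b : Fin n, C * v ^ (j + 1) := by
              refine (Finset.abs_sum_le_sum_abs _ _).trans (Finset.sum_le_sum fun a _ => ?_)
              exact (Finset.abs_sum_le_sum_abs _ _).trans (Finset.sum_le_sum fun b _ => hm _ _ _ _)
          _ = _ := by simp; ring
      have h5 : (1 : ℝ) ≤ |(j : ℝ) + 1| := by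
        rw [abs_of_nonneg (by positivity)]; linarith [(Nat.cast_nonneg j : (0:ℝ) ≤ j)]
      rw [div_le_iff₀ (by linarith)]
      have : 0 ≤ n * n * C * v ^ (j + 1) := by positivity
      nlinarith
    have hnn : 0 ≤ n * C * v ^ (j + 1) := by positivity
    have hv' : 0 ≤ v ^ (j + 1) := by positivity
    refine ⟨fun a b => ?_, ?_⟩
    · rw [newtonT_succ_apply]
      have h6 : |∑ c, newtonT j A a c * A c b| ≤ n * C * v ^ (j + 1) := by
        calc _ ≤ ∑ c : Fin n, C * v ^ (j + 1) :=
              (Finset.abs_sum_le_sum_abs _ _).trans (Finset.sum_le_sum fun b _ => hm _ _ _ _)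
          _ = _ := by simp; ring
      have h7 : |esymmMat (j + 1) A * (1 : Matrix (Fin n) (Fin n) ℝ) a b| ≤ n * n * C * v ^ (j + 1) := by
        rw [abs_mul]
        refine le_trans ?_ h3
        have : |(1 : Matrix (Fin n) (Fin n) ℝ) a b| ≤ 1 := by
          simp only [Matrix.one_apply]; split_ifs <;> simp
        nlinarith [abs_nonneg (esymmMat (j + 1) A)]
      refine (abs_sub _ _).trans ?_
      nlinarith
    · nlinarith

/-- derivative of `σ_{j+1}` along a family. -/
lemma deriv_line (A B : Matrix (Fin n) (Fin n) ℝ) {j : ℕ} (hj : j < n) :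
    HasDerivAt (fun s : ℝ => esymmMat (j + 1) (A + s • B)) (newtonT j A * B).trace 0 := by
  have hdiff : ∀ j ≤ n, DifferentiableAt ℝ (fun s : ℝ => esymmMat j (A + s • B)) 0 := by
    intro j hj
    refine ((contDiff_newtonT (m := 1) (A := fun s : ℝ => A + s • B) ?_ j hj).2.differentiable
      one_ne_zero) 0
    intro a b
    simp only [Matrix.add_apply, Matrix.smul_apply, smul_eq_mul]
    fun_prop
  set d : ℕ → ℝ := fun j => deriv (fun s : ℝ => esymmMat j (A + s • B)) 0 with hd
  have hd' : ∀ j ≤ n, HasDerivAt (fun s : ℝ => esymmMat j (A + s • B)) (d j) 0 :=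
    fun j hj => (hdiff j hj).hasDerivAt
  have key := coeff_unique (n := n) (fun j => (-1) ^ (j + 1) * d (j + 1))
    (fun j => - ((-1) ^ j * (newtonT j A * B).trace)) _ (finite_roots A) ?_ j hj
  · have h1 : ((-1 : ℝ) ^ j) ≠ 0 := by positivity
    have : (newtonT j A * B).trace = d (j + 1) := by
      apply mul_left_cancel₀ h1
      simp only [pow_succ] at key
      linarith
    rw [this]
    exact hd' (j + 1) hj
  intro t ht
  have h1 := det_deriv (t • (1 : Matrix (Fin n) (Fin n) ℝ) - A) (-B) ht
  rw [adj_expand A ht, trace_QQ_mul] at h1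
  have e : ∀ s : ℝ, (t • (1 : Matrix (Fin n) (Fin n) ℝ) - A + s • (-B)).det = PP (A + s • B) n t := by
    intro s
    rw [PP_n]; congr 1; module
  simp_rw [e] at h1
  have h2 : HasDerivAt (fun s : ℝ => PP (A + s • B) n t)
      (∑ j ∈ Finset.range (n + 1), (-1) ^ j * d j * t ^ (n - j)) 0 := by
    unfold PP
    apply HasDerivAt.fun_sum
    intro j hj
    apply HasDerivAt.mul_const
    apply HasDerivAt.const_mul
    exact hd' j (by have := Finset.mem_range.1 hj; omega)
  have h3 := h1.unique h2
  rw [Finset.sum_range_succ'] at h3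
  have d0 : d 0 = 0 := by
    simp only [hd, esymmMat_zero]; simp
  rw [d0] at h3
  simp only [mul_zero, zero_mul, add_zero, Matrix.mul_neg, Matrix.trace_neg, mul_neg, neg_mul] at h3
  simp only [neg_mul]
  rw [h3]
  apply Finset.sum_congr rfl
  intro i _
  rw [show n - (i + 1) = n - 1 - i by omega]

lemma hasFDerivAt_esymm {E : Type*} [NormedAddCommGroup E] [NormedSpace ℝ E]
    {A : E → Matrix (Fin n) (Fin n) ℝ} {x : E} (hA : ∀ a b, DifferentiableAt ℝ (fun x => A x a b) x)
    {j : ℕ} (hj : j < n) (e : E) :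
    fderiv ℝ (fun x => esymmMat (j + 1) (A x)) x e =
      ∑ a, ∑ b, newtonT j (A x) a b * fderiv ℝ (fun x => A x b a) x e := by
  set g : (Fin n → Fin n → ℝ) → ℝ := fun a => esymmMat (j + 1) (Matrix.of a) with hg
  have hgd : Differentiable ℝ g := by
    refine (contDiff_newtonT (m := 1) (A := fun a : Fin n → Fin n → ℝ => Matrix.of a) ?_ (j + 1) hj).2.differentiable
      one_ne_zero
    intro a b
    simp only [Matrix.of_apply]
    fun_prop
  have hgl : ∀ a b : Fin n → Fin n → ℝ, fderiv ℝ g a b = (newtonT j (Matrix.of a) * Matrix.of b).trace := by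
    intro a b
    have h1 := deriv_line (Matrix.of a) (Matrix.of b) hj
    have h2 : HasDerivAt (fun s : ℝ => g (a + s • b)) (fderiv ℝ g a b) 0 := by
      have h3 : HasDerivAt (fun s : ℝ => a + s • b) b 0 := by
        simpa using ((hasDerivAt_id (0 : ℝ)).smul_const b).const_add a
      have h4 : HasFDerivAt g (fderiv ℝ g a) (a + (0 : ℝ) • b) := by
        simpa using (hgd a).hasFDerivAt
      exact h4.comp_hasDerivAt 0 h3
    exact h2.unique h1
  set α : E → Fin n → Fin n → ℝ := fun x a b => A x a b with hα
  have hαd : DifferentiableAt ℝ α x := by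
    rw [differentiableAt_pi]; intro a
    rw [differentiableAt_pi]; intro b
    exact hA a b
  have hc : fderiv ℝ (fun x => esymmMat (j + 1) (A x)) x = (fderiv ℝ g (α x)).comp (fderiv ℝ α x) := by
    exact fderiv_comp x (hgd _) hαd
  have hcomp : ∀ a b, fderiv ℝ α x e a b = fderiv ℝ (fun x => A x a b) x e := by
    intro a b
    have h1 := hαd.hasFDerivAt
    rw [hasFDerivAt_pi'] at h1
    have h2 := h1 a
    rw [hasFDerivAt_pi'] at h2
    have h3 := (h2 b).fderiv
    simp only [hα] at h3 ⊢
    rw [h3]; rfl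
  rw [hc, ContinuousLinearMap.comp_apply, hgl]
  simp only [Matrix.trace, Matrix.mul_apply, Matrix.diag_apply, Matrix.of_apply, hcomp]
  rfl

end
end RH

namespace RH
section
variable {n : ℕ}

lemma spectral (A : Matrix (Fin n) (Fin n) ℝ) (hA : Aᵀ = A) :
    ∃ (U : Matrix (Fin n) (Fin n) ℝ) (l : Fin n → ℝ), Uᵀ * U = 1 ∧ U * Uᵀ = 1 ∧
      A = U * Matrix.diagonal l * Uᵀ := by
  have h : A.IsHermitian := by
    rw [Matrix.IsHermitian, Matrix.conjTranspose_eq_transpose_of_trivial]; exact hA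
  have h1 := h.spectral_theorem
  rw [Unitary.conjStarAlgAut_apply] at h1
  refine ⟨h.eigenvectorUnitary, h.eigenvalues, ?_, ?_, ?_⟩
  · have := Unitary.coe_star_mul_self h.eigenvectorUnitary
    rwa [Matrix.star_eq_conjTranspose, Matrix.conjTranspose_eq_transpose_of_trivial] at this
  · have := Unitary.mul_star_self_of_mem h.eigenvectorUnitary.2
    rwa [Matrix.star_eq_conjTranspose, Matrix.conjTranspose_eq_transpose_of_trivial] at this
  · rw [Matrix.star_eq_conjTranspose, Matrix.conjTranspose_eq_transpose_of_trivial] at h1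
    exact h1

lemma spec_all {A U : Matrix (Fin n) (Fin n) ℝ} {l : Fin n → ℝ} (h1 : Uᵀ * U = 1) (h2 : U * Uᵀ = 1)
    (hA : A = U * Matrix.diagonal l * Uᵀ) : ∀ j, j ≤ n → esymmMat j A = es Finset.univ j l ∧
      newtonT j A = U * Matrix.diagonal (fun i => es (Finset.univ.erase i) j l) * Uᵀ := by
  intro j
  induction j with
  | zero => intro _; simp [esymmMat_zero, newtonT, h2]
  | succ j ih =>
    intro hj
    obtain ⟨ih1, ih2⟩ := ih (by omega)
    have hm : newtonT j A * A = U * Matrix.diagonal (fun i => es (Finset.univ.erase i) j l * l i) * Uᵀ := by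
      rw [ih2, hA]
      calc _ = U * Matrix.diagonal (fun i => es (Finset.univ.erase i) j l) * (Uᵀ * U) * Matrix.diagonal l * Uᵀ := by
            simp only [Matrix.mul_assoc]
        _ = _ := by rw [h1, Matrix.mul_one, Matrix.mul_assoc U, Matrix.diagonal_mul_diagonal]
    have hs : esymmMat (j + 1) A = es Finset.univ (j + 1) l := by
      have h3 := trace_newtonT_mul A (show j < n by omega)
      rw [hm, Matrix.mul_assoc, Matrix.trace_mul_comm, Matrix.mul_assoc, h1, Matrix.mul_one,
        Matrix.trace_diagonal] at h3
      have h4 := sum_mul_es_erase (Finset.univ : Finset (Fin n)) l j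
      have h5 : ((j : ℝ) + 1) ≠ 0 := by positivity
      apply mul_left_cancel₀ h5
      rw [← h3, ← h4]
      exact Finset.sum_congr rfl fun i _ => mul_comm _ _
    refine ⟨hs, ?_⟩
    rw [newtonT, hm, hs]
    have : es Finset.univ (j + 1) l • (1 : Matrix (Fin n) (Fin n) ℝ) =
        U * Matrix.diagonal (fun _ => es Finset.univ (j + 1) l) * Uᵀ := by
      rw [← Matrix.smul_one_eq_diagonal, Matrix.mul_smul, Matrix.mul_one, Matrix.smul_mul, h2]
    rw [this, ← Matrix.sub_mul, ← Matrix.mul_sub, Matrix.diagonal_sub]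
    congr 3
    ext i
    rw [es_erase (Finset.mem_univ i)]; ring

lemma gv_of_gamma {A U : Matrix (Fin n) (Fin n) ℝ} {l : Fin n → ℝ} (h1 : Uᵀ * U = 1) (h2 : U * Uᵀ = 1)
    (hA : A = U * Matrix.diagonal l * Uᵀ) {k : ℕ} (hk : k ≤ n) (hG : GammaPlus k A) :
    GV Finset.univ k l := by
  intro j hj
  rw [← (spec_all h1 h2 hA j (by omega)).1]
  rcases Nat.eq_zero_or_pos j with rfl | h
  · rw [esymmMat_zero]; norm_num
  · exact hG j h hj

lemma es_perm (σ : Equiv.Perm (Fin n)) (j : ℕ) (l : Fin n → ℝ) :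
    es Finset.univ j (fun i => l (σ i)) = es Finset.univ j l := by
  unfold es
  refine Finset.sum_equiv σ.finsetCongr ?_ ?_
  · intro t; simp [Finset.mem_powersetCard]
  · intro t _
    simp

lemma garding_mat {A B : Matrix (Fin n) (Fin n) ℝ} (hA : Aᵀ = A) (hB : Bᵀ = B) {k : ℕ} (hk : k + 1 ≤ n)
    (gA : GammaPlus (k + 1) A) (gB : GammaPlus (k + 1) B) {a b : ℝ} (ha : 0 < a) (hb : 0 < b)
    (hAa : esymmMat (k + 1) A = a ^ (k + 1)) (hBb : esymmMat (k + 1) B = b ^ (k + 1)) :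
    ((k : ℝ) + 1) * a ^ k * b ≤ (newtonT k A * B).trace := by
  obtain ⟨U, l, hU1, hU2, rfl⟩ := spectral A hA
  obtain ⟨V, m, hV1, hV2, rfl⟩ := spectral B hB
  have gl := gv_of_gamma hU1 hU2 rfl hk gA
  have gm := gv_of_gamma hV1 hV2 rfl hk gB
  rw [(spec_all hU1 hU2 rfl (k+1) hk).1] at hAa
  rw [(spec_all hV1 hV2 rfl (k+1) hk).1] at hBb
  rw [(spec_all hU1 hU2 rfl k (by omega)).2]
  set e : Fin n → ℝ := fun i => es (Finset.univ.erase i) k l with he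
  set P := Uᵀ * V with hP
  have hP1 : P * Pᵀ = 1 := by
    rw [hP, Matrix.transpose_mul, Matrix.transpose_transpose, Matrix.mul_assoc, ← Matrix.mul_assoc V, hV2,
      Matrix.one_mul, hU1]
  have hP2 : Pᵀ * P = 1 := by
    rw [hP, Matrix.transpose_mul, Matrix.transpose_transpose, Matrix.mul_assoc, ← Matrix.mul_assoc U, hU2,
      Matrix.one_mul, hV1]
  have ht : (U * Matrix.diagonal e * Uᵀ * (V * Matrix.diagonal m * Vᵀ)).trace = ∑ i, ∑ j, e i * P i j ^ 2 * m j := by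
    have : U * Matrix.diagonal e * Uᵀ * (V * Matrix.diagonal m * Vᵀ) = U * (Matrix.diagonal e * P * Matrix.diagonal m * Vᵀ) := by
      rw [hP]; simp only [Matrix.mul_assoc]
    rw [this, Matrix.trace_mul_comm, Matrix.mul_assoc (Matrix.diagonal e * P * Matrix.diagonal m)]
    have h3 : Vᵀ * U = Pᵀ := by rw [hP, Matrix.transpose_mul, Matrix.transpose_transpose]
    rw [h3]
    simp only [Matrix.trace, Matrix.diag_apply, Matrix.mul_apply (N := Pᵀ), Matrix.mul_diagonal, Matrix.diagonal_mul,
      Matrix.transpose_apply]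
    refine Finset.sum_congr rfl fun i _ => Finset.sum_congr rfl fun j _ => by ring
  rw [ht]
  let D : Matrix (Fin n) (Fin n) ℝ := Matrix.of fun i j => P i j ^ 2
  have hD : D ∈ doublyStochastic ℝ (Fin n) := by
    rw [mem_doublyStochastic_iff_sum]
    refine ⟨fun i j => sq_nonneg _, fun i => ?_, fun j => ?_⟩
    · have := congrFun (congrFun hP1 i) i
      simp only [Matrix.mul_apply, Matrix.transpose_apply, Matrix.one_apply_eq] at this
      rw [← this]; exact Finset.sum_congr rfl fun j _ => by simp [D, sq]
    · have := congrFun (congrFun hP2 j) j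
      simp only [Matrix.mul_apply, Matrix.transpose_apply, Matrix.one_apply_eq] at this
      rw [← this]; exact Finset.sum_congr rfl fun j _ => by simp [D, sq]
  obtain ⟨w, hw0, hw1, hw⟩ := exists_eq_sum_perm_of_mem_doublyStochastic hD
  have hDij : ∀ i j, P i j ^ 2 = ∑ σ : Equiv.Perm (Fin n), w σ * (if σ i = j then 1 else 0) := by
    intro i j
    have := congrFun (congrFun hw i) j
    rw [Matrix.sum_apply] at this
    simp only [Matrix.smul_apply, smul_eq_mul, Equiv.Perm.permMatrix, PEquiv.toMatrix_apply,
      Equiv.toPEquiv_apply] at this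
    rw [show P i j ^ 2 = D i j from rfl, ← this]
    refine Finset.sum_congr rfl fun σ _ => ?_
    simp
  have hsum : ∑ i, ∑ j, e i * P i j ^ 2 * m j = ∑ σ : Equiv.Perm (Fin n), w σ * ∑ i, m (σ i) * e i := by
    simp only [hDij, Finset.mul_sum, Finset.sum_mul]
    have : ∀ i, ∑ j, ∑ σ : Equiv.Perm (Fin n), e i * (w σ * (if σ i = j then 1 else 0)) * m j =
        ∑ σ : Equiv.Perm (Fin n), w σ * (m (σ i) * e i) := by
      intro i
      rw [Finset.sum_comm]
      refine Finset.sum_congr rfl fun σ _ => ?_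
      rw [Finset.sum_eq_single (σ i)]
      · simp; ring
      · intro b _ hb; rw [if_neg (Ne.symm hb)]; ring
      · simp
    rw [Finset.sum_congr rfl fun i _ => this i, Finset.sum_comm]
  rw [hsum]
  calc ((k : ℝ) + 1) * a ^ k * b = ∑ σ : Equiv.Perm (Fin n), w σ * (((k : ℝ) + 1) * a ^ k * b) := by
        rw [← Finset.sum_mul, hw1, one_mul]
    _ ≤ _ := by
        refine Finset.sum_le_sum fun σ _ => mul_le_mul_of_nonneg_left ?_ (hw0 σ)
        refine garding_vec gl (m := fun i => m (σ i)) ?_ ha hb hAa ?_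
        · intro j hj; rw [es_perm]; exact gm j hj
        · rw [es_perm]; exact hBb

lemma elliptic {A : Matrix (Fin n) (Fin n) ℝ} (hA : Aᵀ = A) {k : ℕ} (hk : k + 1 ≤ n)
    (gA : GammaPlus (k + 1) A) {v : ℝ} (hv : ∀ a b, |A a b| ≤ v) (x : Fin n → ℝ) :
    esymmMat (k + 1) A * ∑ a, x a ^ 2 ≤
      ((n : ℝ) + 1) * (n * v) * ∑ a, ∑ b, newtonT k A a b * x a * x b ∧
      0 ≤ ∑ a, ∑ b, newtonT k A a b * x a * x b := by
  obtain ⟨U, l, hU1, hU2, hUA⟩ := spectral A hA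
  have gl := gv_of_gamma hU1 hU2 hUA hk gA
  have hlU : ∀ i, l i = ∑ a, ∑ b, U a i * A a b * U b i := by
    intro i
    have h1 : Uᵀ * A * U = Matrix.diagonal l := by
      rw [hUA]
      calc _ = (Uᵀ * U) * Matrix.diagonal l * (Uᵀ * U) := by simp only [Matrix.mul_assoc]
        _ = _ := by rw [hU1]; simp
    have := congrFun (congrFun h1 i) i
    simp only [Matrix.mul_apply, Matrix.transpose_apply, Matrix.diagonal_apply_eq, Finset.sum_mul] at this
    rw [← this, Finset.sum_comm]
  have hUs : ∀ i, ∑ a, U a i ^ 2 = 1 := by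
    intro i
    have := congrFun (congrFun hU1 i) i
    simp only [Matrix.mul_apply, Matrix.transpose_apply, Matrix.one_apply_eq] at this
    rw [← this]; exact Finset.sum_congr rfl fun j _ => by ring
  have hle : ∀ j ∈ (Finset.univ : Finset (Fin n)), |l j| ≤ n * v := by
    intro i _
    have hv0 : 0 ≤ v := (abs_nonneg _).trans (hv i i)
    rw [hlU]
    calc _ ≤ ∑ a, ∑ b, |U a i| * v * |U b i| := by
          refine (Finset.abs_sum_le_sum_abs _ _).trans (Finset.sum_le_sum fun a _ => ?_)
          refine (Finset.abs_sum_le_sum_abs _ _).trans (Finset.sum_le_sum fun b _ => ?_)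
          rw [abs_mul, abs_mul]
          have := hv a b
          gcongr
      _ = v * (∑ a, |U a i|) ^ 2 := by
          rw [sq, Finset.sum_mul_sum, Finset.mul_sum]
          refine Finset.sum_congr rfl fun a _ => ?_
          rw [Finset.mul_sum]
          refine Finset.sum_congr rfl fun b _ => by ring
      _ ≤ v * (n * ∑ a, |U a i| ^ 2) := by
          have := sq_sum_le_card_mul_sum_sq (s := (Finset.univ : Finset (Fin n))) (f := fun a => |U a i|)
          simp only [Finset.card_univ, Fintype.card_fin] at this
          gcongr
      _ = n * v := by simp only [sq_abs, hUs]; ring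
  have hTq : ∑ a, ∑ b, newtonT k A a b * x a * x b =
      ∑ i, es (Finset.univ.erase i) k l * (∑ a, U a i * x a) ^ 2 := by
    rw [(spec_all hU1 hU2 hUA k (by omega)).2]
    simp only [Matrix.mul_apply (N := Uᵀ), Matrix.mul_diagonal, Matrix.transpose_apply, Finset.sum_mul]
    rw [Finset.sum_congr rfl fun a _ => Finset.sum_comm, Finset.sum_comm]
    refine Finset.sum_congr rfl fun i _ => ?_
    rw [sq, Finset.sum_mul_sum, Finset.mul_sum]
    refine Finset.sum_congr rfl fun a _ => ?_
    rw [Finset.mul_sum]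
    refine Finset.sum_congr rfl fun b _ => by ring
  have hx : ∑ a, x a ^ 2 = ∑ i, (∑ a, U a i * x a) ^ 2 := by
    have h3 : ∀ a b, ∑ i, U a i * U b i = if a = b then (1:ℝ) else 0 := by
      intro a b
      have := congrFun (congrFun hU2 a) b
      simpa only [Matrix.mul_apply, Matrix.transpose_apply, Matrix.one_apply] using this
    have : ∀ i, (∑ a, U a i * x a) ^ 2 = ∑ a, ∑ b, (U a i * U b i) * (x a * x b) := by
      intro i
      rw [sq, Finset.sum_mul_sum]
      refine Finset.sum_congr rfl fun a _ => Finset.sum_congr rfl fun b _ => by ring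
    rw [Finset.sum_congr rfl fun i _ => this i, Finset.sum_comm]
    refine Finset.sum_congr rfl fun a _ => ?_
    rw [Finset.sum_comm, Finset.sum_congr rfl fun b _ => (Finset.sum_mul _ _ _).symm]
    simp [h3, sq]
  refine ⟨?_, ?_⟩
  · rw [(spec_all hU1 hU2 hUA (k+1) hk).1, hx, hTq, Finset.mul_sum, Finset.mul_sum]
    refine Finset.sum_le_sum fun i _ => ?_
    have := es_erase_lower gl (Finset.mem_univ i) hle
    simp only [Finset.card_univ, Fintype.card_fin] at this
    rw [← mul_assoc]
    exact mul_le_mul_of_nonneg_right this (sq_nonneg _)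
  · rw [hTq]
    refine Finset.sum_nonneg fun i _ => mul_nonneg ?_ (sq_nonneg _)
    exact ((gl.erase (Finset.mem_univ i)) k le_rfl).le
end
end RH

namespace RH
section
variable {n : ℕ}

lemma pd_contDiff {m : ℕ} {u : (Fin n → ℝ) → ℝ} (hu : ContDiff ℝ (m + 1 : ℕ) u) (i : Fin n) :
    ContDiff ℝ (m : ℕ) (pd i u) := by
  have : ContDiff ℝ (m : ℕ) (fderiv ℝ u) := hu.fderiv_right (by push_cast; exact le_rfl)
  exact this.clm_apply contDiff_const

lemma pd_hcs {u : (Fin n → ℝ) → ℝ} (hu : HasCompactSupport u) (i : Fin n) :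
    HasCompactSupport (pd i u) := by
  exact hu.fderiv_apply ℝ (Pi.single i 1)

open scoped Convolution ContDiff in
lemma pd_conv {g φ : (Fin n → ℝ) → ℝ} (hφ : Continuous φ) (hg : ContDiff ℝ 1 g) (hc : HasCompactSupport g)
    (i : Fin n) :
    pd i (φ ⋆[ContinuousLinearMap.lsmul ℝ ℝ, volume] g) =
      (φ ⋆[ContinuousLinearMap.lsmul ℝ ℝ, volume] pd i g) := by
  ext x
  have h := hc.hasFDerivAt_convolution_right (ContinuousLinearMap.lsmul ℝ ℝ) (μ := volume)
    (hφ.locallyIntegrable) hg x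
  unfold pd
  rw [h.fderiv, convolution_precompR_apply _ hφ.locallyIntegrable (hc.fderiv ℝ)
    (hg.continuous_fderiv one_ne_zero)]

open scoped Convolution ContDiff in
lemma mollify {u : (Fin n → ℝ) → ℝ} (hu : ContDiff ℝ 2 u) (hc : HasCompactSupport u) {δ : ℝ} (hδ : 0 < δ) :
    ∃ u' : (Fin n → ℝ) → ℝ, ContDiff ℝ 3 u' ∧
      ∀ i j x, |pd i (pd j u') x - pd i (pd j u) x| ≤ δ := by
  have h1 : ∀ j, ContDiff ℝ 1 (pd j u) := fun j => pd_contDiff (m := 1) (by exact_mod_cast hu) j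
  have h2 : ∀ i j, ContDiff ℝ 0 (pd i (pd j u)) := fun i j =>
    pd_contDiff (m := 0) (by exact_mod_cast h1 j) i
  have hr : ∃ r > 0, ∀ i j (x y : Fin n → ℝ), dist x y < r → dist (pd i (pd j u) x) (pd i (pd j u) y) ≤ δ := by
    have : ∀ p : Fin n × Fin n, ∃ r > 0, ∀ (x y : Fin n → ℝ), dist x y < r →
        dist (pd p.1 (pd p.2 u) x) (pd p.1 (pd p.2 u) y) ≤ δ := by
      rintro ⟨i, j⟩
      have huc : UniformContinuous (pd i (pd j u)) :=
        (pd_hcs (pd_hcs hc j) i).uniformContinuous_of_continuous (h2 i j).continuous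
      obtain ⟨r, hr, h⟩ := Metric.uniformContinuous_iff.1 huc δ hδ
      exact ⟨r, hr, fun x y hxy => (h hxy).le⟩
    choose r hr h using this
    by_cases hne : Nonempty (Fin n × Fin n)
    · obtain ⟨p, hp⟩ := Finite.exists_min r
      exact ⟨r p, hr p, fun i j x y hxy => h (i, j) x y (hxy.trans_le (hp (i, j)))⟩
    · exact ⟨1, one_pos, fun i j => (hne ⟨(i, j)⟩).elim⟩
  obtain ⟨r, hr, h⟩ := hr
  let φ : ContDiffBump (0 : Fin n → ℝ) := ⟨r / 2, r, by positivity, by linarith⟩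
  have hφc : Continuous (φ.normed volume) := φ.continuous_normed
  refine ⟨φ.normed volume ⋆[ContinuousLinearMap.lsmul ℝ ℝ, volume] u, ?_, ?_⟩
  · exact φ.hasCompactSupport_normed.contDiff_convolution_left _ φ.contDiff_normed
      hu.continuous.locallyIntegrable
  · intro i j x
    rw [pd_conv hφc (hu.of_le (by norm_num)) hc, pd_conv hφc (h1 j) (pd_hcs hc j)]
    exact φ.dist_normed_convolution_le (h2 i j).continuous.aestronglyMeasurable
      fun y hy => h i j y x hy

/-- `T_{j-1}`, with `T_{-1} = 0`. -/
noncomputable def Tm : ℕ → Matrix (Fin n) (Fin n) ℝ → Matrix (Fin n) (Fin n) ℝ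
  | 0, _ => 0
  | (j + 1), A => newtonT j A

lemma mul_Tm (A : Matrix (Fin n) (Fin n) ℝ) (j : ℕ) : A * Tm j A = esymmMat j A • 1 - newtonT j A := by
  cases j with
  | zero => simp [Tm, newtonT, esymmMat_zero]
  | succ j => simp [Tm, newtonT, newtonT_comm]

lemma pd_add {f g : (Fin n → ℝ) → ℝ} {x} (hf : DifferentiableAt ℝ f x) (hg : DifferentiableAt ℝ g x) (i : Fin n) :
    pd i (fun y => f y + g y) x = pd i f x + pd i g x := by
  unfold pd; rw [fderiv_fun_add hf hg]; rfl

lemma pd_sub {f g : (Fin n → ℝ) → ℝ} {x} (hf : DifferentiableAt ℝ f x) (hg : DifferentiableAt ℝ g x) (i : Fin n) :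
    pd i (fun y => f y - g y) x = pd i f x - pd i g x := by
  unfold pd; rw [fderiv_fun_sub hf hg]; rfl

lemma pd_mul {f g : (Fin n → ℝ) → ℝ} {x} (hf : DifferentiableAt ℝ f x) (hg : DifferentiableAt ℝ g x) (i : Fin n) :
    pd i (fun y => f y * g y) x = f x * pd i g x + pd i f x * g x := by
  unfold pd; rw [fderiv_fun_mul hf hg]; simp; ring

lemma pd_sum {ι : Type*} {s : Finset ι} {f : ι → (Fin n → ℝ) → ℝ} {x}
    (hf : ∀ a ∈ s, DifferentiableAt ℝ (f a) x) (i : Fin n) :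
    pd i (fun y => ∑ a ∈ s, f a y) x = ∑ a ∈ s, pd i (f a) x := by
  unfold pd; rw [fderiv_fun_sum hf]; simp

lemma pd_const (c : ℝ) (i : Fin n) (x) : pd i (fun _ => c) x = 0 := by
  unfold pd; simp

lemma pd_congr {f g : (Fin n → ℝ) → ℝ} {x} (h : f =ᶠ[nhds x] g) (i : Fin n) : pd i f x = pd i g x := by
  unfold pd; rw [h.fderiv_eq]

lemma pd_comm_at {u : (Fin n → ℝ) → ℝ} {x} (hu : ContDiffAt ℝ 2 u x) (i j : Fin n) :
    pd i (pd j u) x = pd j (pd i u) x := by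
  have h := hu.isSymmSndFDerivAt (by simp)
  have hd : DifferentiableAt ℝ (fderiv ℝ u) x :=
    (hu.fderiv_right (m := 1) (by norm_num)).differentiableAt one_ne_zero
  have e : ∀ i j : Fin n, pd i (pd j u) x = fderiv ℝ (fderiv ℝ u) x (Pi.single i 1) (Pi.single j 1) := by
    intro i j
    unfold pd
    rw [fderiv_clm_apply hd (differentiableAt_const _)]
    simp
  rw [e, e]
  exact h _ _

lemma pd_comm {u : (Fin n → ℝ) → ℝ} (hu : ContDiff ℝ 2 u) (i j : Fin n) :
    pd i (pd j u) = pd j (pd i u) := funext fun x => pd_comm_at hu.contDiffAt i j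

/-- augmented Hessian with scalar `h`. -/
noncomputable def AH (u h : (Fin n → ℝ) → ℝ) (x : Fin n → ℝ) : Matrix (Fin n) (Fin n) ℝ :=
  hess u x - h x • (1 : Matrix (Fin n) (Fin n) ℝ)

lemma AH_apply (u h : (Fin n → ℝ) → ℝ) (x : Fin n → ℝ) (a b : Fin n) :
    AH u h x a b = pd a (pd b u) x - h x * (1 : Matrix (Fin n) (Fin n) ℝ) a b := by
  simp [AH, hess]

lemma AH_contDiff {u h : (Fin n → ℝ) → ℝ} {m : ℕ} (hu : ContDiff ℝ (m + 2 : ℕ) u) (hh : ContDiff ℝ m h) (a b : Fin n) :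
    ContDiff ℝ m (fun x => AH u h x a b) := by
  simp only [AH_apply]
  exact (pd_contDiff (m := m) (pd_contDiff (m := m + 1) hu b) a).sub (hh.mul contDiff_const)

lemma AH_symm {u h : (Fin n → ℝ) → ℝ} (hu : ContDiff ℝ 2 u) (x) : (AH u h x)ᵀ = AH u h x := by
  ext a b
  rw [Matrix.transpose_apply, AH_apply, AH_apply, pd_comm hu a b]
  simp [Matrix.one_apply, eq_comm]

lemma div_newton {u h : (Fin n → ℝ) → ℝ} (hu : ContDiff ℝ 3 u) (hh : ContDiff ℝ 1 h) (x : Fin n → ℝ) :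
    ∀ j, j ≤ n → ∀ m, ∑ a, pd a (fun y => newtonT j (AH u h y) a m) x =
      -((n : ℝ) - j) * ∑ a, Tm j (AH u h x) a m * pd a h x := by
  have hAc : ∀ a b, ContDiff ℝ 1 (fun x => AH u h x a b) := fun a b =>
    AH_contDiff (m := 1) (by exact_mod_cast hu) hh a b
  have hAd : ∀ a b, DifferentiableAt ℝ (fun x => AH u h x a b) x := fun a b =>
    (hAc a b).differentiable one_ne_zero x
  have hu1 : ∀ b, ContDiff ℝ 2 (pd b u) := fun b => pd_contDiff (m := 2) (by exact_mod_cast hu) b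
  have hu2 : ∀ a b, ContDiff ℝ 1 (pd a (pd b u)) := fun a b => pd_contDiff (m := 1) (by exact_mod_cast (hu1 b)) a
  have hAp : ∀ a b c, pd c (fun x => AH u h x a b) x =
      pd c (pd a (pd b u)) x - pd c h x * (1 : Matrix (Fin n) (Fin n) ℝ) a b := by
    intro a b c
    simp only [AH_apply]
    rw [pd_sub ((hu2 a b).differentiable one_ne_zero x)
      (((hh.differentiable one_ne_zero) x).mul_const _),
      pd_mul ((hh.differentiable one_ne_zero) x) (differentiableAt_const _), pd_const]
    ring
  have hu3 : ∀ a b c, pd c (pd a (pd b u)) x = pd a (pd c (pd b u)) x := by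
    intro a b c
    rw [pd_comm (hu1 b)]
  have hu4 : ∀ a b, pd a (pd b u) = pd b (pd a u) := fun a b => pd_comm (hu.of_le (by norm_num)) a b
  intro j
  induction j with
  | zero =>
    intro _ m
    simp [newtonT, Tm, pd_const]
  | succ j ih =>
    intro hj m
    have ih := ih (by omega)
    have hTd : ∀ a b, DifferentiableAt ℝ (fun y => newtonT j (AH u h y) a b) x := fun a b =>
      ((contDiff_newtonT hAc j (by omega)).1 a b).differentiable one_ne_zero x
    have hsd : DifferentiableAt ℝ (fun y => esymmMat (j + 1) (AH u h y)) x :=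
      ((contDiff_newtonT hAc (j+1) (by omega)).2).differentiable one_ne_zero x
    set A := AH u h x with hA
    set T := newtonT j A with hT
    have e1 : ∀ a, pd a (fun y => newtonT (j + 1) (AH u h y) a m) x =
        pd a (fun y => esymmMat (j + 1) (AH u h y)) x * (1 : Matrix (Fin n) (Fin n) ℝ) a m -
        ∑ c, (T a c * pd a (fun y => AH u h y c m) x + pd a (fun y => newtonT j (AH u h y) a c) x * A c m) := by
      intro a
      simp only [newtonT_succ_apply]
      rw [pd_sub (hsd.mul_const _) (DifferentiableAt.fun_sum fun c _ => (hTd a c).fun_mul (hAd c m)),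
        pd_mul hsd (differentiableAt_const _), pd_const, pd_sum (fun c _ => (hTd a c).fun_mul (hAd c m))]
      simp only [pd_mul (hTd _ _) (hAd _ _)]
      ring
    have e2 : pd m (fun y => esymmMat (j + 1) (AH u h y)) x =
        ∑ a, ∑ c, T a c * pd m (fun y => AH u h y c a) x := hasFDerivAt_esymm hAd (by omega) _
    have e3 : ∑ a, pd a (fun y => esymmMat (j + 1) (AH u h y)) x * (1 : Matrix (Fin n) (Fin n) ℝ) a m =
        pd m (fun y => esymmMat (j + 1) (AH u h y)) x := by
      simp [Matrix.one_apply]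
    have e4 : ∑ a, ∑ c, pd a (fun y => newtonT j (AH u h y) a c) x * A c m =
        -((n : ℝ) - j) * ∑ a, (A * Tm j A) m a * pd a h x := by
      rw [Finset.sum_comm]
      simp_rw [← Finset.sum_mul]
      simp_rw [ih]
      have hAs : ∀ a b, A a b = A b a := fun a b =>
        congrFun (congrFun (AH_symm (h := h) (hu.of_le (by norm_num)) x) b) a
      have hTs : ∀ a b, Tm j A a b = Tm j A b a := by
        intro a b
        cases j with
        | zero => simp [Tm]
        | succ j =>
          exact congrFun (congrFun (newtonT_symm (AH_symm (h := h) (hu.of_le (by norm_num)) x) j) b) a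
      simp only [Matrix.mul_apply, Finset.sum_mul, Finset.mul_sum]
      rw [Finset.sum_comm]
      refine Finset.sum_congr rfl fun a _ => Finset.sum_congr rfl fun b _ => ?_
      rw [hTs b a, hAs m b]; ring
    have e5 := trace_newtonT A (show j < n by omega)
    have e6 : ∑ a, ∑ c, (T a c * pd m (fun y => AH u h y c a) x - T a c * pd a (fun y => AH u h y c m) x) =
        -(((n : ℝ) - j) * esymmMat j A) * pd m h x + ∑ a, T a m * pd a h x := by
      have : ∀ a c, T a c * pd m (fun y => AH u h y c a) x - T a c * pd a (fun y => AH u h y c m) x =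
          -(T a c * (1 : Matrix (Fin n) (Fin n) ℝ) c a) * pd m h x +
            T a c * (1 : Matrix (Fin n) (Fin n) ℝ) c m * pd a h x := by
        intro a c
        rw [hAp, hAp, hu3 c a m, hu3 c m a, hu4 m a]; ring
      simp_rw [this, Finset.sum_add_distrib, ← Finset.sum_mul]
      rw [← e5]
      simp [Matrix.one_apply, Matrix.trace, hT]
    have e7 : ∑ a, (A * Tm j A) m a * pd a h x = esymmMat j A * pd m h x - ∑ a, T a m * pd a h x := by
      rw [mul_Tm]
      have hTs : ∀ a b, T a b = T b a := fun a b =>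
          congrFun (congrFun (newtonT_symm (AH_symm (h := h) (hu.of_le (by norm_num)) x) j) b) a
      simp only [Matrix.sub_apply, Matrix.smul_apply, smul_eq_mul, sub_mul, Finset.sum_sub_distrib]
      congr 1
      · simp [Matrix.one_apply]
      · exact Finset.sum_congr rfl fun a _ => by rw [← hT, hTs]
    have : Tm (j + 1) A = T := rfl
    rw [this]
    rw [Finset.sum_congr rfl fun a _ => e1 a, Finset.sum_sub_distrib, e3, e2]
    simp_rw [Finset.sum_add_distrib]
    rw [e4, e7]
    simp_rw [Finset.sum_sub_distrib] at e6
    push_cast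
    linarith [e6]
end
end RH

namespace RH
section
variable {n : ℕ}

lemma tendsto_int {F : ℕ → (Fin n → ℝ) → ℝ} {F0 g : (Fin n → ℝ) → ℝ} {C : ℝ} (hFc : ∀ m, Continuous (F m))
    (hg : Integrable g) (hb : ∀ m x, g x ≠ 0 → |F m x| ≤ C)
    (ht : ∀ x, Filter.Tendsto (fun m => F m x) Filter.atTop (nhds (F0 x))) :
    Filter.Tendsto (fun m => ∫ x, F m x * g x) Filter.atTop (nhds (∫ x, F0 x * g x)) := by
  refine tendsto_integral_of_dominated_convergence (fun x => C * |g x|) ?_ ?_ ?_ ?_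
  · intro m; exact (hFc m).aestronglyMeasurable.mul hg.aestronglyMeasurable
  · exact hg.abs.const_mul C
  · intro m
    refine Filter.Eventually.of_forall fun x => ?_
    by_cases h : g x = 0
    · simp [h]
    · rw [Real.norm_eq_abs, abs_mul]
      exact mul_le_mul_of_nonneg_right (hb m x h) (abs_nonneg _)
  · refine Filter.Eventually.of_forall fun x => (ht x).mul_const _

lemma newton_cont (j : ℕ) (hj : j ≤ n) (a b : Fin n) :
    Continuous (fun A : Fin n → Fin n → ℝ => newtonT j (Matrix.of A) a b) := by
  refine ((contDiff_newtonT (m := 0) (A := fun a : Fin n → Fin n → ℝ => Matrix.of a) ?_ j hj).1 a b).continuous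
  intro a b
  simp only [Matrix.of_apply]
  fun_prop

lemma Tm_cont (j : ℕ) (hj : j ≤ n) (a b : Fin n) :
    Continuous (fun A : Fin n → Fin n → ℝ => Tm j (Matrix.of A) a b) := by
  cases j with
  | zero => simp only [Tm]; exact continuous_const
  | succ j => exact newton_cont j (by omega) a b

lemma bound_Tm (j : ℕ) (hj : j ≤ n) : ∃ C : ℝ, 1 ≤ C ∧ ∀ (A : Matrix (Fin n) (Fin n) ℝ) (v : ℝ),
    0 ≤ v → (∀ a b, |A a b| ≤ v) → (∀ a b, |Tm j A a b| ≤ C * v ^ (j - 1)) := by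
  cases j with
  | zero => exact ⟨1, le_rfl, fun A v hv h a b => by simp [Tm]⟩
  | succ j =>
    obtain ⟨C, hC, h⟩ := bound_newtonT (n := n) j (by omega)
    exact ⟨C, hC, fun A v hv hA a b => (h A v hv hA).1 a b⟩

lemma lip_int {X ζ : (Fin n → ℝ) → ℝ} {L : NNReal}
    (hX : LipschitzWith L X) (hζ : ContDiff ℝ 1 ζ) (hζc : HasCompactSupport ζ) (a : Fin n) :
    Integrable (fun x => X x * pd a ζ x + lineDeriv ℝ X x (Pi.single a 1) * ζ x) := by
  refine Integrable.add ?_ ?_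
  · refine Continuous.integrable_of_hasCompactSupport
      (hX.continuous.mul (pd_contDiff (m := 0) (by exact_mod_cast hζ) a).continuous) ?_
    exact (pd_hcs hζc a).mul_left
  · refine Integrable.bdd_mul (c := L * ‖(Pi.single a 1 : Fin n → ℝ)‖) (hζ.continuous.integrable_of_hasCompactSupport hζc)
      ((measurable_lineDeriv hX.continuous).aestronglyMeasurable) ?_
    exact Filter.Eventually.of_forall fun x => norm_lineDeriv_le_of_lipschitz ℝ hX

lemma weak_div_smooth {u h X ζ : (Fin n → ℝ) → ℝ} (hu : ContDiff ℝ 3 u) (hh : ContDiff ℝ 1 h) {L : NNReal}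
    (hX : LipschitzWith L X) (hζ : ContDiff ℝ 1 ζ) (hζc : HasCompactSupport ζ) {j : ℕ} (hj : j ≤ n) (b : Fin n) :
    ∑ a, ∫ x, newtonT j (AH u h x) a b * (X x * pd a ζ x + lineDeriv ℝ X x (Pi.single a 1) * ζ x) =
      ((n : ℝ) - j) * ∑ a, ∫ x, Tm j (AH u h x) a b * (pd a h x * X x * ζ x) := by
  have hAc : ∀ a b, ContDiff ℝ 1 (fun x => AH u h x a b) := fun a b =>
    AH_contDiff (m := 1) (by exact_mod_cast hu) hh a b
  have hTc : ∀ a, ContDiff ℝ 1 (fun x => newtonT j (AH u h x) a b) := fun a =>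
    (contDiff_newtonT hAc j hj).1 a b
  have hTmc : ∀ a, Continuous (fun x => Tm j (AH u h x) a b) := fun a =>
    (Tm_cont j hj a b).comp (continuous_pi fun a => continuous_pi fun b => (hAc a b).continuous)
  have e1 : ∀ a, ∫ x, newtonT j (AH u h x) a b * (X x * pd a ζ x + lineDeriv ℝ X x (Pi.single a 1) * ζ x) =
      ∫ x, -(pd a (fun y => newtonT j (AH u h y) a b) x * (X x * ζ x)) := by
    intro a
    set T : (Fin n → ℝ) → ℝ := fun x => newtonT j (AH u h x) a b with hT
    have hg : ContDiff ℝ 1 (fun x => T x * ζ x) := (hTc a).mul hζ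
    have hgc : HasCompactSupport (fun x => T x * ζ x) := hζc.mul_left
    obtain ⟨D, hD⟩ := ContDiff.lipschitzWith_of_hasCompactSupport hgc hg one_ne_zero
    have h1 := hX.integral_lineDeriv_mul_eq (μ := volume) hD hgc (Pi.single a 1)
    have h2 : ∀ x, lineDeriv ℝ (fun x => T x * ζ x) x (-Pi.single a 1) = -(T x * pd a ζ x + pd a T x * ζ x) := by
      intro x
      rw [(hg.differentiable one_ne_zero x).lineDeriv_eq_fderiv, map_neg]
      congr 1
      exact pd_mul ((hTc a).differentiable one_ne_zero x) (hζ.differentiable one_ne_zero x) a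
    simp_rw [h2] at h1
    have i1 : Integrable (fun x => T x * (X x * pd a ζ x)) :=
      ((hTc a).continuous.mul (hX.continuous.mul (pd_contDiff (m := 0) (by exact_mod_cast hζ) a).continuous)).integrable_of_hasCompactSupport
        ((pd_hcs hζc a).mul_left.mul_left)
    have i2 : Integrable (fun x => lineDeriv ℝ X x (Pi.single a 1) * (T x * ζ x)) := by
      refine Integrable.bdd_mul (c := L * ‖(Pi.single a 1 : Fin n → ℝ)‖) (hg.continuous.integrable_of_hasCompactSupport hgc)
        ((measurable_lineDeriv hX.continuous).aestronglyMeasurable) ?_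
      exact Filter.Eventually.of_forall fun x => norm_lineDeriv_le_of_lipschitz ℝ hX
    have i3 : Integrable (fun x => -(T x * pd a ζ x + pd a T x * ζ x) * X x) := by
      refine Continuous.integrable_of_hasCompactSupport ?_ ?_
      · refine Continuous.mul (Continuous.neg (Continuous.add ?_ ?_)) hX.continuous
        · exact (hTc a).continuous.mul (pd_contDiff (m := 0) (by exact_mod_cast hζ) a).continuous
        · exact (pd_contDiff (m := 0) (by exact_mod_cast hTc a) a).continuous.mul hζ.continuous
      · exact (((pd_hcs hζc a).mul_left (f := T)).add (hζc.mul_left (f := pd a T))).neg.mul_right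
    calc _ = ∫ x, (T x * (X x * pd a ζ x) + lineDeriv ℝ X x (Pi.single a 1) * (T x * ζ x)) := by
          congr 1; ext x; ring
      _ = ∫ x, (T x * (X x * pd a ζ x) + -(T x * pd a ζ x + pd a T x * ζ x) * X x) := by
          rw [integral_add i1 i2, h1, ← integral_add i1 i3]
      _ = _ := by congr 1; ext x; ring
  simp_rw [e1]
  rw [← integral_finsetSum, ← integral_finsetSum, ← integral_const_mul]
  · congr 1
    ext x
    have := div_newton hu hh x j hj b
    rw [Finset.sum_neg_distrib, ← Finset.sum_mul, this, Finset.mul_sum, Finset.mul_sum, Finset.sum_mul,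
      ← Finset.sum_neg_distrib]
    refine Finset.sum_congr rfl fun a _ => by ring
  · intro a _
    refine Continuous.integrable_of_hasCompactSupport
      ((hTmc a).mul (((pd_contDiff (m := 0) (by exact_mod_cast hh) a).continuous.mul hX.continuous).mul hζ.continuous)) ?_
    exact hζc.mul_left.mul_left
  · intro a _
    refine Continuous.integrable_of_hasCompactSupport
      (((pd_contDiff (m := 0) (by exact_mod_cast hTc a) a).continuous.mul (hX.continuous.mul hζ.continuous)).neg) ?_
    exact hζc.mul_left.mul_left.neg

lemma weak_div {u h X ζ : (Fin n → ℝ) → ℝ} (hu : ContDiff ℝ 2 u) (huc : HasCompactSupport u)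
    (hh : ContDiff ℝ 1 h) {L : NNReal}
    (hX : LipschitzWith L X) (hζ : ContDiff ℝ 1 ζ) (hζc : HasCompactSupport ζ) {j : ℕ} (hj : j ≤ n) (b : Fin n) :
    ∑ a, ∫ x, newtonT j (AH u h x) a b * (X x * pd a ζ x + lineDeriv ℝ X x (Pi.single a 1) * ζ x) =
      ((n : ℝ) - j) * ∑ a, ∫ x, Tm j (AH u h x) a b * (pd a h x * X x * ζ x) := by
  have hδ : ∀ m : ℕ, ∃ u' : (Fin n → ℝ) → ℝ, ContDiff ℝ 3 u' ∧
      ∀ i j x, |pd i (pd j u') x - pd i (pd j u) x| ≤ 1 / ((m : ℝ) + 1) := fun m =>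
    mollify hu huc (by positivity)
  choose um hum hclose using hδ
  have hAm : ∀ m a b x, |AH (um m) h x a b - AH u h x a b| ≤ 1 / ((m : ℝ) + 1) := by
    intro m a b x
    rw [AH_apply, AH_apply]
    convert hclose m a b x using 2
    ring
  have hAt : ∀ a b x, Filter.Tendsto (fun m => AH (um m) h x a b) Filter.atTop (nhds (AH u h x a b)) := by
    intro a b x
    rw [tendsto_iff_dist_tendsto_zero]
    refine squeeze_zero (fun _ => dist_nonneg) (fun m => hAm m a b x) ?_
    exact tendsto_one_div_add_atTop_nhds_zero_nat
  have hAt' : ∀ x, Filter.Tendsto (fun m => (fun a b => AH (um m) h x a b : Fin n → Fin n → ℝ)) Filter.atTop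
      (nhds (fun a b => AH u h x a b : Fin n → Fin n → ℝ)) := by
    intro x
    exact tendsto_pi_nhds.2 fun a => tendsto_pi_nhds.2 fun b => hAt a b x
  have hAc : ∀ a b, ContDiff ℝ 0 (fun x => AH u h x a b) := fun a b =>
    AH_contDiff (m := 0) (by exact_mod_cast hu) (hh.of_le zero_le_one) a b
  have hAcm : ∀ m a b, ContDiff ℝ 0 (fun x => AH (um m) h x a b) := fun m a b =>
    AH_contDiff (m := 0) (by exact_mod_cast (hum m).of_le (by norm_num)) (hh.of_le zero_le_one) a b
  obtain ⟨B, hB⟩ : ∃ B, ∀ x ∈ tsupport ζ, ∀ a b, |AH u h x a b| ≤ B := by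
    have : Continuous (fun x => ∑ a, ∑ b, |AH u h x a b|) :=
      continuous_finsetSum _ fun a _ => continuous_finsetSum _ fun b _ => (hAc a b).continuous.abs
    obtain ⟨B, hB⟩ := (IsCompact.bddAbove_image (hζc : IsCompact (tsupport ζ)) this.continuousOn)
    refine ⟨B, fun x hx a b => ?_⟩
    refine le_trans ?_ (hB ⟨x, hx, rfl⟩)
    refine le_trans ?_ (Finset.single_le_sum (f := fun a => ∑ b, |AH u h x a b|)
      (fun a _ => Finset.sum_nonneg fun b _ => abs_nonneg _) (Finset.mem_univ a))
    exact Finset.single_le_sum (f := fun b => |AH u h x a b|) (fun b _ => abs_nonneg _) (Finset.mem_univ b)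
  have hBm : ∀ m, ∀ x ∈ tsupport ζ, ∀ a b, |AH (um m) h x a b| ≤ |B| + 1 := by
    intro m x hx a b
    have h1 := hAm m a b x
    have h2 := hB x hx a b
    have h3 : 1 / ((m : ℝ) + 1) ≤ 1 := by
      rw [div_le_one (by positivity)]; linarith [(Nat.cast_nonneg m : (0:ℝ) ≤ m)]
    have h4 := abs_sub_abs_le_abs_sub (AH (um m) h x a b) (AH u h x a b)
    linarith [le_abs_self B]
  have hz : ∀ x, x ∉ tsupport ζ → ζ x = 0 ∧ ∀ a, pd a ζ x = 0 := by
    intro x hx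
    refine ⟨image_eq_zero_of_notMem_tsupport hx, fun a => ?_⟩
    have : fderiv ℝ ζ x = 0 := by
      by_contra hne
      exact hx (support_fderiv_subset ℝ hne)
    simp [pd, this]
  obtain ⟨C1, hC1, hC1b⟩ := bound_newtonT (n := n) j hj
  obtain ⟨C2, hC2, hC2b⟩ := bound_Tm (n := n) j hj
  have hl : Filter.Tendsto (fun m => ∑ a, ∫ x, newtonT j (AH (um m) h x) a b *
      (X x * pd a ζ x + lineDeriv ℝ X x (Pi.single a 1) * ζ x)) Filter.atTop
      (nhds (∑ a, ∫ x, newtonT j (AH u h x) a b * (X x * pd a ζ x + lineDeriv ℝ X x (Pi.single a 1) * ζ x))) := by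
    refine tendsto_finsetSum _ fun a _ => ?_
    refine tendsto_int (C := C1 * (|B| + 1) ^ j) ?_ (lip_int hX hζ hζc a) ?_ ?_
    · intro m; exact ((contDiff_newtonT (hAcm m) j hj).1 a b).continuous
    · intro m x hx
      have hxs : x ∈ tsupport ζ := by
        by_contra hh'
        obtain ⟨h1, h2⟩ := hz x hh'
        exact hx (by simp [h1, h2])
      exact (hC1b _ _ (by positivity) (hBm m x hxs)).1 a b
    · intro x
      exact ((newton_cont j hj a b).tendsto _).comp (hAt' x)
  have hr : Filter.Tendsto (fun m => ((n : ℝ) - j) * ∑ a, ∫ x, Tm j (AH (um m) h x) a b * (pd a h x * X x * ζ x))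
      Filter.atTop
      (nhds (((n : ℝ) - j) * ∑ a, ∫ x, Tm j (AH u h x) a b * (pd a h x * X x * ζ x))) := by
    refine Filter.Tendsto.const_mul _ (tendsto_finsetSum _ fun a _ => ?_)
    refine tendsto_int (C := C2 * (|B| + 1) ^ (j - 1)) ?_ ?_ ?_ ?_
    · intro m
      exact (Tm_cont j hj a b).comp (continuous_pi fun a => continuous_pi fun b => (hAcm m a b).continuous)
    · refine Continuous.integrable_of_hasCompactSupport
        (((pd_contDiff (m := 0) (by exact_mod_cast hh) a).continuous.mul hX.continuous).mul hζ.continuous) ?_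
      exact hζc.mul_left
    · intro m x hx
      have hxs : x ∈ tsupport ζ := by
        by_contra hh'
        obtain ⟨h1, h2⟩ := hz x hh'
        exact hx (by simp [h1])
      exact hC2b _ _ (by positivity) (hBm m x hxs) a b
    · intro x
      exact ((Tm_cont j hj a b).tendsto _).comp (hAt' x)
  refine tendsto_nhds_unique hl ?_
  simp_rw [fun m => weak_div_smooth (hum m) hh hX hζ hζc hj b]
  exact hr
end
end RH

namespace RH
section
variable {n : ℕ}

lemma zero_off {ζ : (Fin n → ℝ) → ℝ} {K : Set (Fin n → ℝ)} (h : tsupport ζ ⊆ K) {x} (hx : x ∉ K) :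
    ζ x = 0 ∧ ∀ a, pd a ζ x = 0 := by
  have hx' : x ∉ tsupport ζ := fun h' => hx (h h')
  refine ⟨image_eq_zero_of_notMem_tsupport hx', fun a => ?_⟩
  have : fderiv ℝ ζ x = 0 := by
    by_contra hne
    exact hx' (support_fderiv_subset ℝ hne)
  simp [pd, this]

lemma R_bound (j : ℕ) (hj : j ≤ n) (C : ℝ) (hC : 1 ≤ C) : ∃ C' : ℝ, 1 ≤ C' ∧
    ∀ (K : Set (Fin n → ℝ)) (u h X ζ v : (Fin n → ℝ) → ℝ) (L : NNReal) (b : Fin n),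
    ContDiff ℝ 2 u → HasCompactSupport u → ContDiff ℝ 1 h → LipschitzWith L X →
    ContDiff ℝ 1 ζ → HasCompactSupport ζ → tsupport ζ ⊆ K → IsCompact K → ContinuousOn v K →
    (∀ x ∈ K, 1 ≤ v x) → (∀ x, 0 ≤ ζ x) → 
    (∀ x ∈ K, |X x| ≤ C) → (∀ x ∈ K, ∀ a, |lineDeriv ℝ X x (Pi.single a 1)| ≤ C * v x) →
    (∀ x ∈ K, ∀ a, |pd a h x| ≤ C * v x) → (∀ x ∈ K, ∀ a b, |AH u h x a b| ≤ C * v x) →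
    |∑ a, ∫ x, newtonT j (AH u h x) a b * (X x * pd a ζ x)| ≤ C' * ∫ x in K, v x ^ (j + 1) * ζ x := by
  obtain ⟨C1, hC1, hC1b⟩ := bound_newtonT (n := n) j hj
  obtain ⟨C2, hC2, hC2b⟩ := bound_Tm (n := n) j hj
  refine ⟨n * (C1 * C ^ (j + 1)) + n * (n * (C2 * C ^ (j + 1) * C)) + 1, ?_, ?_⟩
  · have : 0 ≤ n * (C1 * C ^ (j + 1)) + n * (n * (C2 * C ^ (j + 1) * C)) := by positivity
    linarith
  intro K u h X ζ v L b hu huc hh hX hζ hζc hζK hK hv hv1 hζ0 hXC hX' hhC hAC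
  have hAc : ∀ a b, ContDiff ℝ 0 (fun x => AH u h x a b) := fun a b =>
    AH_contDiff (m := 0) (by exact_mod_cast hu) (hh.of_le zero_le_one) a b
  have hTc : ∀ a, Continuous (fun x => newtonT j (AH u h x) a b) := fun a =>
    ((contDiff_newtonT hAc j hj).1 a b).continuous
  have wd := weak_div hu huc hh hX hζ hζc hj b
  have i1 : ∀ a, Integrable (fun x => newtonT j (AH u h x) a b * (X x * pd a ζ x)) := fun a =>
    ((hTc a).mul (hX.continuous.mul (pd_contDiff (m := 0) (by exact_mod_cast hζ) a).continuous)).integrable_of_hasCompactSupport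
        ((pd_hcs hζc a).mul_left.mul_left)
  have i2 : ∀ a, Integrable (fun x => newtonT j (AH u h x) a b * (lineDeriv ℝ X x (Pi.single a 1) * ζ x)) := by
    intro a
    have : Integrable (fun x => lineDeriv ℝ X x (Pi.single a 1) * (newtonT j (AH u h x) a b * ζ x)) := by
      refine Integrable.bdd_mul (c := L * ‖(Pi.single a 1 : Fin n → ℝ)‖)
        (((hTc a).mul hζ.continuous).integrable_of_hasCompactSupport hζc.mul_left)
        ((measurable_lineDeriv hX.continuous).aestronglyMeasurable) ?_
      exact Filter.Eventually.of_forall fun x => norm_lineDeriv_le_of_lipschitz ℝ hX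
    refine this.congr (Filter.Eventually.of_forall fun x => ?_)
    simp only []
    ring
  have iK : IntegrableOn (fun x => v x ^ (j + 1) * ζ x) K :=
    ContinuousOn.integrableOn_compact hK ((hv.pow _).mul hζ.continuous.continuousOn)
  have b1 : ∀ a, |∫ x, newtonT j (AH u h x) a b * (lineDeriv ℝ X x (Pi.single a 1) * ζ x)| ≤
      C1 * C ^ (j + 1) * ∫ x in K, v x ^ (j + 1) * ζ x := by
    intro a
    rw [← setIntegral_eq_integral_of_forall_compl_eq_zero (s := K)
      (fun x hx => by rw [(zero_off hζK hx).1]; ring), ← integral_const_mul]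
    rw [← Real.norm_eq_abs]
    refine norm_integral_le_of_norm_le (iK.const_mul _) ?_
    refine (ae_restrict_iff' hK.measurableSet).2 (Filter.Eventually.of_forall fun x hx => ?_)
    have hvx : 0 ≤ v x := by linarith [hv1 x hx]
    have h1 := (hC1b _ _ (mul_nonneg (by linarith) hvx) (hAC x hx)).1 a b
    have h2 := hX' x hx a
    rw [Real.norm_eq_abs, abs_mul, abs_mul, abs_of_nonneg (hζ0 x), ← mul_assoc, ← mul_assoc]
    refine mul_le_mul_of_nonneg_right ?_ (hζ0 x)
    calc _ ≤ (C1 * (C * v x) ^ j) * (C * v x) := mul_le_mul h1 h2 (abs_nonneg _) (by positivity)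
      _ = _ := by rw [mul_pow]; ring
  have b2 : ∀ a, |∫ x, Tm j (AH u h x) a b * (pd a h x * X x * ζ x)| ≤
      C2 * C ^ (j + 1) * C * ∫ x in K, v x ^ (j + 1) * ζ x := by
    intro a
    rw [← setIntegral_eq_integral_of_forall_compl_eq_zero (s := K)
      (fun x hx => by rw [(zero_off hζK hx).1]; ring), ← integral_const_mul]
    rw [← Real.norm_eq_abs]
    refine norm_integral_le_of_norm_le (iK.const_mul _) ?_
    refine (ae_restrict_iff' hK.measurableSet).2 (Filter.Eventually.of_forall fun x hx => ?_)
    have hvx : 0 ≤ v x := by linarith [hv1 x hx]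
    have h1 := (hC2b _ _ (mul_nonneg (by linarith) hvx) (hAC x hx)) a b
    have h2 := hhC x hx a
    have h3 := hXC x hx
    rw [Real.norm_eq_abs, abs_mul, abs_mul, abs_mul, abs_of_nonneg (hζ0 x), ← mul_assoc, ← mul_assoc, ← mul_assoc]
    refine mul_le_mul_of_nonneg_right ?_ (hζ0 x)
    have hCv : 1 ≤ C * v x := by nlinarith [hv1 x hx]
    calc _ ≤ (C2 * (C * v x) ^ (j - 1)) * (C * v x) * C := by gcongr
      _ ≤ (C2 * (C * v x) ^ j) * (C * v x) * C := by
        gcongr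
        omega
      _ = _ := by rw [mul_pow]; ring
  have hsplit : ∑ a, ∫ x, newtonT j (AH u h x) a b * (X x * pd a ζ x) =
      ((n : ℝ) - j) * (∑ a, ∫ x, Tm j (AH u h x) a b * (pd a h x * X x * ζ x)) -
      ∑ a, ∫ x, newtonT j (AH u h x) a b * (lineDeriv ℝ X x (Pi.single a 1) * ζ x) := by
    rw [← wd, ← Finset.sum_sub_distrib]
    refine Finset.sum_congr rfl fun a _ => ?_
    rw [eq_sub_iff_add_eq, ← integral_add (i1 a) (i2 a)]
    congr 1; ext x; ring
  rw [hsplit]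
  set I := ∫ x in K, v x ^ (j + 1) * ζ x with hI
  have hI0 : 0 ≤ I := setIntegral_nonneg hK.measurableSet fun x hx =>
    mul_nonneg (pow_nonneg (by linarith [hv1 x hx]) _) (hζ0 x)
  have s1 : |∑ a, ∫ x, newtonT j (AH u h x) a b * (lineDeriv ℝ X x (Pi.single a 1) * ζ x)| ≤
      n * (C1 * C ^ (j + 1) * I) := by
    refine (Finset.abs_sum_le_sum_abs _ _).trans ((Finset.sum_le_sum fun a _ => b1 a).trans ?_)
    simp
  have s2 : |∑ a, ∫ x, Tm j (AH u h x) a b * (pd a h x * X x * ζ x)| ≤ n * (C2 * C ^ (j + 1) * C * I) := by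
    refine (Finset.abs_sum_le_sum_abs _ _).trans ((Finset.sum_le_sum fun a _ => b2 a).trans ?_)
    simp
  have s3 : |((n : ℝ) - j)| ≤ n := by
    have : (j : ℝ) ≤ n := by exact_mod_cast hj
    rw [abs_of_nonneg (by linarith)]; linarith [(Nat.cast_nonneg j : (0:ℝ) ≤ j)]
  refine (abs_sub _ _).trans ?_
  rw [abs_mul]
  have := mul_le_mul s3 s2 (abs_nonneg _) (by positivity)
  nlinarith

/-- rpow cut-off regularity -/
lemma cut_contDiff {m : ℕ} {η w : (Fin n → ℝ) → ℝ} (hη : ContDiff ℝ m η) (hw : ContDiff ℝ m w)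
    (hpos : ∀ x ∈ tsupport η, 0 < w x) (s : ℝ) : ContDiff ℝ m (fun x => η x * w x ^ s) := by
  rw [contDiff_iff_contDiffAt]
  intro x
  by_cases hx : x ∈ tsupport η
  · exact hη.contDiffAt.mul (hw.contDiffAt.rpow_const_of_ne (hpos x hx).ne')
  · have : (fun x => η x * w x ^ s) =ᶠ[nhds x] fun _ => 0 := by
      filter_upwards [(isClosed_tsupport η).isOpen_compl.mem_nhds hx] with y hy
      rw [image_eq_zero_of_notMem_tsupport hy, zero_mul]
    exact contDiffAt_const.congr_of_eventuallyEq this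

lemma cut_tsupport {η w : (Fin n → ℝ) → ℝ} : tsupport (fun x => η x * w x) ⊆ tsupport η := by
  refine closure_mono ?_
  intro x hx
  simp only [Function.mem_support] at hx ⊢
  exact fun h => hx (by rw [h, zero_mul])

lemma cut_pd {η w : (Fin n → ℝ) → ℝ} (hη : ContDiff ℝ 1 η) (hw : ContDiff ℝ 1 w)
    (hpos : ∀ x ∈ tsupport η, 0 < w x) (s : ℝ) (a : Fin n) (x : Fin n → ℝ) :
    pd a (fun x => η x * w x ^ s) x = η x * (s * w x ^ (s - 1) * pd a w x) + pd a η x * w x ^ s := by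
  by_cases hx : x ∈ tsupport η
  · have hwd := hw.differentiable one_ne_zero x
    have hd : HasFDerivAt (fun x => w x ^ s) ((s * w x ^ (s - 1)) • fderiv ℝ w x) x :=
      hwd.hasFDerivAt.rpow_const (Or.inl (hpos x hx).ne')
    rw [pd_mul (hη.differentiable one_ne_zero x) hd.differentiableAt]
    congr 2
    unfold pd
    rw [hd.fderiv]; simp
  · obtain ⟨h1, h2⟩ := zero_off (ζ := η) (K := tsupport η) le_rfl hx
    have := (zero_off (ζ := fun x => η x * w x ^ s) (K := tsupport η) cut_tsupport hx).2 a
    rw [this, h1, h2]; ring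
end
end RH

namespace RH
section
variable {n : ℕ}

/-- bilinear form of a matrix -/
def bl (M : Matrix (Fin n) (Fin n) ℝ) (x y : Fin n → ℝ) : ℝ := ∑ a, ∑ b, M a b * x a * y b

lemma sym_app {M : Matrix (Fin n) (Fin n) ℝ} (h : Mᵀ = M) (a b : Fin n) : M a b = M b a :=
  congrFun (congrFun h b) a

lemma bl_bound {M : Matrix (Fin n) (Fin n) ℝ} {x y : Fin n → ℝ} {m X Y : ℝ} (hm : 0 ≤ m) (hX : 0 ≤ X)
    (hM : ∀ a b, |M a b| ≤ m) (hx : ∀ a, |x a| ≤ X) (hy : ∀ a, |y a| ≤ Y) :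
    |bl M x y| ≤ n * (n * (m * X * Y)) := by
  unfold bl
  refine (Finset.abs_sum_le_sum_abs _ _).trans ?_
  calc _ ≤ ∑ a : Fin n, ∑ b : Fin n, m * X * Y := by
        refine Finset.sum_le_sum fun a _ => (Finset.abs_sum_le_sum_abs _ _).trans ?_
        refine Finset.sum_le_sum fun b _ => ?_
        rw [abs_mul, abs_mul]
        exact mul_le_mul (mul_le_mul (hM a b) (hx a) (abs_nonneg _) hm) (hy b) (abs_nonneg _) (by positivity)
    _ = _ := by simp

lemma bl_symm {M : Matrix (Fin n) (Fin n) ℝ} (h : Mᵀ = M) (x y : Fin n → ℝ) : bl M x y = bl M y x := by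
  unfold bl
  rw [Finset.sum_comm]
  refine Finset.sum_congr rfl fun a _ => Finset.sum_congr rfl fun b _ => ?_
  have : M b a = M a b := sym_app h _ _
  rw [this]; ring

lemma bl_cs {M : Matrix (Fin n) (Fin n) ℝ} (h : Mᵀ = M) (hp : ∀ x, 0 ≤ bl M x x) (x y : Fin n → ℝ) (α γ : ℝ) :
    -(α ^ 2 * bl M x x + γ ^ 2 * bl M y y) ≤ 2 * (α * γ) * bl M x y := by
  have := hp (fun a => α * x a + γ * y a)
  have e : bl M (fun a => α * x a + γ * y a) (fun a => α * x a + γ * y a) =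
      α ^ 2 * bl M x x + γ ^ 2 * bl M y y + α * γ * bl M x y + α * γ * bl M y x := by
    unfold bl
    simp only [Finset.mul_sum, ← Finset.sum_add_distrib]
    refine Finset.sum_congr rfl fun a _ => Finset.sum_congr rfl fun b _ => ?_
    ring
  rw [e, bl_symm h y x] at this
  linarith

lemma dot_bound {x y : Fin n → ℝ} {X Y : ℝ} (hX : 0 ≤ X)
    (hx : ∀ a, |x a| ≤ X) (hy : ∀ a, |y a| ≤ Y) : |∑ a, x a * y a| ≤ n * (X * Y) := by
  refine (Finset.abs_sum_le_sum_abs _ _).trans ?_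
  calc _ ≤ ∑ a : Fin n, X * Y := by
        refine Finset.sum_le_sum fun a _ => ?_
        rw [abs_mul]
        exact mul_le_mul (hx a) (hy a) (abs_nonneg _) hX
    _ = _ := by simp

/-- the algebraic identity for `S ∇h · ∇w` -/
lemma bl_S {S T A : Matrix (Fin n) (Fin n) ℝ} {σ h G : ℝ} {p Y W Hh : Fin n → ℝ}
    (hSA : S * A = σ • (1 : Matrix (Fin n) (Fin n) ℝ) - T) (hS : Sᵀ = S) (hT : Tᵀ = T)
    (hH : ∀ a, Hh a = Y a - 2 * G * h * p a + 2 * G * ∑ m, p m * (A a m + h * if a = m then 1 else 0)) :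
    bl S Hh W = bl S Y W + 2 * G * σ * (∑ m, p m * W m) - 2 * G * bl T p W := by
  have e1 : ∀ a, Hh a = Y a + 2 * G * ∑ m, A a m * p m := by
    intro a
    rw [hH a]
    have : ∑ m, p m * (A a m + h * if a = m then 1 else 0) = (∑ m, A a m * p m) + h * p a := by
      simp only [mul_add, Finset.sum_add_distrib]
      congr 1
      · exact Finset.sum_congr rfl fun m _ => mul_comm _ _
      · simp [mul_comm]
    rw [this]; ring
  have e2 : ∀ b, ∑ a, S a b * (∑ m, A a m * p m) = σ * p b - ∑ m, T b m * p m := by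
    intro b
    have : ∀ m, ∑ a, S a b * A a m = σ * (if b = m then 1 else 0) - T b m := by
      intro m
      have := congrFun (congrFun hSA b) m
      rw [Matrix.mul_apply] at this
      simp only [Matrix.sub_apply, Matrix.smul_apply, Matrix.one_apply, smul_eq_mul] at this
      rw [← this]
      refine Finset.sum_congr rfl fun a _ => ?_
      rw [sym_app hS a b]
    calc _ = ∑ m, (∑ a, S a b * A a m) * p m := by
          simp only [Finset.mul_sum, Finset.sum_mul]
          rw [Finset.sum_comm]
          exact Finset.sum_congr rfl fun m _ => Finset.sum_congr rfl fun a _ => by ring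
      _ = _ := by
          simp only [this, sub_mul, Finset.sum_sub_distrib]
          congr 1
          simp
  have e3 : ∀ (M : Matrix (Fin n) (Fin n) ℝ) (x : Fin n → ℝ), bl M x W = ∑ b, (∑ a, M a b * x a) * W b := by
    intro M x
    unfold bl
    rw [Finset.sum_comm]
    simp only [Finset.sum_mul]
  have e4 : ∀ b, ∑ m, T b m * p m = ∑ m, T m b * p m := fun b =>
    Finset.sum_congr rfl fun m _ => by rw [sym_app hT b m]
  rw [e3 S, e3 S, e3 T, Finset.mul_sum, Finset.mul_sum, ← Finset.sum_add_distrib, ← Finset.sum_sub_distrib]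
  refine Finset.sum_congr rfl fun b _ => ?_
  have : ∑ a, S a b * Hh a = (∑ a, S a b * Y a) + 2 * G * (∑ a, S a b * (∑ m, A a m * p m)) := by
    rw [Finset.mul_sum, ← Finset.sum_add_distrib]
    exact Finset.sum_congr rfl fun a _ => by rw [e1 a]; ring
  rw [this, e2 b, e4 b]; ring

/-- the pointwise algebraic inequality behind the Caccioppoli estimate -/
lemma pw_alg {T S A D2 : Matrix (Fin n) (Fin n) ℝ} {σ h G c C C1 D v vq w w2 η q V vk : ℝ}
    {p Y W Hh g E : Fin n → ℝ}
    (hSA : S * A = σ • (1 : Matrix (Fin n) (Fin n) ℝ) - T) (hS : Sᵀ = S) (hT : Tᵀ = T)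
    (hTp : ∀ x, 0 ≤ bl T x x)
    (hH : ∀ a, Hh a = Y a - 2 * G * h * p a + 2 * G * ∑ m, p m * (A a m + h * if a = m then 1 else 0))
    (hc0 : 0 ≤ c) (hcn : c ≤ n) (hC : 1 ≤ C) (hC1 : 1 ≤ C1) (hD : 1 ≤ D) (hv : 1 ≤ v) (hvk : 1 ≤ vk)
    (hw : v / 2 ≤ w) (hw2 : 0 < w2) (hwq : w2 * w * w ≤ 2 * vq) (hη0 : 0 ≤ η) (hη1 : η ≤ 1)
    (hq : 2 < q)
    (hTb : ∀ a b, |T a b| ≤ C1 * vk) (hSb : ∀ a b, |S a b| ≤ C1 * vk)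
    (hY : ∀ a, |Y a| ≤ C) (hg : ∀ a, |g a| ≤ C) (hp : ∀ a, |p a| ≤ C) (hG : |G| ≤ C) (hE : ∀ a, |E a| ≤ D)
    (hV : V = vk * vq)
    (hmain : 2 * c * G * σ * (∑ m, p m * W m) + (∑ m, g m * W m) - C * (vk * v) ≤ ∑ b, ∑ a, T a b * D2 a b) :
    (q - 1) / 2 * (η ^ 2 * w2 * bl T W W) ≤
      (∑ b, ∑ a, T a b * (D2 a b * (η ^ 2 * (w2 * w)) + W b * (η ^ 2 * ((q - 1) * w2 * W a) + 2 * η * E a * (w2 * w))))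
      - c * (∑ b, ∑ a, S a b * (Hh a * (W b * (η ^ 2 * (w2 * w)))))
      + c * (∑ a, ∑ b, S b a * (Y a * (η ^ 2 * (w2 * w) * W b + 2 * η * E b * (w2 * w * w) / q)))
      - (∑ b, g b * (η ^ 2 * (w2 * w) * W b + 2 * η * E b * (w2 * w * w) / q))
      + (8 * n ^ 2 * C1 + 8 * n ^ 4 * C ^ 4 * C1 + 4 * C + 4 * n ^ 3 * C1 * C + 4 * n * C) * D ^ 2 * V := by
  have hwp : 0 < w := by linarith
  have i1 : (∑ b, ∑ a, T a b * (D2 a b * (η ^ 2 * (w2 * w)) + W b * (η ^ 2 * ((q - 1) * w2 * W a) + 2 * η * E a * (w2 * w))))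
      = η ^ 2 * (w2 * w) * (∑ b, ∑ a, T a b * D2 a b) + (q - 1) * (η ^ 2 * w2 * bl T W W) + 2 * η * (w2 * w) * bl T E W := by
    unfold bl
    rw [Finset.sum_comm (f := fun b a => T a b * D2 a b), Finset.sum_comm]
    simp only [Finset.mul_sum, ← Finset.sum_add_distrib]
    refine Finset.sum_congr rfl fun b _ => Finset.sum_congr rfl fun a _ => ?_
    ring
  have i2 : (∑ b, ∑ a, S a b * (Hh a * (W b * (η ^ 2 * (w2 * w))))) = η ^ 2 * (w2 * w) * bl S Hh W := by
    unfold bl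
    rw [Finset.sum_comm]
    simp only [Finset.mul_sum]
    refine Finset.sum_congr rfl fun b _ => Finset.sum_congr rfl fun a _ => ?_
    ring
  have i3 : (∑ a, ∑ b, S b a * (Y a * (η ^ 2 * (w2 * w) * W b + 2 * η * E b * (w2 * w * w) / q))) =
      η ^ 2 * (w2 * w) * bl S Y W + 2 * η * (w2 * w * w) / q * bl S Y E := by
    unfold bl
    simp only [Finset.mul_sum, ← Finset.sum_add_distrib]
    refine Finset.sum_congr rfl fun a _ => Finset.sum_congr rfl fun b _ => ?_
    rw [sym_app hS b a]
    ring
  have i4 : (∑ b, g b * (η ^ 2 * (w2 * w) * W b + 2 * η * E b * (w2 * w * w) / q)) =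
      η ^ 2 * (w2 * w) * (∑ b, g b * W b) + 2 * η * (w2 * w * w) / q * (∑ b, g b * E b) := by
    simp only [Finset.mul_sum, ← Finset.sum_add_distrib]
    refine Finset.sum_congr rfl fun b _ => ?_
    ring
  rw [i1, i2, i3, i4, bl_S hSA hS hT hH]
  have hvq : 0 < vq := by linarith [mul_pos (mul_pos hw2 hwp) hwp]
  have hV0 : 0 ≤ V := by rw [hV]; positivity
  have hη2 : η ^ 2 ≤ 1 := pow_le_one₀ hη0 hη1
  have hwq0 : 0 < w2 * w * w := by positivity
  have hn0 : (0:ℝ) ≤ n := Nat.cast_nonneg n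
  -- pieces
  have c1 := bl_cs hT hTp E W (2 * w) (η / 2)
  have c2 := bl_cs hT hTp p W (2 * c * G * η * w) (η / 2)
  have b1 : bl T E E ≤ n * (n * (C1 * vk * D * D)) := (le_abs_self _).trans (bl_bound (by positivity) (by linarith) hTb hE hE)
  have b2 : bl T p p ≤ n * (n * (C1 * vk * C * C)) := (le_abs_self _).trans (bl_bound (by positivity) (by linarith) hTb hp hp)
  have b3 : |bl S Y E| ≤ n * (n * (C1 * vk * C * D)) := bl_bound (by positivity) (by linarith) hSb hY hE
  have b4 : |∑ b, g b * E b| ≤ n * (C * D) := dot_bound (by linarith) hg hE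
  have hDD : D ≤ D ^ 2 := le_self_pow₀ hD (by norm_num)
  have hD1 : 1 ≤ D ^ 2 := one_le_pow₀ hD
  -- term 1
  have t1 : -(1 / 4 * (η ^ 2 * w2 * bl T W W)) - 8 * n ^ 2 * C1 * D ^ 2 * V ≤ 2 * η * (w2 * w) * bl T E W := by
    have h1 : w2 * w * w * bl T E E ≤ 2 * vq * (n * (n * (C1 * vk * D * D))) :=
      mul_le_mul hwq b1 (hTp E) (by positivity)
    have h2 := mul_le_mul_of_nonneg_left c1 hw2.le
    have h6 : 4 * (2 * vq * (n * (n * (C1 * vk * D * D)))) = 8 * n ^ 2 * C1 * D ^ 2 * V := by rw [hV]; ring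
    have h7 : w2 * (2 * (2 * w * (η / 2)) * bl T E W) = 2 * η * (w2 * w) * bl T E W := by ring
    have h8 : w2 * -((2 * w) ^ 2 * bl T E E + (η / 2) ^ 2 * bl T W W) =
      -(4 * (w2 * w * w * bl T E E)) - 1 / 4 * (η ^ 2 * w2 * bl T W W) := by ring
    linarith
  have t2 : -(1 / 4 * (η ^ 2 * w2 * bl T W W)) - 8 * n ^ 4 * C ^ 4 * C1 * D ^ 2 * V ≤
      η ^ 2 * (w2 * w) * (c * (2 * G * bl T p W)) := by
    have hG2 : G ^ 2 ≤ C ^ 2 := sq_le_sq' (by linarith [neg_abs_le G]) ((le_abs_self G).trans hG)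
    have hc2 : c ^ 2 ≤ n ^ 2 := by gcongr
    have h1 : w2 * w * w * bl T p p ≤ 2 * vq * (n * (n * (C1 * vk * C * C))) :=
      mul_le_mul hwq b2 (hTp p) (by positivity)
    have h3 : c ^ 2 * G ^ 2 * η ^ 2 ≤ n ^ 2 * C ^ 2 * 1 := by gcongr
    have h4 := mul_le_mul h3 h1 (mul_nonneg hwq0.le (hTp p)) (by positivity)
    have h2 := mul_le_mul_of_nonneg_left c2 hw2.le
    have h5 : 8 * n ^ 4 * C ^ 4 * C1 * V * 1 ≤ 8 * n ^ 4 * C ^ 4 * C1 * V * D ^ 2 := by gcongr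
    have h6 : 4 * (n ^ 2 * C ^ 2 * 1 * (2 * vq * (n * (n * (C1 * vk * C * C))))) = 8 * n ^ 4 * C ^ 4 * C1 * V * 1 := by
      rw [hV]; ring
    have h7 : w2 * (2 * (2 * c * G * η * w * (η / 2)) * bl T p W) = η ^ 2 * (w2 * w) * (c * (2 * G * bl T p W)) := by ring
    have h8 : w2 * -((2 * c * G * η * w) ^ 2 * bl T p p + (η / 2) ^ 2 * bl T W W) =
      -(4 * (c ^ 2 * G ^ 2 * η ^ 2 * (w2 * w * w * bl T p p))) - 1 / 4 * (η ^ 2 * w2 * bl T W W) := by ring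
    linarith
  have t3 : η ^ 2 * (w2 * w) * (C * (vk * v)) ≤ 4 * C * D ^ 2 * V := by
    have h1 : w2 * w * v ≤ 4 * vq := by
      have : w2 * w * v ≤ w2 * w * (2 * w) := by gcongr; linarith
      linarith
    have h2 : η ^ 2 * (w2 * w * v) ≤ 1 * (4 * vq) := mul_le_mul hη2 h1 (by positivity) (by norm_num)
    have h3 := mul_le_mul_of_nonneg_left h2 (show 0 ≤ C * vk by positivity)
    have h5 : 4 * C * V * 1 ≤ 4 * C * V * D ^ 2 := by gcongr
    have h6 : C * vk * (1 * (4 * vq)) = 4 * C * V * 1 := by rw [hV]; ring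
    have h7 : C * vk * (η ^ 2 * (w2 * w * v)) = η ^ 2 * (w2 * w) * (C * (vk * v)) := by ring
    linarith
  have hz : 0 ≤ 2 * η * (w2 * w * w) / q ∧ 2 * η * (w2 * w * w) / q ≤ 4 * vq := by
    refine ⟨by positivity, ?_⟩
    rw [div_le_iff₀ (by linarith)]
    have : η * (w2 * w * w) ≤ 1 * (2 * vq) := mul_le_mul hη1 hwq hwq0.le (by norm_num)
    have : 4 * vq * 1 ≤ 4 * vq * q := by gcongr; linarith
    linarith
  set z := 2 * η * (w2 * w * w) / q with hzdef
  have t4 : -(4 * n ^ 3 * C1 * C * D ^ 2 * V) ≤ c * (z * bl S Y E) := by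
    have h1 : |c * (z * bl S Y E)| ≤ n * (4 * vq * (n * (n * (C1 * vk * C * D)))) := by
      rw [abs_mul, abs_mul, abs_of_nonneg hc0, abs_of_nonneg hz.1]
      gcongr
      exact hz.2
    have h5 : 4 * n ^ 3 * C1 * C * V * D ≤ 4 * n ^ 3 * C1 * C * V * D ^ 2 := by gcongr
    have h6 : n * (4 * vq * (n * (n * (C1 * vk * C * D)))) = 4 * n ^ 3 * C1 * C * V * D := by rw [hV]; ring
    have := neg_abs_le (c * (z * bl S Y E))
    linarith
  have t5 : z * (∑ b, g b * E b) ≤ 4 * n * C * D ^ 2 * V := by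
    have h1 : |z * (∑ b, g b * E b)| ≤ 4 * vq * (n * (C * D)) := by
      rw [abs_mul, abs_of_nonneg hz.1]
      gcongr
      exact hz.2
    have h5 : 4 * n * C * vq * D * 1 ≤ 4 * n * C * vq * D ^ 2 * vk := by gcongr
    have := le_abs_self (z * (∑ b, g b * E b))
    have h6 : 4 * n * C * vq * D ^ 2 * vk = 4 * n * C * D ^ 2 * V := by rw [hV]; ring
    linarith
  have hm := mul_le_mul_of_nonneg_left hmain (show 0 ≤ η ^ 2 * (w2 * w) by positivity)
  have hP : 0 ≤ η ^ 2 * w2 * bl T W W := mul_nonneg (by positivity) (hTp W)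
  have hP2 : (q - 1) / 2 * (η ^ 2 * w2 * bl T W W) ≤ (q - 1) * (η ^ 2 * w2 * bl T W W) - 1 / 2 * (η ^ 2 * w2 * bl T W W) := by
    have := mul_le_mul_of_nonneg_right (show (1:ℝ) / 2 ≤ (q - 1) / 2 by linarith) hP
    linarith
  linarith
end
end RH

namespace RH
section
variable {n : ℕ}

/-- Data for the Caccioppoli estimate (`k = κ + 2`). -/
structure Core (κ : ℕ) (C q : ℝ) (K : Set (Fin n → ℝ)) (u h v w G : (Fin n → ℝ) → ℝ)
    (X g : Fin n → (Fin n → ℝ) → ℝ) : Prop where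
  hu : ContDiff ℝ 2 u
  huc : HasCompactSupport u
  hh : ContDiff ℝ 1 h
  hw : ContDiff ℝ 2 w
  hK : IsCompact K
  hv : ContinuousOn v K
  hX : ∀ a, ∃ L, LipschitzWith L (X a)
  hg : ∀ a, ∃ L, LipschitzWith L (g a)
  hv1 : ∀ x ∈ K, 1 ≤ v x
  bX : ∀ x ∈ K, ∀ a, |X a x| ≤ C
  bg : ∀ x ∈ K, ∀ a, |g a x| ≤ C
  bG : ∀ x ∈ K, |G x| ≤ C
  bp : ∀ x ∈ K, ∀ a, |pd a u x| ≤ C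
  lX : ∀ x ∈ K, ∀ a b, |lineDeriv ℝ (X a) x (Pi.single b 1)| ≤ C * v x
  lg : ∀ x ∈ K, ∀ a b, |lineDeriv ℝ (g a) x (Pi.single b 1)| ≤ C * v x
  bh : ∀ x ∈ K, ∀ a, |pd a h x| ≤ C * v x
  bA : ∀ x ∈ K, ∀ a b, |AH u h x a b| ≤ C * v x
  eh : ∀ x ∈ K, ∀ a, pd a h x = X a x - 2 * G x * h x * pd a u x
        + 2 * G x * ∑ m, pd m u x * pd a (pd m u) x
  gam : ∀ x ∈ K, GammaPlus (κ + 2) (AH u h x)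
  sig : ∀ x ∈ K, 1 ≤ C * esymmMat (κ + 2) (AH u h x)
  main : ∀ x ∈ K, 2 * ((n : ℝ) - ((κ + 1 : ℕ) : ℝ)) * G x * esymmMat (κ + 1) (AH u h x) * (∑ m, pd m u x * pd m w x)
        + (∑ m, g m x * pd m w x) - C * (v x ^ (κ + 1) * v x) ≤
        ∑ b, ∑ a, newtonT (κ + 1) (AH u h x) a b * pd a (pd b w) x
  wv : ∀ x ∈ K, v x / 2 ≤ w x
  wq : ∀ x ∈ K, w x ^ q ≤ 2 * v x ^ q

lemma int5 {K : Set (Fin n → ℝ)} {F0 F1 F2 F3 F4 V : (Fin n → ℝ) → ℝ} {r c d : ℝ} (hK : MeasurableSet K)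
    (h0 : IntegrableOn F0 K) (h1 : IntegrableOn F1 K) (h2 : IntegrableOn F2 K) (h3 : IntegrableOn F3 K)
    (h4 : IntegrableOn F4 K) (hV : IntegrableOn V K)
    (pw : ∀ x ∈ K, r * F0 x ≤ F1 x - c * F2 x + c * F3 x - F4 x + d * V x) :
    r * (∫ x in K, F0 x) ≤ (∫ x in K, F1 x) - c * (∫ x in K, F2 x) + c * (∫ x in K, F3 x) - (∫ x in K, F4 x)
      + d * (∫ x in K, V x) := by
  have e2 : IntegrableOn (fun x => c * F2 x) K := h2.const_mul c
  have e3 : IntegrableOn (fun x => c * F3 x) K := h3.const_mul c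
  have eV : IntegrableOn (fun x => d * V x) K := hV.const_mul d
  have a1 : IntegrableOn (fun x => F1 x - c * F2 x) K := Integrable.sub h1 e2
  have a2 : IntegrableOn (fun x => F1 x - c * F2 x + c * F3 x) K := Integrable.add a1 e3
  have a3 : IntegrableOn (fun x => F1 x - c * F2 x + c * F3 x - F4 x) K := Integrable.sub a2 h4
  have a4 : IntegrableOn (fun x => F1 x - c * F2 x + c * F3 x - F4 x + d * V x) K := Integrable.add a3 eV
  have := setIntegral_mono_on (h0.const_mul r) a4 hK pw
  rw [integral_const_mul, integral_add a3 eV, integral_sub a2 h4, integral_add a1 e3, integral_sub h1 e2,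
    integral_const_mul, integral_const_mul, integral_const_mul] at this
  exact this

lemma caccioppoli (κ : ℕ) (hκ : κ + 2 ≤ n) (C : ℝ) (hC : 1 ≤ C) : ∃ C' : ℝ, 1 ≤ C' ∧
    ∀ (q : ℝ) (K : Set (Fin n → ℝ)) (u h v w G : (Fin n → ℝ) → ℝ) (X g : Fin n → (Fin n → ℝ) → ℝ),
    Core κ C q K u h v w G X g → 2 < q → ∀ (η : (Fin n → ℝ) → ℝ) (D : ℝ), ContDiff ℝ 1 η →
    (∀ x, 0 ≤ η x) → (∀ x, η x ≤ 1) → tsupport η ⊆ K → (∀ x a, |pd a η x| ≤ D) → 1 ≤ D →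
    (q - 1) / 2 * ∫ x in K, η x ^ 2 * w x ^ (q - 2) * bl (newtonT (κ + 1) (AH u h x)) (grad w x) (grad w x)
      ≤ C' * D ^ 2 * ∫ x in K, v x ^ (κ + 1) * v x ^ q := by
  obtain ⟨C1, hC1, hC1b⟩ := bound_newtonT (n := n) (κ + 1) (by omega)
  obtain ⟨C2, hC2, hC2b⟩ := bound_newtonT (n := n) κ (by omega)
  obtain ⟨R1, hR1, hR1b⟩ := R_bound (n := n) κ (by omega) C hC
  obtain ⟨R2, hR2, hR2b⟩ := R_bound (n := n) 0 (by omega) C hC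
  set C3 : ℝ := C1 * C ^ (κ + 1) + C2 * C ^ κ with hC3
  have hC31 : 1 ≤ C3 := by
    have : 1 * 1 ≤ C1 * C ^ (κ + 1) := mul_le_mul hC1 (one_le_pow₀ hC) (by norm_num) (by linarith)
    have : 0 ≤ C2 * C ^ κ := by positivity
    linarith
  set C4 : ℝ := 8 * n ^ 2 * C3 + 8 * n ^ 4 * C ^ 4 * C3 + 4 * C + 4 * n ^ 3 * C3 * C + 4 * n * C with hC4
  have hC40 : 1 ≤ C4 := by
    have : 0 ≤ 8 * n ^ 2 * C3 + 8 * n ^ 4 * C ^ 4 * C3 + 4 * n ^ 3 * C3 * C + 4 * n * C := by positivity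
    linarith
  refine ⟨n * (n * (2 * R1)) + n * (2 * R2) + C4, ?_, ?_⟩
  · have : 0 ≤ n * (n * (2 * R1)) + n * (2 * R2) := by positivity
    linarith
  intro q K u h v w G X g cr hq η D hη hη0 hη1 hηK hηD hD
  have hwpos : ∀ x ∈ K, 0 < w x := fun x hx => by linarith [cr.wv x hx, cr.hv1 x hx]
  have hw1 : ContDiff ℝ 1 w := cr.hw.of_le (by norm_num)
  set e : (Fin n → ℝ) → ℝ := fun x => η x ^ 2 with he
  have hec : ContDiff ℝ 1 e := hη.pow 2
  have het : tsupport e ⊆ K := by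
    refine (closure_mono ?_).trans hηK
    intro x hx
    simp only [he, Function.mem_support] at hx ⊢
    exact fun h => hx (by rw [h]; norm_num)
  have hecs : HasCompactSupport e := cr.hK.of_isClosed_subset (isClosed_tsupport _) het
  have hep : ∀ x a, pd a e x = 2 * η x * pd a η x := by
    intro x a
    have : e = fun x => η x * η x := by ext x; simp [he, sq]
    rw [this, pd_mul (hη.differentiable one_ne_zero x) (hη.differentiable one_ne_zero x)]
    ring
  have hepos : ∀ x ∈ tsupport e, 0 < w x := fun x hx => hwpos x (het hx)
  -- φ and ζ
  set φ : (Fin n → ℝ) → ℝ := fun x => e x * w x ^ (q - 1) with hφ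
  have hφc : ContDiff ℝ 1 φ := cut_contDiff (m := 1) (by exact_mod_cast hec) (by exact_mod_cast hw1) hepos (q - 1)
  have hφt : tsupport φ ⊆ K := cut_tsupport.trans het
  set ζ : (Fin n → ℝ) → ℝ := fun x => (1 / q) * (e x * w x ^ q) with hζ
  have hζc0 : ContDiff ℝ 1 (fun x => e x * w x ^ q) :=
    cut_contDiff (m := 1) (by exact_mod_cast hec) (by exact_mod_cast hw1) hepos q
  have hζc : ContDiff ℝ 1 ζ := contDiff_const.mul hζc0
  have hζt : tsupport ζ ⊆ K := by
    refine subset_trans (closure_mono ?_) (cut_tsupport.trans het : tsupport (fun x => e x * w x ^ q) ⊆ K)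
    intro x hx
    simp only [hζ, Function.mem_support] at hx ⊢
    exact fun h => hx (by rw [h]; norm_num)
  have hζcs : HasCompactSupport ζ := cr.hK.of_isClosed_subset (isClosed_tsupport _) hζt
  have hζ0 : ∀ x, 0 ≤ ζ x := by
    intro x
    by_cases hx : x ∈ K
    · have := hwpos x hx
      simp only [hζ, he]; positivity
    · rw [(zero_off hζt hx).1]
  have hζp : ∀ x a, pd a ζ x = (1 / q) * (e x * (q * w x ^ (q - 1) * pd a w x) + pd a e x * w x ^ q) := by
    intro x a
    rw [← cut_pd hec hw1 hepos q a x]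
    unfold pd
    rw [hζ, fderiv_const_mul (hζc0.differentiable one_ne_zero x)]
    simp
  set ψ : Fin n → (Fin n → ℝ) → ℝ := fun b x => pd b w x * φ x with hψ
  have hwp : ∀ b, ContDiff ℝ 1 (pd b w) := fun b => by
    exact_mod_cast pd_contDiff (m := 1) (by exact_mod_cast cr.hw) b
  have hwpp : ∀ a b, Continuous (pd a (pd b w)) := fun a b =>
    (pd_contDiff (m := 0) (by exact_mod_cast hwp b) a).continuous
  have hψc : ∀ b, ContDiff ℝ 1 (ψ b) := fun b => (hwp b).mul hφc
  have hψt : ∀ b, tsupport (ψ b) ⊆ K := by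
    intro b
    refine (closure_mono ?_).trans hφt
    intro x hx
    simp only [hψ, Function.mem_support] at hx ⊢
    exact fun h => hx (by rw [h]; norm_num)
  have hψcs : ∀ b, HasCompactSupport (ψ b) := fun b => cr.hK.of_isClosed_subset (isClosed_tsupport _) (hψt b)
  have hψp : ∀ x a b, pd a (ψ b) x = pd b w x * pd a φ x + pd a (pd b w) x * φ x := by
    intro x a b
    rw [hψ, pd_mul ((hwp b).differentiable one_ne_zero x) (hφc.differentiable one_ne_zero x)]
  -- continuity
  have hAc : ∀ a b, ContDiff ℝ 0 (fun x => AH u h x a b) := fun a b =>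
    AH_contDiff (m := 0) (by exact_mod_cast cr.hu) (cr.hh.of_le zero_le_one) a b
  have hTc : ∀ a b, Continuous (fun x => newtonT (κ + 1) (AH u h x) a b) := fun a b =>
    ((contDiff_newtonT hAc (κ + 1) (by omega)).1 a b).continuous
  have hSc : ∀ a b, Continuous (fun x => newtonT κ (AH u h x) a b) := fun a b =>
    ((contDiff_newtonT hAc κ (by omega)).1 a b).continuous
  have hhc : ∀ a, Continuous (pd a h) := fun a =>
    (pd_contDiff (m := 0) (by exact_mod_cast cr.hh) a).continuous
  have hψpc : ∀ a b, Continuous (pd a (ψ b)) := fun a b =>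
    (pd_contDiff (m := 0) (by exact_mod_cast hψc b) a).continuous
  have hζpc : ∀ a, Continuous (pd a ζ) := fun a =>
    (pd_contDiff (m := 0) (by exact_mod_cast hζc) a).continuous
  have hwc : ContinuousOn w K := hw1.continuous.continuousOn
  have hXc : ∀ a, Continuous (X a) := fun a => (cr.hX a).choose_spec.continuous
  have hgc : ∀ a, Continuous (g a) := fun a => (cr.hg a).choose_spec.continuous
  set c : ℝ := (n : ℝ) - ((κ + 1 : ℕ) : ℝ) with hc
  have hc0 : 0 ≤ c := by
    have : ((κ + 1 : ℕ) : ℝ) ≤ n := by exact_mod_cast (by omega : κ + 1 ≤ n)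
    linarith
  have hcn : c ≤ n := by
    have : (0:ℝ) ≤ ((κ + 1 : ℕ) : ℝ) := Nat.cast_nonneg _
    linarith
  set V : (Fin n → ℝ) → ℝ := fun x => v x ^ (κ + 1) * v x ^ q with hV
  have hVi : IntegrableOn V K := by
    refine ContinuousOn.integrableOn_compact cr.hK ((cr.hv.pow _).mul (cr.hv.rpow_const ?_))
    intro x hx
    exact Or.inl (by linarith [cr.hv1 x hx])
  have hvpos : ∀ x ∈ K, 0 < v x := fun x hx => by linarith [cr.hv1 x hx]
  have hV0 : ∀ x ∈ K, 0 ≤ V x := fun x hx => by have := hvpos x hx; simp only [hV]; positivity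
  set IV := ∫ x in K, V x with hIV
  have hIV0 : 0 ≤ IV := setIntegral_nonneg cr.hK.measurableSet hV0
  -- the four integrands
  set F1 : (Fin n → ℝ) → ℝ := fun x => ∑ b, ∑ a, newtonT (κ + 1) (AH u h x) a b * pd a (ψ b) x with hF1
  set F2 : (Fin n → ℝ) → ℝ := fun x => ∑ b, ∑ a, newtonT κ (AH u h x) a b * (pd a h x * ψ b x) with hF2
  set F3 : (Fin n → ℝ) → ℝ := fun x => ∑ a, ∑ b, newtonT κ (AH u h x) b a * (X a x * pd b ζ x) with hF3
  set F4 : (Fin n → ℝ) → ℝ := fun x => ∑ b, g b x * pd b ζ x with hF4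
  set F0 : (Fin n → ℝ) → ℝ := fun x => η x ^ 2 * w x ^ (q - 2) * bl (newtonT (κ + 1) (AH u h x)) (grad w x) (grad w x) with hF0
  have c1 : Continuous F1 := continuous_finsetSum _ fun b _ => continuous_finsetSum _ fun a _ =>
    (hTc a b).mul (hψpc a b)
  have c2 : Continuous F2 := continuous_finsetSum _ fun b _ => continuous_finsetSum _ fun a _ =>
    (hSc a b).mul ((hhc a).mul (hψc b).continuous)
  have c3 : Continuous F3 := continuous_finsetSum _ fun a _ => continuous_finsetSum _ fun b _ =>
    (hSc b a).mul ((hXc a).mul (hζpc b))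
  have c4 : Continuous F4 := continuous_finsetSum _ fun b _ => (hgc b).mul (hζpc b)
  have c0 : ContinuousOn F0 K := by
    refine ContinuousOn.mul ((hη.continuous.pow 2).continuousOn.mul (hwc.rpow_const fun x hx => Or.inl (hwpos x hx).ne')) ?_
    refine Continuous.continuousOn ?_
    unfold bl
    exact continuous_finsetSum _ fun a _ => continuous_finsetSum _ fun b _ =>
      ((hTc a b).mul (hwp a).continuous).mul (hwp b).continuous
  have kI : ∀ {F : (Fin n → ℝ) → ℝ}, Continuous F → IntegrableOn F K := fun hF =>
    hF.continuousOn.integrableOn_compact cr.hK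
  -- global integrals
  have off : ∀ x ∉ K, (∀ b, ψ b x = 0) ∧ (∀ a b, pd a (ψ b) x = 0) ∧ ∀ a, pd a ζ x = 0 := fun x hx =>
    ⟨fun b => (zero_off (hψt b) hx).1, fun a b => (zero_off (hψt b) hx).2 a, (zero_off hζt hx).2⟩
  have J1 : ∫ x in K, F1 x = c * ∫ x in K, F2 x := by
    rw [setIntegral_eq_integral_of_forall_compl_eq_zero (fun x hx => by simp [hF1, (off x hx).2.1]),
      setIntegral_eq_integral_of_forall_compl_eq_zero (fun x hx => by simp [hF2, (off x hx).1])]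
    have ia : ∀ a b, Integrable (fun x => newtonT (κ + 1) (AH u h x) a b * pd a (ψ b) x) := fun a b =>
      ((hTc a b).mul (hψpc a b)).integrable_of_hasCompactSupport (pd_hcs (hψcs b) a).mul_left
    have ib : ∀ a b, Integrable (fun x => newtonT κ (AH u h x) a b * (pd a h x * ψ b x)) := fun a b =>
      ((hSc a b).mul ((hhc a).mul (hψc b).continuous)).integrable_of_hasCompactSupport
        (hψcs b).mul_left.mul_left
    simp only [hF1, hF2]
    rw [integral_finsetSum _ fun b _ => integrable_finsetSum _ fun a _ => ia a b,
      integral_finsetSum _ fun b _ => integrable_finsetSum _ fun a _ => ib a b, Finset.mul_sum]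
    refine Finset.sum_congr rfl fun b _ => ?_
    rw [integral_finsetSum _ fun a _ => ia a b, integral_finsetSum _ fun a _ => ib a b]
    have := weak_div cr.hu cr.huc cr.hh (X := fun _ => (1:ℝ)) (L := 0) (LipschitzWith.const 1) (hψc b) (hψcs b)
      (show κ + 1 ≤ n by omega) b
    have hl : ∀ x y : Fin n → ℝ, lineDeriv ℝ (fun _ : Fin n → ℝ => (1:ℝ)) x y = 0 := by
      intro x y; simp [lineDeriv]
    simpa only [Tm, hl, zero_mul, add_zero, one_mul, mul_one] using this
  have vζ : ∀ x ∈ K, ∀ j ≤ κ, v x ^ (j + 1) * ζ x ≤ 2 * V x := by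
    intro x hx j hj
    have hv1 := cr.hv1 x hx
    have hvp := hvpos x hx
    have h1 : v x ^ (j + 1) ≤ v x ^ (κ + 1) := pow_le_pow_right₀ hv1 (by omega)
    have h2 : ζ x ≤ 2 * v x ^ q := by
      have h3 : (1 / q) * (e x * w x ^ q) ≤ 1 * (1 * (2 * v x ^ q)) := by
        have hw' := hwpos x hx
        have hq1 : 1 / q ≤ 1 := by rw [div_le_one (by linarith)]; linarith
        have he1 : e x ≤ 1 := pow_le_one₀ (hη0 x) (hη1 x)
        have he0 : 0 ≤ e x := by simp only [he]; positivity
        exact mul_le_mul hq1 (mul_le_mul he1 (cr.wq x hx) (by positivity) (by norm_num)) (by positivity) (by norm_num)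
      simp only [hζ]; linarith
    calc _ ≤ v x ^ (κ + 1) * (2 * v x ^ q) := mul_le_mul h1 h2 (hζ0 x) (by positivity)
      _ = _ := by simp only [hV]; ring
  have Iζ : ∀ j ≤ κ, ∫ x in K, v x ^ (j + 1) * ζ x ≤ 2 * IV := by
    intro j hj
    rw [hIV, ← integral_const_mul]
    refine setIntegral_mono_on ?_ (hVi.const_mul 2) cr.hK.measurableSet fun x hx => vζ x hx j hj
    exact ((cr.hv.pow _).mul hζc.continuous.continuousOn).integrableOn_compact cr.hK
  have J3 : |∫ x in K, F3 x| ≤ n * (2 * R1) * IV := by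
    rw [setIntegral_eq_integral_of_forall_compl_eq_zero (fun x hx => by simp [hF3, (off x hx).2.2])]
    have ia : ∀ a b, Integrable (fun x => newtonT κ (AH u h x) b a * (X a x * pd b ζ x)) := fun a b =>
      ((hSc b a).mul ((hXc a).mul (hζpc b))).integrable_of_hasCompactSupport (pd_hcs hζcs b).mul_left.mul_left
    simp only [hF3]
    rw [integral_finsetSum _ fun a _ => integrable_finsetSum _ fun b _ => ia a b]
    refine (Finset.abs_sum_le_sum_abs _ _).trans ?_
    calc _ ≤ ∑ a : Fin n, R1 * (2 * IV) := by
          refine Finset.sum_le_sum fun a _ => ?_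
          rw [integral_finsetSum _ fun b _ => ia a b]
          obtain ⟨L, hL⟩ := cr.hX a
          refine (hR1b K u h (X a) ζ v L a cr.hu cr.huc cr.hh hL hζc hζcs hζt cr.hK cr.hv cr.hv1 hζ0
            (fun x hx => cr.bX x hx a) (fun x hx => cr.lX x hx a) cr.bh cr.bA).trans ?_
          exact mul_le_mul_of_nonneg_left (Iζ κ le_rfl) (by linarith)
      _ = _ := by simp; ring
  have J4 : |∫ x in K, F4 x| ≤ n * (2 * R2) * IV := by
    rw [setIntegral_eq_integral_of_forall_compl_eq_zero (fun x hx => by simp [hF4, (off x hx).2.2])]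
    have ia : ∀ b, Integrable (fun x => g b x * pd b ζ x) := fun b =>
      ((hgc b).mul (hζpc b)).integrable_of_hasCompactSupport (pd_hcs hζcs b).mul_left
    simp only [hF4]
    rw [integral_finsetSum _ fun b _ => ia b]
    refine (Finset.abs_sum_le_sum_abs _ _).trans ?_
    calc _ ≤ ∑ a : Fin n, R2 * (2 * IV) := by
          refine Finset.sum_le_sum fun a _ => ?_
          obtain ⟨L, hL⟩ := cr.hg a
          have := (hR2b K u h (g a) ζ v L a cr.hu cr.huc cr.hh hL hζc hζcs hζt cr.hK cr.hv cr.hv1 hζ0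
            (fun x hx => cr.bg x hx a) (fun x hx => cr.lg x hx a) cr.bh cr.bA)
          have e1 : ∑ b, ∫ x, newtonT 0 (AH u h x) b a * (g a x * pd b ζ x) = ∫ x, g a x * pd a ζ x := by
            rw [Finset.sum_eq_single a]
            · simp [newtonT]
            · intro b _ hb
              simp [newtonT, Matrix.one_apply_ne hb]
            · simp
          rw [e1] at this
          refine this.trans ?_
          exact mul_le_mul_of_nonneg_left (Iζ 0 (Nat.zero_le _)) (by linarith)
      _ = _ := by simp; ring
  -- pointwise
  have pw : ∀ x ∈ K, (q - 1) / 2 * F0 x ≤ F1 x - c * F2 x + c * F3 x - F4 x + C4 * D ^ 2 * V x := by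
    intro x hx
    have hv1 := cr.hv1 x hx
    have hvp := hvpos x hx
    have hwx := hwpos x hx
    have hAs : (AH u h x)ᵀ = AH u h x := AH_symm cr.hu x
    have r1 : w x ^ (q - 1) = w x ^ (q - 2) * w x := by
      rw [← Real.rpow_add_one hwx.ne']; congr 1; ring
    have r2 : w x ^ q = w x ^ (q - 2) * w x * w x := by
      rw [← r1, ← Real.rpow_add_one hwx.ne']; congr 1; ring
    have hCv : 0 ≤ C * v x := by positivity
    have h1 := fun a b => (hC1b _ _ hCv (cr.bA x hx)).1 a b
    have h2 := fun a b => (hC2b _ _ hCv (cr.bA x hx)).1 a b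
    have key := pw_alg (T := newtonT (κ + 1) (AH u h x)) (S := newtonT κ (AH u h x)) (A := AH u h x)
      (D2 := Matrix.of fun a b => pd a (pd b w) x) (σ := esymmMat (κ + 1) (AH u h x)) (h := h x) (G := G x)
      (c := c) (C := C) (C1 := C3) (D := D) (v := v x) (vq := v x ^ q) (w := w x) (w2 := w x ^ (q - 2)) (η := η x)
      (q := q) (V := V x) (vk := v x ^ (κ + 1)) (p := fun a => pd a u x) (Y := fun a => X a x)
      (W := grad w x) (Hh := fun a => pd a h x) (g := fun a => g a x) (E := fun a => pd a η x)
      (by rw [newtonT_comm]; exact mul_Tm (AH u h x) (κ + 1)) (newtonT_symm hAs _) (newtonT_symm hAs _)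
      (fun y => (elliptic hAs (show κ + 1 + 1 ≤ n by omega) (cr.gam x hx) (cr.bA x hx) y).2)
      (fun a => by
        rw [cr.eh x hx a]
        congr 3
        ext m
        rw [AH_apply]
        rw [Matrix.one_apply]; ring)
      hc0 hcn hC hC31 hD hv1 (one_le_pow₀ hv1) (cr.wv x hx) (by positivity) (by rw [← r2]; exact cr.wq x hx)
      (hη0 x) (hη1 x) hq
      (fun a b => by
        refine (h1 a b).trans ?_
        rw [mul_pow, ← mul_assoc]
        refine mul_le_mul_of_nonneg_right ?_ (by positivity)
        have : 0 ≤ C2 * C ^ κ := by positivity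
        linarith)
      (fun a b => by
        refine (h2 a b).trans ?_
        rw [mul_pow, ← mul_assoc]
        refine mul_le_mul ?_ (pow_le_pow_right₀ hv1 (by omega)) (by positivity) (by positivity)
        have : 0 ≤ C1 * C ^ (κ + 1) := by positivity
        linarith)
      (cr.bX x hx) (cr.bg x hx) (cr.bp x hx) (cr.bG x hx) (hηD x) rfl
      (cr.main x hx)
    have hq0 : q ≠ 0 := by linarith
    have q1 : F1 x = ∑ b, ∑ a, newtonT (κ + 1) (AH u h x) a b * ((Matrix.of fun a b => pd a (pd b w) x) a b * (η x ^ 2 * (w x ^ (q - 2) * w x)) + grad w x b * (η x ^ 2 * ((q - 1) * w x ^ (q - 2) * grad w x a) + 2 * η x * pd a η x * (w x ^ (q - 2) * w x))) := by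
      simp only [hF1]
      refine Finset.sum_congr rfl fun b _ => Finset.sum_congr rfl fun a _ => ?_
      rw [hψp, hφ, cut_pd hec hw1 hepos, hep, r1]
      simp only [he, grad, Matrix.of_apply]
      rw [show q - 1 - 1 = q - 2 by ring, r1]
      ring
    have q3 : ∀ b, pd b ζ x = η x ^ 2 * (w x ^ (q - 2) * w x) * grad w x b + 2 * η x * pd b η x * (w x ^ (q - 2) * w x * w x) / q := by
      intro b
      rw [hζp, hep, ← r2, ← r1]
      simp only [he, grad]
      field_simp
    have q2 : F2 x = ∑ b, ∑ a, newtonT κ (AH u h x) a b * (pd a h x * (grad w x b * (η x ^ 2 * (w x ^ (q - 2) * w x)))) := by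
      simp only [hF2, hψ, hφ, he, r1, grad]
    have q3' : F3 x = ∑ a, ∑ b, newtonT κ (AH u h x) b a * (X a x * (η x ^ 2 * (w x ^ (q - 2) * w x) * grad w x b + 2 * η x * pd b η x * (w x ^ (q - 2) * w x * w x) / q)) := by
      simp only [hF3, q3]
    have q4 : F4 x = ∑ b, g b x * (η x ^ 2 * (w x ^ (q - 2) * w x) * grad w x b + 2 * η x * pd b η x * (w x ^ (q - 2) * w x * w x) / q) := by
      simp only [hF4, q3]
    rw [q1, q2, q3', q4]
    exact key
  have fin := int5 cr.hK.measurableSet (c0.integrableOn_compact cr.hK) (kI c1) (kI c2) (kI c3) (kI c4) hVi pw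
  rw [J1] at fin
  have hD1 : 1 ≤ D ^ 2 := one_le_pow₀ hD
  have s3 : c * ∫ x in K, F3 x ≤ n * (n * (2 * R1) * IV) := by
    calc _ ≤ |c * ∫ x in K, F3 x| := le_abs_self _
      _ ≤ _ := by rw [abs_mul, abs_of_nonneg hc0]; gcongr
  have s4 := neg_abs_le (∫ x in K, F4 x)
  have s5 : (n * (n * (2 * R1)) + n * (2 * R2)) * IV * 1 ≤ (n * (n * (2 * R1)) + n * (2 * R2)) * IV * D ^ 2 := by
    gcongr
  linarith
end
end RH

namespace RH
section
variable {n : ℕ}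

lemma energy (κ : ℕ) (hκ : κ + 2 ≤ n) (C : ℝ) (hC : 1 ≤ C) : ∃ C' : ℝ, 1 ≤ C' ∧
    ∀ (q : ℝ) (K : Set (Fin n → ℝ)) (u h v w G : (Fin n → ℝ) → ℝ) (X g : Fin n → (Fin n → ℝ) → ℝ),
    Core κ C q K u h v w G X g → 2 < q → ∀ (η : (Fin n → ℝ) → ℝ) (D : ℝ), ContDiff ℝ 1 η →
    (∀ x, 0 ≤ η x) → (∀ x, η x ≤ 1) → tsupport η ⊆ K → (∀ x a, |pd a η x| ≤ D) → 1 ≤ D →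
    ∫ x in K, ∑ a, pd a (fun x => η x * w x ^ ((q - 1) / 2)) x ^ 2
      ≤ C' * q * D ^ 2 * ∫ x in K, v x ^ (κ + 1) * v x ^ q := by
  obtain ⟨C1, hC1, hC1b⟩ := caccioppoli (n := n) κ hκ C hC
  set E1 : ℝ := C * ((n + 1) * (n * (2 * C))) with hE1
  have hE10 : 0 ≤ E1 := by positivity
  refine ⟨E1 * C1 + 8 * n + 1, by have : 0 ≤ E1 * C1 + 8 * n := by positivity
                                  linarith, ?_⟩
  intro q K u h v w G X g cr hq η D hη hη0 hη1 hηK hηD hD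
  have cac := hC1b q K u h v w G X g cr hq η D hη hη0 hη1 hηK hηD hD
  have hwpos : ∀ x ∈ K, 0 < w x := fun x hx => by linarith [cr.wv x hx, cr.hv1 x hx]
  have hvpos : ∀ x ∈ K, 0 < v x := fun x hx => by linarith [cr.hv1 x hx]
  have hw1 : ContDiff ℝ 1 w := cr.hw.of_le (by norm_num)
  have hep : ∀ x ∈ tsupport η, 0 < w x := fun x hx => hwpos x (hηK hx)
  set V : (Fin n → ℝ) → ℝ := fun x => v x ^ (κ + 1) * v x ^ q with hV
  have hVi : IntegrableOn V K := by
    refine ContinuousOn.integrableOn_compact cr.hK ((cr.hv.pow _).mul (cr.hv.rpow_const ?_))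
    intro x hx
    exact Or.inl (by linarith [cr.hv1 x hx])
  have hV0 : ∀ x ∈ K, 0 ≤ V x := fun x hx => by have := hvpos x hx; simp only [hV]; positivity
  set IV := ∫ x in K, V x with hIV
  have hIV0 : 0 ≤ IV := setIntegral_nonneg cr.hK.measurableSet hV0
  set F0 : (Fin n → ℝ) → ℝ := fun x => η x ^ 2 * w x ^ (q - 2) * bl (newtonT (κ + 1) (AH u h x)) (grad w x) (grad w x) with hF0
  have hwp : ∀ b, ContDiff ℝ 1 (pd b w) := fun b => by
    exact_mod_cast pd_contDiff (m := 1) (by exact_mod_cast cr.hw) b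
  have hAc : ∀ a b, ContDiff ℝ 0 (fun x => AH u h x a b) := fun a b =>
    AH_contDiff (m := 0) (by exact_mod_cast cr.hu) (cr.hh.of_le zero_le_one) a b
  have hTc : ∀ a b, Continuous (fun x => newtonT (κ + 1) (AH u h x) a b) := fun a b =>
    ((contDiff_newtonT hAc (κ + 1) (by omega)).1 a b).continuous
  have c0 : ContinuousOn F0 K := by
    refine ContinuousOn.mul ((hη.continuous.pow 2).continuousOn.mul (hw1.continuous.continuousOn.rpow_const fun x hx => Or.inl (hwpos x hx).ne')) ?_
    refine Continuous.continuousOn ?_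
    unfold bl
    exact continuous_finsetSum _ fun a _ => continuous_finsetSum _ fun b _ =>
      ((hTc a b).mul (hwp a).continuous).mul (hwp b).continuous
  have hΦ : ContDiff ℝ 1 (fun x => η x * w x ^ ((q - 1) / 2)) :=
    cut_contDiff (m := 1) (by exact_mod_cast hη) (by exact_mod_cast hw1) hep _
  have cL : Continuous (fun x => ∑ a, pd a (fun x => η x * w x ^ ((q - 1) / 2)) x ^ 2) :=
    continuous_finsetSum _ fun a _ => ((pd_contDiff (m := 0) (by exact_mod_cast hΦ) a).continuous).pow 2
  have pw : ∀ x ∈ K, ∑ a, pd a (fun x => η x * w x ^ ((q - 1) / 2)) x ^ 2 ≤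
      ((q - 1) ^ 2 / 2 * E1) * F0 x + (8 * n * D ^ 2) * V x := by
    intro x hx
    have hv1 := cr.hv1 x hx
    have hvp := hvpos x hx
    have hwx := hwpos x hx
    have hAs : (AH u h x)ᵀ = AH u h x := AH_symm cr.hu x
    obtain ⟨el, el0⟩ := elliptic hAs (show κ + 1 + 1 ≤ n by omega) (cr.gam x hx) (cr.bA x hx) (grad w x)
    have hN0 : 0 ≤ ∑ a, grad w x a ^ 2 := Finset.sum_nonneg fun a _ => sq_nonneg _
    have hN : ∑ a, grad w x a ^ 2 ≤ E1 * w x * bl (newtonT (κ + 1) (AH u h x)) (grad w x) (grad w x) := by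
      have h1 : 1 * (∑ a, grad w x a ^ 2) ≤ C * esymmMat (κ + 2) (AH u h x) * ∑ a, grad w x a ^ 2 :=
        mul_le_mul_of_nonneg_right (cr.sig x hx) hN0
      have h2 := mul_le_mul_of_nonneg_left el (show 0 ≤ C by linarith)
      have h3 : (C * ((n + 1) * (n * (C * v x)))) * bl (newtonT (κ + 1) (AH u h x)) (grad w x) (grad w x) ≤
          (C * ((n + 1) * (n * (C * (2 * w x))))) * bl (newtonT (κ + 1) (AH u h x)) (grad w x) (grad w x) := by
        refine mul_le_mul_of_nonneg_right ?_ el0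
        have := cr.wv x hx
        gcongr
        linarith
      simp only [hE1]
      unfold bl at h3 ⊢
      linarith
    have r1 : w x ^ (q - 1) = (w x ^ ((q - 1) / 2)) ^ 2 := by
      rw [← Real.rpow_natCast, ← Real.rpow_mul hwx.le]; congr 1; push_cast; ring
    have r2 : w x ^ (q - 2) = (w x ^ ((q - 1) / 2 - 1)) ^ 2 * w x := by
      rw [← Real.rpow_natCast (w x ^ ((q - 1) / 2 - 1)), ← Real.rpow_mul hwx.le, ← Real.rpow_add_one hwx.ne']; congr 1; push_cast; ring
    have r3 : w x ^ q = w x ^ (q - 1) * w x := by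
      rw [← Real.rpow_add_one hwx.ne']; congr 1; ring
    have hwq1 : (w x ^ ((q - 1) / 2)) ^ 2 ≤ 4 * V x := by
      rw [← r1]
      have h1 := cr.wq x hx
      have h2 : w x ^ (q - 1) * 1 ≤ w x ^ (q - 1) * (2 * w x) := by
        gcongr
        linarith [cr.wv x hx]
      have h3 : 1 * v x ^ q ≤ v x ^ (κ + 1) * v x ^ q := by
        gcongr
        exact one_le_pow₀ hv1
      simp only [hV]
      linarith
    have st : ∀ a, pd a (fun x => η x * w x ^ ((q - 1) / 2)) x ^ 2 ≤
        (q - 1) ^ 2 / 2 * (η x ^ 2 * (w x ^ ((q - 1) / 2 - 1)) ^ 2) * grad w x a ^ 2 + 8 * D ^ 2 * V x := by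
      intro a
      rw [cut_pd hη hw1 hep]
      set s1 := w x ^ ((q - 1) / 2 - 1)
      set s2 := w x ^ ((q - 1) / 2)
      have h1 : (pd a η x) ^ 2 ≤ D ^ 2 := sq_le_sq' (by linarith [neg_abs_le (pd a η x), hηD x a]) ((le_abs_self _).trans (hηD x a))
      have h2 : (pd a η x) ^ 2 * s2 ^ 2 ≤ D ^ 2 * (4 * V x) := mul_le_mul h1 hwq1 (sq_nonneg _) (sq_nonneg _)
      have h3 := sq_nonneg (η x * ((q - 1) / 2 * s1 * pd a w x) - pd a η x * s2)
      simp only [grad]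
      linarith
    calc _ ≤ ∑ a, ((q - 1) ^ 2 / 2 * (η x ^ 2 * (w x ^ ((q - 1) / 2 - 1)) ^ 2) * grad w x a ^ 2 + 8 * D ^ 2 * V x) :=
          Finset.sum_le_sum fun a _ => st a
      _ = (q - 1) ^ 2 / 2 * (η x ^ 2 * (w x ^ ((q - 1) / 2 - 1)) ^ 2) * (∑ a, grad w x a ^ 2) + 8 * n * D ^ 2 * V x := by
          rw [Finset.sum_add_distrib, ← Finset.mul_sum]; simp; ring
      _ ≤ (q - 1) ^ 2 / 2 * (η x ^ 2 * (w x ^ ((q - 1) / 2 - 1)) ^ 2) * (E1 * w x * bl (newtonT (κ + 1) (AH u h x)) (grad w x) (grad w x)) + 8 * n * D ^ 2 * V x := by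
          gcongr
      _ = _ := by simp only [hF0]; rw [r2]; ring
  have i0 : IntegrableOn (fun x => ((q - 1) ^ 2 / 2 * E1) * F0 x) K := (c0.integrableOn_compact cr.hK).const_mul _
  have iV : IntegrableOn (fun x => (8 * n * D ^ 2) * V x) K := hVi.const_mul _
  have fin := setIntegral_mono_on (cL.continuousOn.integrableOn_compact cr.hK) (Integrable.add i0 iV) cr.hK.measurableSet pw
  refine fin.trans ?_
  simp only [Pi.add_apply]
  rw [integral_add i0 iV, integral_const_mul, integral_const_mul]
  have h1 := mul_le_mul_of_nonneg_left cac (show 0 ≤ (q - 1) * E1 by have : 0 ≤ q - 1 := by linarith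
                                                                     positivity)
  have h2 : (q - 1) * (E1 * C1 * D ^ 2 * IV) ≤ q * (E1 * C1 * D ^ 2 * IV) := by
    gcongr; linarith
  have h3 : 1 * (8 * n * D ^ 2 * IV) ≤ q * (8 * n * D ^ 2 * IV) := by
    gcongr; linarith
  have h4 : 0 ≤ q * D ^ 2 * IV := by positivity
  linarith
end
end RH

namespace RH
section
variable {n : ℕ}

lemma norm_fderiv_le_pd (Φ : (Fin n → ℝ) → ℝ) (x : Fin n → ℝ) : ‖fderiv ℝ Φ x‖ ≤ ∑ a, |pd a Φ x| := by
  refine ContinuousLinearMap.opNorm_le_bound _ (Finset.sum_nonneg fun a _ => abs_nonneg _) fun y => ?_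
  have : y = ∑ a, y a • (Pi.single a (1:ℝ) : Fin n → ℝ) := by
    ext i; simp [Finset.sum_apply, Pi.single_apply]
  conv_lhs => rw [this, map_sum]
  refine (norm_sum_le _ _).trans ?_
  rw [Finset.sum_mul]
  refine Finset.sum_le_sum fun a _ => ?_
  rw [map_smul, norm_smul, mul_comm, Real.norm_eq_abs]
  exact mul_le_mul_of_nonneg_left (norm_le_pi_norm y a) (abs_nonneg _)

lemma sobolev (hn : 3 ≤ n) : ∃ S : ℝ, 0 ≤ S ∧ ∀ Φ : (Fin n → ℝ) → ℝ, ContDiff ℝ 1 Φ → HasCompactSupport Φ →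
    (∫ x, |Φ x| ^ (2 * (n:ℝ) / (n - 2))) ^ (((n:ℝ) - 2) / n) ≤ S * ∫ x, ∑ a, pd a Φ x ^ 2 := by
  have hn3 : (3:ℝ) ≤ n := by exact_mod_cast hn
  set A := eLpNormLESNormFDerivOfEqInnerConst (volume : Measure (Fin n → ℝ)) ((2:NNReal) : ℝ) with hA
  refine ⟨(A:ℝ) ^ 2 * n, by positivity, fun Φ hΦ hc => ?_⟩
  set p' : NNReal := ⟨2 * (n:ℝ) / (n - 2), by apply div_nonneg <;> linarith⟩ with hp'
  have hp'v : (p' : ℝ) = 2 * (n:ℝ) / (n - 2) := rfl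
  have hp'0 : p' ≠ 0 := by
    intro h
    have : (p':ℝ) = 0 := by rw [h]; rfl
    rw [hp'v, div_eq_zero_iff] at this
    rcases this with h | h <;> linarith
  have sob := eLpNorm_le_eLpNorm_fderiv_of_eq_inner (volume : Measure (Fin n → ℝ)) hΦ hc (p := 2) (p' := p')
    (by norm_num) (by simp; omega) (by
      rw [hp'v]
      simp only [Module.finrank_fintype_fun_eq_card, Fintype.card_fin]
      have : (n:ℝ) - 2 ≠ 0 := by linarith
      have : (n:ℝ) ≠ 0 := by linarith
      push_cast
      field_simp)
  have hcf : Continuous (fderiv ℝ Φ) := hΦ.continuous_fderiv one_ne_zero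
  have m1 : MemLp Φ p' := hΦ.continuous.memLp_of_hasCompactSupport hc
  have m2 : MemLp (fderiv ℝ Φ) ((2 : NNReal) : ENNReal) := hcf.memLp_of_hasCompactSupport (hc.fderiv ℝ)
  rw [m1.eLpNorm_eq_integral_rpow_norm (by exact_mod_cast hp'0) ENNReal.coe_ne_top,
    m2.eLpNorm_eq_integral_rpow_norm (by simp) ENNReal.coe_ne_top] at sob
  rw [← hA, ← ENNReal.ofReal_coe_nnreal (p := A), ← ENNReal.ofReal_mul (by positivity),
    ENNReal.ofReal_le_ofReal_iff (by positivity)] at sob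
  simp only [ENNReal.coe_toReal, hp'v, NNReal.coe_ofNat] at sob
  have i2 : 0 ≤ ∫ x, ‖fderiv ℝ Φ x‖ ^ (2:ℝ) := integral_nonneg fun x => by positivity
  have i1 : 0 ≤ ∫ x, ‖Φ x‖ ^ (2 * (n:ℝ) / (n - 2)) := integral_nonneg fun x => by positivity
  have sob2 := pow_le_pow_left₀ (by positivity) sob 2
  rw [mul_pow, ← Real.rpow_natCast, ← Real.rpow_mul i1, ← Real.rpow_natCast ((∫ x, ‖fderiv ℝ Φ x‖ ^ (2:ℝ)) ^ (2:ℝ)⁻¹),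
    ← Real.rpow_mul i2] at sob2
  have e1 : (2 * (n:ℝ) / (n - 2))⁻¹ * ((2:ℕ):ℝ) = ((n:ℝ) - 2) / n := by
    have : (n:ℝ) - 2 ≠ 0 := by linarith
    have : (n:ℝ) ≠ 0 := by linarith
    push_cast; field_simp
  have e2 : (2:ℝ)⁻¹ * ((2:ℕ):ℝ) = 1 := by norm_num
  rw [e1, e2, Real.rpow_one] at sob2
  refine sob2.trans ?_
  rw [mul_assoc]
  refine mul_le_mul_of_nonneg_left ?_ (by positivity)
  rw [← integral_const_mul]
  refine integral_mono_of_nonneg (Filter.Eventually.of_forall fun x => by positivity) ?_ (Filter.Eventually.of_forall fun x => ?_)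
  · refine Integrable.const_mul (integrable_finsetSum _ fun a _ => ?_) _
    have hpc := (pd_contDiff (m := 0) (by exact_mod_cast hΦ) a).continuous
    simp only [sq]
    exact (hpc.mul hpc).integrable_of_hasCompactSupport (pd_hcs hc a).mul_left
  · simp only []
    have h1 := norm_fderiv_le_pd Φ x
    have h2 : (∑ a, |pd a Φ x|) ^ 2 ≤ n * ∑ a, pd a Φ x ^ 2 := by
      have := sq_sum_le_card_mul_sum_sq (s := (Finset.univ : Finset (Fin n))) (f := fun a => |pd a Φ x|)
      simpa using this
    rw [Real.rpow_two]
    exact (pow_le_pow_left₀ (norm_nonneg _) h1 2).trans h2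

lemma reverse_w (hn : 3 ≤ n) (κ : ℕ) (hκ : κ + 2 ≤ n) (C : ℝ) (hC : 1 ≤ C) : ∃ C' : ℝ, 1 ≤ C' ∧
    ∀ (q : ℝ) (K B : Set (Fin n → ℝ)) (u h v w G : (Fin n → ℝ) → ℝ) (X g : Fin n → (Fin n → ℝ) → ℝ),
    Core κ C q K u h v w G X g → 2 < q → ∀ (η : (Fin n → ℝ) → ℝ) (D : ℝ), ContDiff ℝ 1 η →
    (∀ x, 0 ≤ η x) → (∀ x, η x ≤ 1) → tsupport η ⊆ K → (∀ x a, |pd a η x| ≤ D) → 1 ≤ D →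
    MeasurableSet B → B ⊆ K → (∀ x ∈ B, η x = 1) → (∀ x ∈ K, v x ^ (q - 1) ≤ 2 * w x ^ (q - 1)) →
    (∫ x in B, v x ^ ((q - 1) * (n / (n - 2)))) ^ (((n:ℝ) - 2) / n)
      ≤ C' * q * D ^ 2 * ∫ x in K, v x ^ (κ + 1) * v x ^ q := by
  obtain ⟨C1, hC1, hC1b⟩ := energy (n := n) κ hκ C hC
  obtain ⟨S, hS, hSb⟩ := sobolev hn
  have hn3 : (3:ℝ) ≤ n := by exact_mod_cast hn
  refine ⟨2 * (S * C1) + 1, by have : 0 ≤ S * C1 := by positivity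
                               linarith, ?_⟩
  intro q K B u h v w G X g cr hq η D hη hη0 hη1 hηK hηD hD hB hBK hB1 hvw
  have en := hC1b q K u h v w G X g cr hq η D hη hη0 hη1 hηK hηD hD
  have hwpos : ∀ x ∈ K, 0 < w x := fun x hx => by linarith [cr.wv x hx, cr.hv1 x hx]
  have hvpos : ∀ x ∈ K, 0 < v x := fun x hx => by linarith [cr.hv1 x hx]
  have hw1 : ContDiff ℝ 1 w := cr.hw.of_le (by norm_num)
  have hep : ∀ x ∈ tsupport η, 0 < w x := fun x hx => hwpos x (hηK hx)
  set Φ : (Fin n → ℝ) → ℝ := fun x => η x * w x ^ ((q - 1) / 2) with hΦd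
  have hΦ : ContDiff ℝ 1 Φ :=
    cut_contDiff (m := 1) (by exact_mod_cast hη) (by exact_mod_cast hw1) hep _
  have hΦt : tsupport Φ ⊆ K := cut_tsupport.trans hηK
  have hΦc : HasCompactSupport Φ := cr.hK.of_isClosed_subset (isClosed_tsupport _) hΦt
  have sob := hSb Φ hΦ hΦc
  rw [setIntegral_eq_integral_of_forall_compl_eq_zero (fun x hx => by simp [(zero_off hΦt hx).2])] at en
  set IV := ∫ x in K, v x ^ (κ + 1) * v x ^ q with hIV
  have hIV0 : 0 ≤ IV := setIntegral_nonneg cr.hK.measurableSet fun x hx => by have := hvpos x hx; positivity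
  set t : ℝ := (n:ℝ) / (n - 2) with ht
  have hn2 : 0 < (n:ℝ) - 2 := by linarith
  have ht0 : 0 < t := by positivity
  have hti : ((n:ℝ) - 2) / n = t⁻¹ := by rw [ht, inv_div]
  rw [hti] at sob ⊢
  have e2 : 2 * (n:ℝ) / (n - 2) = 2 * t := by rw [ht]; ring
  rw [e2] at sob
  have intB : ∫ x in B, v x ^ ((q - 1) * t) ≤ 2 ^ t * ∫ x, |Φ x| ^ (2 * t) := by
    have iΦ : Integrable (fun x => |Φ x| ^ (2 * t)) := by
      have c : Continuous (fun x => |Φ x| ^ (2 * t)) := (continuous_abs.comp hΦ.continuous).rpow_const fun x => Or.inr (by positivity)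
      refine c.integrable_of_hasCompactSupport ?_
      refine hΦc.mono ?_
      intro x hx
      simp only [Function.mem_support] at hx ⊢
      intro h0
      rw [h0] at hx
      exact hx (by rw [abs_zero, Real.zero_rpow (by positivity)])
    calc _ ≤ ∫ x in B, 2 ^ t * |Φ x| ^ (2 * t) := by
          refine setIntegral_mono_on ?_ (iΦ.const_mul _).integrableOn hB fun x hx => ?_
          · refine IntegrableOn.mono_set ?_ hBK
            refine ContinuousOn.integrableOn_compact cr.hK (cr.hv.rpow_const fun x hx => Or.inl (hvpos x hx).ne')
          · have hx' := hBK hx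
            have hwx := hwpos x hx'
            have hvx := hvpos x hx'
            have e3 : |Φ x| ^ (2 * t) = (w x ^ (q - 1)) ^ t := by
              rw [hΦd]
              simp only [hB1 x hx, one_mul]
              rw [abs_of_nonneg (by positivity), Real.rpow_mul (by positivity)]
              congr 1
              rw [← Real.rpow_mul hwx.le]; congr 1; ring
            rw [e3, Real.rpow_mul hvx.le, ← Real.mul_rpow (by norm_num) (by positivity)]
            exact Real.rpow_le_rpow (by positivity) (hvw x hx') ht0.le
      _ ≤ _ := by
          rw [integral_const_mul]
          refine mul_le_mul_of_nonneg_left ?_ (by positivity)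
          exact setIntegral_le_integral iΦ (Filter.Eventually.of_forall fun x => by positivity)
  have iB0 : 0 ≤ ∫ x in B, v x ^ ((q - 1) * t) := setIntegral_nonneg hB fun x hx => by
    have := hvpos x (hBK hx); positivity
  have h1 := Real.rpow_le_rpow iB0 intB (inv_nonneg.2 ht0.le)
  rw [Real.mul_rpow (by positivity) (integral_nonneg fun x => by positivity), ← Real.rpow_mul (by norm_num),
    mul_inv_cancel₀ ht0.ne', Real.rpow_one] at h1
  have h2 := mul_le_mul_of_nonneg_left en hS
  have h4 : 0 ≤ q * D ^ 2 * IV := by positivity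
  linarith
end
end RH

namespace RH
section
variable {n : ℕ}

lemma memLp_cont {K B : Set (Fin n → ℝ)} {f : (Fin n → ℝ) → ℝ} (hK : IsCompact K) (hB : MeasurableSet B) (hBK : B ⊆ K)
    (hf : ContinuousOn f K) (p : ENNReal) : MemLp f p (volume.restrict B) := by
  obtain ⟨c, hc⟩ := hK.exists_bound_of_continuousOn hf
  haveI : IsFiniteMeasure (volume.restrict B) :=
    ⟨by rw [Measure.restrict_apply_univ]; exact (measure_mono hBK).trans_lt hK.measure_lt_top⟩
  refine MemLp.of_bound ((hf.mono hBK).aestronglyMeasurable hB) c ?_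
  exact (ae_restrict_iff' hB).2 (Filter.Eventually.of_forall fun x hx => hc x (hBK hx))

lemma interp (hn : 3 ≤ n) (k : ℕ) (hk : 2 ≤ k) {K B : Set (Fin n → ℝ)} {v : (Fin n → ℝ) → ℝ} {q M : ℝ}
    (hK : IsCompact K) (hB : MeasurableSet B) (hBK : B ⊆ K) (hv : ContinuousOn v K) (hv1 : ∀ x ∈ K, 1 ≤ v x)
    (hM : ∫ x in B, v x ^ ((k : ℝ) * n / 2) ≤ M) :
    (∫ x in B, v x ^ (((k : ℝ) * n / ((k : ℝ) * n - 2 * k + 2)) * q)) ^ (((k : ℝ) * n / ((k : ℝ) * n - 2 * k + 2))⁻¹)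
    ≤ (∫ x in B, v x ^ ((q - 1) * ((n:ℝ) / (n - 2)))) ^ (((n:ℝ) - 2) / n) * M ^ (2 / ((k:ℝ) * n)) := by
  have hn3 : (3:ℝ) ≤ n := by exact_mod_cast hn
  have hk2 : (2:ℝ) ≤ k := by exact_mod_cast hk
  have hden : 0 < (k : ℝ) * n - 2 * k + 2 := by nlinarith
  have hn2 : 0 < (n:ℝ) - 2 := by linarith
  set β : ℝ := (k : ℝ) * n / ((k : ℝ) * n - 2 * k + 2) with hβ
  have hβ0 : 0 < β := by positivity
  set a : ℝ := β * ((n:ℝ) - 2) / n with ha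
  set b : ℝ := 2 * β / (k * n) with hb
  have ha0 : 0 < a := by positivity
  have hb0 : 0 < b := by positivity
  have hab : a + b = 1 := by
    rw [ha, hb, hβ]; field_simp; try ring
  have hpos : ∀ x ∈ K, 0 < v x := fun x hx => by linarith [hv1 x hx]
  set P : ℝ := (q - 1) * ((n:ℝ) / (n - 2)) with hP
  set Q : ℝ := (k : ℝ) * n / 2 with hQ
  have hsum : β * q = P * a + Q * b := by
    rw [hP, hQ, ha, hb]; field_simp; ring
  have cont : ∀ s : ℝ, ContinuousOn (fun x => v x ^ s) K := fun s => hv.rpow_const fun x hx => Or.inl (hpos x hx).ne'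
  have hol := integral_mul_le_Lp_mul_Lq_of_nonneg (μ := volume.restrict B) (p := a⁻¹) (q := b⁻¹)
    (f := fun x => v x ^ (P * a)) (g := fun x => v x ^ (Q * b))
    (by
      refine ⟨by simp [hab], by positivity, by positivity⟩)
    ((ae_restrict_iff' hB).2 (Filter.Eventually.of_forall fun x hx => by have := hpos x (hBK hx); positivity))
    ((ae_restrict_iff' hB).2 (Filter.Eventually.of_forall fun x hx => by have := hpos x (hBK hx); positivity))
    (memLp_cont hK hB hBK (cont _) _) (memLp_cont hK hB hBK (cont _) _)
  have e1 : ∫ x in B, v x ^ (P * a) * v x ^ (Q * b) = ∫ x in B, v x ^ (β * q) :=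
    setIntegral_congr_fun hB fun x hx => by
      have := hpos x (hBK hx)
      rw [← Real.rpow_add this, hsum]
  have e2 : ∫ x in B, (v x ^ (P * a)) ^ a⁻¹ = ∫ x in B, v x ^ P :=
    setIntegral_congr_fun hB fun x hx => by
      have := hpos x (hBK hx)
      rw [← Real.rpow_mul this.le, mul_assoc, mul_inv_cancel₀ ha0.ne', mul_one]
  have e3 : ∫ x in B, (v x ^ (Q * b)) ^ b⁻¹ = ∫ x in B, v x ^ Q :=
    setIntegral_congr_fun hB fun x hx => by
      have := hpos x (hBK hx)
      rw [← Real.rpow_mul this.le, mul_assoc, mul_inv_cancel₀ hb0.ne', mul_one]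
  rw [e1, e2, e3, one_div, one_div, inv_inv, inv_inv] at hol
  have p1 : ∀ s : ℝ, 0 ≤ ∫ x in B, v x ^ s := fun s => setIntegral_nonneg hB fun x hx => by
    have := hpos x (hBK hx); positivity
  have hM0 : 0 ≤ M := (p1 _).trans hM
  have h1 : (∫ x in B, v x ^ (β * q)) ≤ (∫ x in B, v x ^ P) ^ a * M ^ b :=
    hol.trans (mul_le_mul_of_nonneg_left (Real.rpow_le_rpow (p1 _) hM hb0.le) (Real.rpow_nonneg (p1 _) _))
  have h2 := Real.rpow_le_rpow (p1 _) h1 (inv_nonneg.2 hβ0.le)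
  rw [Real.mul_rpow (Real.rpow_nonneg (p1 _) _) (Real.rpow_nonneg hM0 _), ← Real.rpow_mul (p1 _), ← Real.rpow_mul hM0] at h2
  have e4 : a * β⁻¹ = ((n:ℝ) - 2) / n := by rw [ha]; field_simp
  have e5 : b * β⁻¹ = 2 / ((k:ℝ) * n) := by rw [hb]; field_simp
  rwa [e4, e5] at h2

/-- one dimensional bump -/
lemma bump1 : ∃ c : ℝ, 1 ≤ c ∧ ∀ s : ℝ, |deriv Real.smoothTransition s| ≤ c := by
  have hc : Continuous (deriv Real.smoothTransition) :=
    (Real.smoothTransition.contDiff (n := 1)).continuous_deriv le_rfl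
  obtain ⟨c, hc'⟩ := (isCompact_Icc (a := (0:ℝ)) (b := 1)).exists_bound_of_continuousOn hc.continuousOn
  refine ⟨max c 1, le_max_right _ _, fun s => ?_⟩
  by_cases hs : s ∈ Icc (0:ℝ) 1
  · exact (hc' s hs).trans (le_max_left _ _)
  · have : deriv Real.smoothTransition s = 0 := by
      rw [mem_Icc, not_and_or, not_le, not_le] at hs
      rcases hs with h | h
      · have : Real.smoothTransition =ᶠ[nhds s] fun _ => 0 := by
          filter_upwards [Iio_mem_nhds h] with y hy
          exact Real.smoothTransition.zero_of_nonpos (le_of_lt hy)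
        rw [this.deriv_eq]; simp
      · have : Real.smoothTransition =ᶠ[nhds s] fun _ => 1 := by
          filter_upwards [Ioi_mem_nhds h] with y hy
          exact Real.smoothTransition.one_of_one_le (le_of_lt hy)
        rw [this.deriv_eq]; simp
    rw [this, abs_zero]
    exact zero_le_one.trans (le_max_right _ _)

/-- cube cut-off -/
lemma cutoff : ∃ c : ℝ, 1 ≤ c ∧ ∀ (x₀ : Fin n → ℝ) (r ρ : ℝ), 0 < r → 0 < ρ → ∃ η : (Fin n → ℝ) → ℝ,
    ContDiff ℝ 1 η ∧ (∀ x, 0 ≤ η x) ∧ (∀ x, η x ≤ 1) ∧ tsupport η ⊆ closedBall x₀ (r + ρ) ∧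
    (∀ x a, |pd a η x| ≤ c / ρ) ∧ ∀ x ∈ ball x₀ r, η x = 1 := by
  obtain ⟨c, hc1, hc⟩ := bump1
  refine ⟨2 * c, by linarith, fun x₀ r ρ hr hρ => ?_⟩
  set τ := Real.smoothTransition with hτ
  have hτc : ContDiff ℝ 1 τ := Real.smoothTransition.contDiff
  set b : Fin n → ℝ → ℝ := fun i s => τ ((r + ρ - (s - x₀ i)) / ρ) * τ ((r + ρ + (s - x₀ i)) / ρ) with hb
  have hτ0 : ∀ s, 0 ≤ τ s := Real.smoothTransition.nonneg
  have hτ1 : ∀ s, τ s ≤ 1 := Real.smoothTransition.le_one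
  have hb0 : ∀ i s, 0 ≤ b i s := fun i s => mul_nonneg (hτ0 _) (hτ0 _)
  have hb1 : ∀ i s, b i s ≤ 1 := fun i s => mul_le_one₀ (hτ1 _) (hτ0 _) (hτ1 _)
  have hbc : ∀ i, ContDiff ℝ 1 (b i) := by
    intro i
    refine ContDiff.mul (hτc.comp ?_) (hτc.comp ?_)
    · exact (contDiff_const.sub (contDiff_id.sub contDiff_const)).div_const _
    · exact (contDiff_const.add (contDiff_id.sub contDiff_const)).div_const _
  have hbd : ∀ i s, |deriv (b i) s| ≤ 2 * c / ρ := by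
    intro i s
    have h1 : HasDerivAt (fun s => τ ((r + ρ - (s - x₀ i)) / ρ)) (deriv τ ((r + ρ - (s - x₀ i)) / ρ) * (-1 / ρ)) s := by
      refine HasDerivAt.comp s ((hτc.differentiable one_ne_zero) _).hasDerivAt ?_
      have := (((hasDerivAt_id s).sub_const (x₀ i)).const_sub (r + ρ)).div_const ρ
      simpa using this
    have h2 : HasDerivAt (fun s => τ ((r + ρ + (s - x₀ i)) / ρ)) (deriv τ ((r + ρ + (s - x₀ i)) / ρ) * (1 / ρ)) s := by
      refine HasDerivAt.comp s ((hτc.differentiable one_ne_zero) _).hasDerivAt ?_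
      have := (((hasDerivAt_id s).sub_const (x₀ i)).const_add (r + ρ)).div_const ρ
      simpa using this
    have h3 := (h1.mul h2).deriv
    have h4 : deriv (b i) s = _ := h3
    rw [h4]
    refine (abs_add_le _ _).trans ?_
    have k1 := hc ((r + ρ - (s - x₀ i)) / ρ)
    have k2 := hc ((r + ρ + (s - x₀ i)) / ρ)
    have k3 : |τ ((r + ρ + (s - x₀ i)) / ρ)| ≤ 1 := by rw [abs_of_nonneg (hτ0 _)]; exact hτ1 _
    have k4 : |τ ((r + ρ - (s - x₀ i)) / ρ)| ≤ 1 := by rw [abs_of_nonneg (hτ0 _)]; exact hτ1 _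
    have a1 : |(-1:ℝ) / ρ| = 1 / ρ := by rw [abs_div, abs_neg, abs_one, abs_of_pos hρ]
    have a2 : |(1:ℝ) / ρ| = 1 / ρ := by rw [abs_div, abs_one, abs_of_pos hρ]
    rw [abs_mul, abs_mul, abs_mul, abs_mul, a1, a2]
    calc _ ≤ c * (1 / ρ) * 1 + 1 * (c * (1 / ρ)) := by gcongr
      _ = _ := by ring
  have hbz : ∀ i s, b i s ≠ 0 → |s - x₀ i| ≤ r + ρ := by
    intro i s h
    by_contra hlt
    rw [not_le, lt_abs] at hlt
    apply h
    rcases hlt with h1 | h1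
    · simp only [hb]
      rw [hτ, Real.smoothTransition.zero_of_nonpos (div_nonpos_of_nonpos_of_nonneg (by linarith) hρ.le), zero_mul]
    · simp only [hb]
      rw [hτ, Real.smoothTransition.zero_of_nonpos (x := (r + ρ + (s - x₀ i)) / ρ) (div_nonpos_of_nonpos_of_nonneg (by linarith) hρ.le), mul_zero]
  have hbo : ∀ i s, |s - x₀ i| ≤ r → b i s = 1 := by
    intro i s h
    rw [abs_le] at h
    simp only [hb]
    rw [hτ, Real.smoothTransition.one_of_one_le, Real.smoothTransition.one_of_one_le, one_mul]
    · rw [le_div_iff₀ hρ]; linarith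
    · rw [le_div_iff₀ hρ]; linarith
  refine ⟨fun x => ∏ i, b i (x i), ?_, fun x => Finset.prod_nonneg fun i _ => hb0 _ _,
    fun x => Finset.prod_le_one (fun i _ => hb0 _ _) fun i _ => hb1 _ _, ?_, ?_, ?_⟩
  · exact contDiff_prod fun i _ => (hbc i).comp (contDiff_apply ℝ ℝ i)
  · refine closure_minimal ?_ isClosed_closedBall
    intro x hx
    rw [mem_closedBall, dist_pi_le_iff (by linarith)]
    intro i
    rw [Real.dist_eq]
    refine hbz i _ fun h => hx ?_
    exact Finset.prod_eq_zero (Finset.mem_univ i) h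
  · intro x a
    -- derivative along a single coordinate
    have hd : DifferentiableAt ℝ (fun x : Fin n → ℝ => ∏ i, b i (x i)) x :=
      (contDiff_prod fun i _ => (hbc i).comp (contDiff_apply ℝ ℝ i) : ContDiff ℝ 1 _).differentiable one_ne_zero x
    have h1 : pd a (fun x : Fin n → ℝ => ∏ i, b i (x i)) x = deriv (fun t : ℝ => ∏ i, b i ((x + t • (Pi.single a 1 : Fin n → ℝ)) i)) 0 := by
      unfold pd
      rw [← hd.lineDeriv_eq_fderiv]; rfl
    rw [h1]
    have h2 : (fun t : ℝ => ∏ i, b i ((x + t • (Pi.single a 1 : Fin n → ℝ)) i)) =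
        fun t => b a (x a + t) * ∏ i ∈ Finset.univ.erase a, b i (x i) := by
      ext t
      rw [← Finset.mul_prod_erase _ _ (Finset.mem_univ a)]
      congr 1
      · simp
      · refine Finset.prod_congr rfl fun i hi => ?_
        simp [Finset.ne_of_mem_erase hi]
    rw [h2, deriv_mul_const_field, deriv_comp_const_add, add_zero, abs_mul]
    have h3 : |∏ i ∈ Finset.univ.erase a, b i (x i)| ≤ 1 := by
      rw [abs_of_nonneg (Finset.prod_nonneg fun i _ => hb0 _ _)]
      exact Finset.prod_le_one (fun i _ => hb0 _ _) fun i _ => hb1 _ _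
    calc _ ≤ 2 * c / ρ * 1 := mul_le_mul (hbd _ _) h3 (abs_nonneg _) (by positivity)
      _ = _ := mul_one _
  · intro x hx
    refine Finset.prod_eq_one fun i _ => hbo i _ ?_
    rw [mem_ball] at hx
    have := (dist_le_pi_dist x x₀ i).trans hx.le
    rwa [Real.dist_eq] at this
end
end RH

namespace RH
section
variable {n : ℕ}

lemma c11_data {E : Type*} [NormedAddCommGroup E] [NormedSpace ℝ E] {g : E → ℝ} {O Q : Set E}
    (hO : IsOpen O) (hg : C11On g O) (hQ : IsCompact Q) (hQc : Convex ℝ Q) (hQO : Q ⊆ O) :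
    ∃ C : ℝ, 1 ≤ C ∧ (∀ y ∈ Q, DifferentiableAt ℝ g y) ∧ (∀ y ∈ Q, |g y| ≤ C) ∧ (∀ y ∈ Q, ‖fderiv ℝ g y‖ ≤ C) ∧
      (∀ y ∈ Q, ∀ z ∈ Q, ‖fderiv ℝ g y - fderiv ℝ g z‖ ≤ C * ‖y - z‖) ∧
      (∀ y ∈ Q, ∀ z ∈ Q, |g y - g z| ≤ C * ‖y - z‖) ∧
      (∀ y ∈ Q, ∀ z ∈ Q, |g z - g y - fderiv ℝ g y (z - y)| ≤ C * ‖z - y‖ ^ 2) := by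
  obtain ⟨hg1, hg2⟩ := hg
  have hd : ∀ y ∈ Q, DifferentiableAt ℝ g y := fun y hy =>
    (hg1.contDiffAt (hO.mem_nhds (hQO hy))).differentiableAt one_ne_zero
  have hcd : ContinuousOn (fderiv ℝ g) Q := (hg1.continuousOn_fderiv_of_isOpen hO le_rfl).mono hQO
  obtain ⟨c1, hc1⟩ := hQ.exists_bound_of_continuousOn (hg1.continuousOn.mono hQO)
  obtain ⟨c2, hc2⟩ := hQ.exists_bound_of_continuousOn hcd
  have hll : LocallyLipschitzOn Q (fderiv ℝ g) := by
    intro x hx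
    obtain ⟨K, t, ht, hK⟩ := hg2 x (hQO hx)
    rw [hO.nhdsWithin_eq (hQO hx)] at ht
    refine ⟨K, t ∩ O, mem_nhdsWithin_of_mem_nhds (Filter.inter_mem ht (hO.mem_nhds (hQO hx))), ?_⟩
    intro y hy z hz
    have := hK hy.1 hz.1
    rwa [fderivWithin_of_isOpen hO hy.2, fderivWithin_of_isOpen hO hz.2] at this
  obtain ⟨c3, hc3⟩ := hll.exists_lipschitzOnWith_of_compact hQ
  have h3 : ∀ y ∈ Q, ∀ z ∈ Q, ‖fderiv ℝ g y - fderiv ℝ g z‖ ≤ c3 * ‖y - z‖ := fun y hy z hz => by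
    have := hc3.dist_le_mul y hy z hz
    rwa [dist_eq_norm, dist_eq_norm] at this
  set C : ℝ := 1 + |c1| + |c2| + c3 with hC
  have a1 := abs_nonneg c1
  have a2 := abs_nonneg c2
  have a3 : (0:ℝ) ≤ c3 := c3.2
  refine ⟨C, by linarith, hd, fun y hy => (hc1 y hy).trans (by linarith [le_abs_self c1]),
    fun y hy => (hc2 y hy).trans (by linarith [le_abs_self c2]), fun y hy z hz => (h3 y hy z hz).trans ?_,
    fun y hy z hz => ?_, fun y hy z hz => ?_⟩
  · exact mul_le_mul_of_nonneg_right (by linarith) (norm_nonneg _)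
  · have := hQc.norm_image_sub_le_of_norm_fderiv_le hd hc2 hz hy
    refine this.trans (mul_le_mul_of_nonneg_right (by linarith [le_abs_self c2]) (norm_nonneg _))
  · have hseg : segment ℝ y z ⊆ Q := hQc.segment_subset hy hz
    have := (convex_segment y z).norm_image_sub_le_of_norm_hasFDerivWithin_le' (𝕜 := ℝ) (f := g)
      (f' := fderiv ℝ g) (φ := fderiv ℝ g y) (C := c3 * ‖z - y‖)
      (fun w hw => (hd w (hseg hw)).hasFDerivAt.hasFDerivWithinAt)
      (fun w hw => (h3 w (hseg hw) y hy).trans (mul_le_mul_of_nonneg_left (norm_sub_le_of_mem_segment hw) a3))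
      (left_mem_segment ℝ y z) (right_mem_segment ℝ y z)
    refine this.trans ?_
    have := norm_nonneg (z - y)
    have h : c3 * ‖z - y‖ * ‖z - y‖ = c3 * ‖z - y‖ ^ 2 := by ring
    rw [h]
    exact mul_le_mul_of_nonneg_right (by linarith) (by positivity)

/-- bounded Lipschitz functions -/
def BL {E : Type*} [NormedAddCommGroup E] (Q : Set E) (φ : E → ℝ) : Prop :=
  ∃ c : ℝ, (∀ y ∈ Q, |φ y| ≤ c) ∧ ∀ y ∈ Q, ∀ z ∈ Q, |φ y - φ z| ≤ c * ‖y - z‖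

variable {E : Type*} [NormedAddCommGroup E] {Q : Set E} {φ ψ : E → ℝ}

lemma BL.mk' (c d : ℝ) (h1 : ∀ y ∈ Q, |φ y| ≤ c) (h2 : ∀ y ∈ Q, ∀ z ∈ Q, |φ y - φ z| ≤ d * ‖y - z‖) : BL Q φ :=
  ⟨max c d, fun y hy => (h1 y hy).trans (le_max_left _ _), fun y hy z hz => (h2 y hy z hz).trans
    (mul_le_mul_of_nonneg_right (le_max_right _ _) (norm_nonneg _))⟩

lemma BL.const (c : ℝ) : BL Q (fun _ => c) := BL.mk' |c| 0 (fun _ _ => le_rfl) (fun y _ z _ => by simp)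

lemma BL.add (h1 : BL Q φ) (h2 : BL Q ψ) : BL Q (fun y => φ y + ψ y) := by
  obtain ⟨c, a, b⟩ := h1
  obtain ⟨d, a', b'⟩ := h2
  refine ⟨c + d, fun y hy => (abs_add_le _ _).trans (add_le_add (a y hy) (a' y hy)), fun y hy z hz => ?_⟩
  have e : φ y + ψ y - (φ z + ψ z) = (φ y - φ z) + (ψ y - ψ z) := by ring
  rw [e, add_mul]
  exact (abs_add_le _ _).trans (add_le_add (b y hy z hz) (b' y hy z hz))

lemma BL.mul (h1 : BL Q φ) (h2 : BL Q ψ) : BL Q (fun y => φ y * ψ y) := by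
  obtain ⟨c, a, b⟩ := h1
  obtain ⟨d, a', b'⟩ := h2
  refine BL.mk' (|c| * |d|) (2 * |c| * |d|) (fun y hy => ?_) (fun y hy z hz => ?_)
  · rw [abs_mul]
    exact mul_le_mul ((a y hy).trans (le_abs_self c)) ((a' y hy).trans (le_abs_self d)) (abs_nonneg _) (abs_nonneg _)
  · have e : φ y * ψ y - φ z * ψ z = φ y * (ψ y - ψ z) + (φ y - φ z) * ψ z := by ring
    have n0 := norm_nonneg (y - z)
    have h1 : |φ y * (ψ y - ψ z)| ≤ |c| * (|d| * ‖y - z‖) := by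
      rw [abs_mul]
      exact mul_le_mul ((a y hy).trans (le_abs_self c)) ((b' y hy z hz).trans
        (mul_le_mul_of_nonneg_right (le_abs_self d) n0)) (abs_nonneg _) (abs_nonneg _)
    have h2 : |(φ y - φ z) * ψ z| ≤ (|c| * ‖y - z‖) * |d| := by
      rw [abs_mul]
      exact mul_le_mul ((b y hy z hz).trans (mul_le_mul_of_nonneg_right (le_abs_self c) n0))
        ((a' z hz).trans (le_abs_self d)) (abs_nonneg _) (by positivity)
    rw [e]
    refine (abs_add_le _ _).trans ?_
    linarith

lemma BL.pow (h1 : BL Q φ) (m : ℕ) : BL Q (fun y => φ y ^ m) := by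
  induction m with
  | zero => simpa using BL.const (Q := Q) 1
  | succ m ih => simpa [pow_succ] using ih.mul h1

lemma BL.sum {ι : Type*} (s : Finset ι) {φ : ι → E → ℝ} (h : ∀ i, BL Q (φ i)) : BL Q (fun y => ∑ i ∈ s, φ i y) := by
  classical
  induction s using Finset.induction_on with
  | empty => simpa using BL.const (Q := Q) 0
  | insert a s ha ih => simpa [Finset.sum_insert ha] using (h a).add ih

/-- uniform first order difference quotients. -/
lemma dq_unif {p : (Fin n → ℝ) → ℝ} (hp : ContDiff ℝ 1 p) (hc : HasCompactSupport p) {ε : ℝ} (hε : 0 < ε) :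
    ∃ t₀ : ℝ, 0 < t₀ ∧ ∀ x, ∀ l : Fin n, ∀ s : ℝ, |s| ≤ t₀ →
      |p (x + s • Pi.single l 1) - p x - s * pd l p x| ≤ ε * |s| := by
  have huc : ∀ l : Fin n, UniformContinuous (pd l p) := fun l =>
    (pd_hcs hc l).uniformContinuous_of_continuous (pd_contDiff (m := 0) hp l).continuous
  have h1 : ∀ l : Fin n, ∃ t₀ : ℝ, 0 < t₀ ∧ ∀ x y, dist x y < t₀ → |pd l p x - pd l p y| < ε := fun l =>
    Metric.uniformContinuous_iff.1 (huc l) ε hε |>.imp fun d hd => ⟨hd.1, fun x y hxy => hd.2 hxy⟩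
  choose d hd0 hd using h1
  obtain ⟨t, ht0, ht⟩ : ∃ t : ℝ, 0 < t ∧ ∀ l, t < d l := by
    rcases isEmpty_or_nonempty (Fin n) with he | he
    · exact ⟨1, one_pos, fun l => he.elim l⟩
    · obtain ⟨l₀, hl₀⟩ := Finite.exists_min d
      exact ⟨d l₀ / 2, by have := hd0 l₀; positivity, fun l => by have := hd0 l₀; have := hl₀ l; linarith⟩
  refine ⟨t, ht0, fun x l s hs => ?_⟩
  have hder : ∀ r : ℝ, HasDerivAt (fun r : ℝ => p (x + r • Pi.single l 1) - r * pd l p x)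
      (pd l p (x + r • Pi.single l 1) - pd l p x) r := by
    intro r
    have h2 : HasDerivAt (fun r : ℝ => x + r • (Pi.single l 1 : Fin n → ℝ)) (Pi.single l 1) r := by
      simpa using ((hasDerivAt_id r).smul_const (Pi.single l (1:ℝ) : Fin n → ℝ)).const_add x
    have h3 := ((hp.differentiable one_ne_zero) (x + r • Pi.single l 1)).hasFDerivAt.comp_hasDerivAt r h2
    have h4 := h3.sub ((hasDerivAt_id r).mul_const (pd l p x))
    refine h4.congr_deriv ?_
    simp [pd]
  have := (convex_uIcc (0:ℝ) s).norm_image_sub_le_of_norm_hasDerivWithin_le (C := ε)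
    (fun r _ => (hder r).hasDerivWithinAt) (fun r hr => ?_) left_mem_uIcc right_mem_uIcc
  · simp only [zero_smul, add_zero, zero_mul, sub_zero, Real.norm_eq_abs] at this
    convert this using 2; ring
  · have hr' : |r| ≤ |s| := by
      have := abs_sub_left_of_mem_uIcc hr
      simpa using this
    refine (hd l _ _ ?_).le
    rw [dist_eq_norm, add_sub_cancel_left, norm_smul]
    have h1 : ‖(Pi.single l 1 : Fin n → ℝ)‖ = 1 := by rw [Pi.norm_single]; simp
    rw [h1, mul_one, Real.norm_eq_abs]
    linarith [ht l]

/-- uniform second order difference quotients. -/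
lemma ddq_unif {u : (Fin n → ℝ) → ℝ} (hu : ContDiff ℝ 2 u) {ε t₀ : ℝ}
    (h : ∀ x, ∀ l : Fin n, ∀ s : ℝ, |s| ≤ t₀ →
      |pd l u (x + s • Pi.single l 1) - pd l u x - s * pd l (pd l u) x| ≤ ε * |s|) (hε : 0 ≤ ε)
    (x) (l : Fin n) {t : ℝ} (ht : 0 < t) (htt : t ≤ t₀) : 
    |u (x + t • Pi.single l 1) - 2 * u x + u (x - t • Pi.single l 1) - t ^ 2 * pd l (pd l u) x| ≤ 2 * ε * t ^ 2 := by
  have hder : ∀ r : ℝ, HasDerivAt (fun r : ℝ => u (x + r • Pi.single l 1) + u (x + (-r) • Pi.single l 1)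
      - r ^ 2 * pd l (pd l u) x)
      (pd l u (x + r • Pi.single l 1) - pd l u (x + (-r) • Pi.single l 1) - 2 * r * pd l (pd l u) x) r := by
    intro r
    have h2 : HasDerivAt (fun r : ℝ => x + r • (Pi.single l 1 : Fin n → ℝ)) (Pi.single l 1) r := by
      simpa using ((hasDerivAt_id r).smul_const (Pi.single l (1:ℝ) : Fin n → ℝ)).const_add x
    have h2' : HasDerivAt (fun r : ℝ => x + (-r) • (Pi.single l 1 : Fin n → ℝ)) (-Pi.single l 1) r := by
      simpa using ((hasDerivAt_id r).neg.smul_const (Pi.single l (1:ℝ) : Fin n → ℝ)).const_add x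
    have h3 := ((hu.differentiable two_ne_zero) (x + r • Pi.single l 1)).hasFDerivAt.comp_hasDerivAt r h2
    have h3' := ((hu.differentiable two_ne_zero) (x + (-r) • Pi.single l 1)).hasFDerivAt.comp_hasDerivAt r h2'
    have h4 := (h3.add h3').sub ((hasDerivAt_pow 2 r).mul_const (pd l (pd l u) x))
    refine h4.congr_deriv ?_
    rw [map_neg]
    unfold pd
    simp
    ring
  have := (convex_Icc (0:ℝ) t).norm_image_sub_le_of_norm_hasDerivWithin_le (C := 2 * ε * t)
    (fun r _ => (hder r).hasDerivWithinAt) (fun r hr => ?_) (left_mem_Icc.2 ht.le) (right_mem_Icc.2 ht.le)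
  · simp only [zero_smul, add_zero, neg_zero, Real.norm_eq_abs, sub_zero, abs_of_pos ht] at this
    have e : x - t • (Pi.single l 1 : Fin n → ℝ) = x + (-t) • Pi.single l 1 := by rw [neg_smul, sub_eq_add_neg]
    rw [e]
    have e2 : 2 * ε * t ^ 2 = 2 * ε * t * t := by ring
    rw [e2]
    convert this using 2; ring
  · have hr' : |r| = r := abs_of_nonneg hr.1
    have a1 := h x l r (by rw [hr']; exact hr.2.trans htt)
    have a2 := h x l (-r) (by rw [abs_neg, hr']; exact hr.2.trans htt)
    rw [abs_neg] at a2
    rw [hr'] at a1 a2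
    have e : pd l u (x + r • Pi.single l 1) - pd l u (x + (-r) • Pi.single l 1) - 2 * r * pd l (pd l u) x
      = (pd l u (x + r • Pi.single l 1) - pd l u x - r * pd l (pd l u) x) -
        (pd l u (x + (-r) • Pi.single l 1) - pd l u x - (-r) * pd l (pd l u) x) := by ring
    rw [Real.norm_eq_abs, e]
    refine (abs_sub _ _).trans ?_
    have : ε * r ≤ ε * t := mul_le_mul_of_nonneg_left hr.2 hε
    linarith
end
end RH

namespace RH
section
variable {n : ℕ}

lemma norm_e (l : Fin n) (t : ℝ) : ‖t • (Pi.single l 1 : Fin n → ℝ)‖ = |t| := by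
  rw [norm_smul, Pi.norm_single]; simp

lemma clm_third (D : ((Fin n → ℝ) × ℝ × (Fin n → ℝ)) →L[ℝ] ℝ) (s : ℝ) (z : Fin n → ℝ) :
    D (0, s, z) = s * D (0, 1, 0) + ∑ m, D (0, 0, Pi.single m 1) * z m := by
  have e : ((0, s, z) : (Fin n → ℝ) × ℝ × (Fin n → ℝ)) = s • (0, 1, 0) + (0, 0, z) := by simp
  have e2 : ((0, 0, z) : (Fin n → ℝ) × ℝ × (Fin n → ℝ)) = ∑ m, z m • ((0, 0, Pi.single m 1) : (Fin n → ℝ) × ℝ × (Fin n → ℝ)) := by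
    refine Prod.ext ?_ (Prod.ext ?_ ?_)
    · simp [Prod.fst_sum]
    · simp [Prod.fst_sum, Prod.snd_sum]
    · simp only [Prod.snd_sum, Prod.smul_snd]
      ext i
      simp [Finset.sum_apply, Pi.single_apply]
  rw [e, map_add, map_smul, e2, map_sum, smul_eq_mul]
  simp only [map_smul, smul_eq_mul]
  congr 1
  exact Finset.sum_congr rfl fun m _ => mul_comm _ _

lemma f_second {f : ((Fin n → ℝ) × ℝ × (Fin n → ℝ)) → ℝ} {Q : Set ((Fin n → ℝ) × ℝ × (Fin n → ℝ))} {C : ℝ} (hC : 1 ≤ C)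
    (fD : ∀ y ∈ Q, ‖fderiv ℝ f y‖ ≤ C)
    (fT : ∀ y ∈ Q, ∀ z ∈ Q, |f z - f y - fderiv ℝ f y (z - y)| ≤ C * ‖z - y‖ ^ 2)
    {x x₁ x₂ e p p₁ p₂ : Fin n → ℝ} {a a₁ a₂ t c v : ℝ} (h0 : (x, a, p) ∈ Q) (h1 : (x₁, a₁, p₁) ∈ Q)
    (h2 : (x₂, a₂, p₂) ∈ Q) (ht : 0 < t) (hc : 1 ≤ c) (hv : 1 ≤ v) (e1 : x₁ = x + e) (e2 : x₂ = x - e) (he : ‖e‖ ≤ t)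
    (ha1 : |a₁ - a| ≤ c * t) (ha2 : |a₂ - a| ≤ c * t) (hp1 : ‖p₁ - p‖ ≤ c * v * t) (hp2 : ‖p₂ - p‖ ≤ c * v * t)
    (haa : |a₁ - 2 * a + a₂| ≤ c * v * t ^ 2) :
    (∑ m, fderiv ℝ f (x, a, p) (0, 0, Pi.single m 1) * (p₁ m - 2 * p m + p₂ m)) - 3 * C * c ^ 2 * (v ^ 2 * t ^ 2) ≤
      f (x₁, a₁, p₁) - 2 * f (x, a, p) + f (x₂, a₂, p₂) := by
  set D := fderiv ℝ f (x, a, p) with hD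
  have hcv : 1 ≤ c * v := one_le_mul_of_one_le_of_one_le hc hv
  have hct : c * t ≤ c * v * t := by
    have : c * t * 1 ≤ c * t * v := mul_le_mul_of_nonneg_left hv (by positivity)
    linarith
  have htt : t ≤ c * v * t := by
    have : 1 * t ≤ c * v * t := mul_le_mul_of_nonneg_right hcv ht.le
    linarith
  have n1 : ‖((x₁, a₁, p₁) : (Fin n → ℝ) × ℝ × (Fin n → ℝ)) - (x, a, p)‖ ≤ c * v * t := by
    rw [Prod.mk_sub_mk, Prod.mk_sub_mk, Prod.norm_mk, Prod.norm_mk]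
    refine max_le ?_ (max_le (ha1.trans hct) hp1)
    rw [e1, add_sub_cancel_left]; exact he.trans htt
  have n2 : ‖((x₂, a₂, p₂) : (Fin n → ℝ) × ℝ × (Fin n → ℝ)) - (x, a, p)‖ ≤ c * v * t := by
    rw [Prod.mk_sub_mk, Prod.mk_sub_mk, Prod.norm_mk, Prod.norm_mk]
    refine max_le ?_ (max_le (ha2.trans hct) hp2)
    rw [e2, sub_sub_cancel_left, norm_neg]; exact he.trans htt
  have t1 := (abs_le.1 ((fT _ h0 _ h1).trans (mul_le_mul_of_nonneg_left (pow_le_pow_left₀ (norm_nonneg _) n1 2) (by linarith)))).1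
  have t2 := (abs_le.1 ((fT _ h0 _ h2).trans (mul_le_mul_of_nonneg_left (pow_le_pow_left₀ (norm_nonneg _) n2 2) (by linarith)))).1
  have es : D (((x₁, a₁, p₁) : (Fin n → ℝ) × ℝ × (Fin n → ℝ)) - (x, a, p)) + D ((x₂, a₂, p₂) - (x, a, p)) =
      D (0, a₁ - 2 * a + a₂, fun m => p₁ m - 2 * p m + p₂ m) := by
    rw [← map_add]
    congr 1
    refine Prod.ext ?_ (Prod.ext ?_ ?_)
    · simp [e1, e2]
    · simp; ring
    · ext m; simp; ring
  rw [clm_third] at es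
  have hD1 : |D (0, 1, 0)| ≤ C := by
    have := D.le_opNorm (0, 1, 0)
    have e : ‖((0, 1, 0) : (Fin n → ℝ) × ℝ × (Fin n → ℝ))‖ = 1 := by simp [Prod.norm_mk]
    rw [e, mul_one] at this
    exact this.trans (fD _ h0)
  have h3 : -(c * v * t ^ 2 * C) ≤ (a₁ - 2 * a + a₂) * D (0, 1, 0) := by
    refine (abs_le.1 ?_).1
    rw [abs_mul]
    exact mul_le_mul haa hD1 (abs_nonneg _) (by positivity)
  have h4 : c * v * t ^ 2 * C ≤ C * c ^ 2 * (v ^ 2 * t ^ 2) := by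
    have : (c * v) * (t ^ 2 * C) ≤ (c * v * (c * v)) * (t ^ 2 * C) :=
      mul_le_mul_of_nonneg_right (le_mul_of_one_le_left (by positivity) hcv) (by positivity)
    linarith [show (c * v * (c * v)) * (t ^ 2 * C) = C * c ^ 2 * (v ^ 2 * t ^ 2) by ring,
      show (c * v) * (t ^ 2 * C) = c * v * t ^ 2 * C by ring]
  have h5 : C * (c * v * t) ^ 2 = C * c ^ 2 * (v ^ 2 * t ^ 2) := by ring
  rw [h5] at t1 t2
  linarith

lemma clm_second (D : ((Fin n → ℝ) × ℝ) →L[ℝ] ℝ) (s : ℝ) : D (0, s) = s * D (0, 1) := by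
  have e : ((0, s) : (Fin n → ℝ) × ℝ) = s • (0, 1) := by simp
  rw [e, map_smul, smul_eq_mul]

lemma h_second {H : ((Fin n → ℝ) × ℝ) → ℝ} {Q : Set ((Fin n → ℝ) × ℝ)} {C : ℝ} (hC : 1 ≤ C)
    (HD : ∀ y ∈ Q, ‖fderiv ℝ H y‖ ≤ C) (HL : ∀ y ∈ Q, ∀ z ∈ Q, |H y - H z| ≤ C * ‖y - z‖)
    (HT : ∀ y ∈ Q, ∀ z ∈ Q, |H z - H y - fderiv ℝ H y (z - y)| ≤ C * ‖z - y‖ ^ 2)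
    (H0 : ∀ y ∈ Q, 0 ≤ H y)
    {x x₁ x₂ e p p₁ p₂ : Fin n → ℝ} {a a₁ a₂ t c v : ℝ} (h0 : (x, a) ∈ Q) (h1 : (x₁, a₁) ∈ Q)
    (h2 : (x₂, a₂) ∈ Q) (ht : 0 < t) (hc : 1 ≤ c) (hv : 1 ≤ v) (e1 : x₁ = x + e) (e2 : x₂ = x - e) (he : ‖e‖ ≤ t)
    (ha1 : |a₁ - a| ≤ c * t) (ha2 : |a₂ - a| ≤ c * t) (hp1 : ‖p₁ - p‖ ≤ c * v * t) (hp2 : ‖p₂ - p‖ ≤ c * v * t)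
    (haa : |a₁ - 2 * a + a₂| ≤ c * v * t ^ 2) (hp : ∀ m, |p m| ≤ C) :
    2 * H (x, a) * (∑ m, p m * (p₁ m - 2 * p m + p₂ m)) - 7 * n * C ^ 3 * c ^ 2 * (v * t ^ 2) ≤
      H (x₁, a₁) * normSq p₁ - 2 * (H (x, a) * normSq p) + H (x₂, a₂) * normSq p₂ := by
  set D := fderiv ℝ H (x, a) with hD
  have hct : t ≤ c * t := le_mul_of_one_le_left ht.le hc
  have n1 : ‖((x₁, a₁) : (Fin n → ℝ) × ℝ) - (x, a)‖ ≤ c * t := by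
    rw [Prod.mk_sub_mk, Prod.norm_mk]
    refine max_le ?_ ha1
    rw [e1, add_sub_cancel_left]; exact he.trans hct
  have n2 : ‖((x₂, a₂) : (Fin n → ℝ) × ℝ) - (x, a)‖ ≤ c * t := by
    rw [Prod.mk_sub_mk, Prod.norm_mk]
    refine max_le ?_ ha2
    rw [e2, sub_sub_cancel_left, norm_neg]; exact he.trans hct
  have t1 := (abs_le.1 ((HT _ h0 _ h1).trans (mul_le_mul_of_nonneg_left (pow_le_pow_left₀ (norm_nonneg _) n1 2) (by linarith)))).1
  have t2 := (abs_le.1 ((HT _ h0 _ h2).trans (mul_le_mul_of_nonneg_left (pow_le_pow_left₀ (norm_nonneg _) n2 2) (by linarith)))).1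
  have l1 := (HL _ h1 _ h0).trans (mul_le_mul_of_nonneg_left n1 (by linarith))
  have l2 := (HL _ h2 _ h0).trans (mul_le_mul_of_nonneg_left n2 (by linarith))
  have es : D (((x₁, a₁) : (Fin n → ℝ) × ℝ) - (x, a)) + D ((x₂, a₂) - (x, a)) = (a₁ - 2 * a + a₂) * D (0, 1) := by
    rw [← map_add, ← clm_second]
    congr 1
    refine Prod.ext ?_ ?_
    · simp [e1, e2]
    · simp; ring
  have hD1 : |D (0, 1)| ≤ C := by
    have := D.le_opNorm (0, 1)
    have e : ‖((0, 1) : (Fin n → ℝ) × ℝ)‖ = 1 := by simp [Prod.norm_mk]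
    rw [e, mul_one] at this
    exact this.trans (HD _ h0)
  have h3 : -(c * v * t ^ 2 * C) ≤ (a₁ - 2 * a + a₂) * D (0, 1) := by
    refine (abs_le.1 ?_).1
    rw [abs_mul]
    exact mul_le_mul haa hD1 (abs_nonneg _) (by positivity)
  set W : ℝ := c ^ 2 * (v * t ^ 2) with hW
  have hW0 : 0 ≤ W := by positivity
  have g1 : c * v * t ^ 2 ≤ W := by
    have : c * (v * t ^ 2) ≤ (c * c) * (v * t ^ 2) :=
      mul_le_mul_of_nonneg_right (le_mul_of_one_le_left (by positivity) hc) (by positivity)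
    rw [hW]; linarith [show (c * c) * (v * t ^ 2) = c ^ 2 * (v * t ^ 2) by ring]
  have g2 : (c * t) ^ 2 ≤ W := by
    have : c ^ 2 * t ^ 2 * 1 ≤ c ^ 2 * t ^ 2 * v := mul_le_mul_of_nonneg_left hv (by positivity)
    rw [hW]; linarith [show (c * t) ^ 2 = c ^ 2 * t ^ 2 * 1 by ring, show c ^ 2 * t ^ 2 * v = c ^ 2 * (v * t ^ 2) by ring]
  have g3 : C * (c * t) ^ 2 ≤ C * W := mul_le_mul_of_nonneg_left g2 (by linarith)
  have g4 : c * v * t ^ 2 * C ≤ W * C := mul_le_mul_of_nonneg_right g1 (by linarith)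
  -- second difference of H
  have d2 : -(3 * C * W) ≤ H (x₁, a₁) - 2 * H (x, a) + H (x₂, a₂) := by linarith
  have N0 : 0 ≤ normSq p := Finset.sum_nonneg fun _ _ => sq_nonneg _
  have N1 : normSq p ≤ n * C ^ 2 := by
    unfold normSq
    calc ∑ i, p i ^ 2 ≤ ∑ _i : Fin n, C ^ 2 := Finset.sum_le_sum fun i _ => sq_le_sq' (abs_le.1 (hp i)).1 (abs_le.1 (hp i)).2
      _ = n * C ^ 2 := by simp
  have d3 : -(3 * C * W * (n * C ^ 2)) ≤ (H (x₁, a₁) - 2 * H (x, a) + H (x₂, a₂)) * normSq p := by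
    have : -(3 * C * W) * normSq p ≤ (H (x₁, a₁) - 2 * H (x, a) + H (x₂, a₂)) * normSq p :=
      mul_le_mul_of_nonneg_right d2 N0
    have : 3 * C * W * normSq p ≤ 3 * C * W * (n * C ^ 2) := mul_le_mul_of_nonneg_left N1 (by positivity)
    linarith
  have key : ∀ p' : Fin n → ℝ, normSq p + 2 * ∑ m, p m * (p' m - p m) ≤ normSq p' := by
    intro p'
    unfold normSq
    rw [Finset.mul_sum, ← Finset.sum_add_distrib]
    exact Finset.sum_le_sum fun i _ => by nlinarith [sq_nonneg (p' i - p i)]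
  have bnd : ∀ p' : Fin n → ℝ, ‖p' - p‖ ≤ c * v * t → |∑ m, p m * (p' m - p m)| ≤ n * (C * (c * v * t)) := by
    intro p' h'
    calc |∑ m, p m * (p' m - p m)| ≤ ∑ m, |p m * (p' m - p m)| := Finset.abs_sum_le_sum_abs _ _
      _ ≤ ∑ _m : Fin n, C * (c * v * t) := Finset.sum_le_sum fun m _ => by
          rw [abs_mul]
          exact mul_le_mul (hp m) ((norm_le_pi_norm (p' - p) m).trans h') (abs_nonneg _) (by linarith)
      _ = n * (C * (c * v * t)) := by simp
  have q1 : -(C * (c * t) * (n * (C * (c * v * t)))) ≤ (H (x₁, a₁) - H (x, a)) * ∑ m, p m * (p₁ m - p m) := by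
    refine (abs_le.1 ?_).1
    rw [abs_mul]
    exact mul_le_mul l1 (bnd _ hp1) (abs_nonneg _) (by positivity)
  have q2 : -(C * (c * t) * (n * (C * (c * v * t)))) ≤ (H (x₂, a₂) - H (x, a)) * ∑ m, p m * (p₂ m - p m) := by
    refine (abs_le.1 ?_).1
    rw [abs_mul]
    exact mul_le_mul l2 (bnd _ hp2) (abs_nonneg _) (by positivity)
  have k1 := mul_le_mul_of_nonneg_left (key p₁) (H0 _ h1)
  have k2 := mul_le_mul_of_nonneg_left (key p₂) (H0 _ h2)
  have ss : ∑ m, p m * (p₁ m - 2 * p m + p₂ m) = (∑ m, p m * (p₁ m - p m)) + ∑ m, p m * (p₂ m - p m) := by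
    rw [← Finset.sum_add_distrib]
    exact Finset.sum_congr rfl fun m _ => by ring
  rw [ss]
  set S1 := ∑ m, p m * (p₁ m - p m)
  set S2 := ∑ m, p m * (p₂ m - p m)
  have ew : C * (c * t) * (n * (C * (c * v * t))) = n * C ^ 2 * W := by rw [hW]; ring
  rw [ew] at q1 q2
  have fin1 : n * C ^ 2 * W ≤ n * C ^ 3 * W := by
    have : C ^ 2 ≤ C ^ 3 := pow_le_pow_right₀ hC (by norm_num)
    have : (n : ℝ) * C ^ 2 ≤ n * C ^ 3 := mul_le_mul_of_nonneg_left this (by positivity)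
    exact mul_le_mul_of_nonneg_right this hW0
  have e7 : 7 * (n:ℝ) * C ^ 3 * c ^ 2 * (v * t ^ 2) = 7 * (n * C ^ 3 * W) := by rw [hW]; ring
  rw [e7]
  have e8 : 3 * C * W * (n * C ^ 2) = 3 * (n * C ^ 3 * W) := by ring
  rw [e8] at d3
  linarith
end
end RH

namespace RH
section
variable {n : ℕ}

/-- data on the coefficient functions -/
structure Dat (κ : ℕ) (f : ((Fin n → ℝ) × ℝ × (Fin n → ℝ)) → ℝ) (H : ((Fin n → ℝ) × ℝ) → ℝ)
    (Q : Set ((Fin n → ℝ) × ℝ × (Fin n → ℝ))) (QH : Set ((Fin n → ℝ) × ℝ)) (C : ℝ) : Prop where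
  C1 : 1 ≤ C
  f0 : ∀ y ∈ Q, 0 < f y
  fc : ∀ y ∈ Q, 1 ≤ C * f y ^ (κ + 2)
  fB : ∀ y ∈ Q, |f y| ≤ C
  fD : ∀ y ∈ Q, ‖fderiv ℝ f y‖ ≤ C
  fT : ∀ y ∈ Q, ∀ z ∈ Q, |f z - f y - fderiv ℝ f y (z - y)| ≤ C * ‖z - y‖ ^ 2
  H0 : ∀ y ∈ QH, 0 ≤ H y
  Hd : ∀ y ∈ QH, DifferentiableAt ℝ H y
  HB : ∀ y ∈ QH, |H y| ≤ C
  HD : ∀ y ∈ QH, ‖fderiv ℝ H y‖ ≤ C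
  HL : ∀ y ∈ QH, ∀ z ∈ QH, |H y - H z| ≤ C * ‖y - z‖
  HT : ∀ y ∈ QH, ∀ z ∈ QH, |H z - H y - fderiv ℝ H y (z - y)| ≤ C * ‖z - y‖ ^ 2

/-- localized solution -/
structure Sol (κ : ℕ) (f : ((Fin n → ℝ) × ℝ × (Fin n → ℝ)) → ℝ) (H : ((Fin n → ℝ) × ℝ) → ℝ)
    (Q : Set ((Fin n → ℝ) × ℝ × (Fin n → ℝ))) (QH : Set ((Fin n → ℝ) × ℝ)) (C C₁ : ℝ)
    (U : Set (Fin n → ℝ)) (u h : (Fin n → ℝ) → ℝ) : Prop where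
  hu : ContDiff ℝ 2 u
  huc : HasCompactSupport u
  hh : ContDiff ℝ 1 h
  hU : IsOpen U
  mQ : ∀ x ∈ U, (x, u x, grad u x) ∈ Q
  mQH : ∀ x ∈ U, (x, u x) ∈ QH
  pb : ∀ x ∈ U, ∀ a, |pd a u x| ≤ C
  sg : ∀ x ∈ U, esymmMat (κ + 2) (AH u h x) = f (x, u x, grad u x) ^ (κ + 2)
  gm : ∀ x ∈ U, GammaPlus (κ + 2) (AH u h x)
  v1 : ∀ x ∈ U, 1 ≤ lapl u x + C₁
  hb : ∀ x ∈ U, ∀ a b, |pd a (pd b u) x| ≤ lapl u x + C₁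
  eh : ∀ x ∈ U, h x = H (x, u x) * normSq (grad u x)

variable {κ : ℕ} {f : ((Fin n → ℝ) × ℝ × (Fin n → ℝ)) → ℝ} {H : ((Fin n → ℝ) × ℝ) → ℝ}
    {Q : Set ((Fin n → ℝ) × ℝ × (Fin n → ℝ))} {QH : Set ((Fin n → ℝ) × ℝ)} {C C₁ : ℝ}
    {U : Set (Fin n → ℝ)} {u h : (Fin n → ℝ) → ℝ}

lemma Sol.garding (hκ : κ + 2 ≤ n) (D : Dat κ f H Q QH C) (S : Sol κ f H Q QH C C₁ U u h) {x y₁ y₂ : Fin n → ℝ} (hx : x ∈ U)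
    (h1 : y₁ ∈ U) (h2 : y₂ ∈ U) :
    ((κ : ℝ) + 2) * f (x, u x, grad u x) ^ (κ + 1) *
        (f (y₁, u y₁, grad u y₁) - 2 * f (x, u x, grad u x) + f (y₂, u y₂, grad u y₂))
      + ((n : ℝ) - ((κ + 1 : ℕ) : ℝ)) * esymmMat (κ + 1) (AH u h x) * (h y₁ - 2 * h x + h y₂) ≤
    ∑ b, ∑ a, newtonT (κ + 1) (AH u h x) a b * (pd a (pd b u) y₁ - 2 * pd a (pd b u) x + pd a (pd b u) y₂) := by
  set T := newtonT (κ + 1) (AH u h x) with hT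
  set F := f (x, u x, grad u x) with hF
  have key : ∀ y ∈ U, ((κ : ℝ) + 2) * F ^ (κ + 1) * f (y, u y, grad u y) ≤ (T * AH u h y).trace := by
    intro y hy
    have := garding_mat (AH_symm (h := h) S.hu x) (AH_symm (h := h) S.hu y) (k := κ + 1) hκ (S.gm x hx) (S.gm y hy)
      (D.f0 _ (S.mQ x hx)) (D.f0 _ (S.mQ y hy)) (S.sg x hx) (S.sg y hy)
    push_cast at this
    rw [show (κ : ℝ) + 2 = κ + 1 + 1 by ring]
    exact this
  have k0 : (T * AH u h x).trace = ((κ : ℝ) + 2) * F ^ (κ + 1) * F := by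
    rw [hT, trace_newtonT_mul _ (by omega), S.sg x hx]
    push_cast; ring
  have htr : T.trace = ((n : ℝ) - ((κ + 1 : ℕ) : ℝ)) * esymmMat (κ + 1) (AH u h x) := trace_newtonT _ (by omega)
  have ex : ∀ y, (T * AH u h y).trace = (∑ b, ∑ a, T a b * pd a (pd b u) y) - h y * T.trace := by
    intro y
    have : T * AH u h y = T * hess u y - h y • T := by
      rw [AH, mul_sub, mul_smul_comm, mul_one]
    rw [this, trace_sub, trace_smul, smul_eq_mul]
    congr 1
    rw [Finset.sum_comm]
    simp only [Matrix.trace, Matrix.diag, Matrix.mul_apply, hess, Matrix.of_apply]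
    refine Finset.sum_congr rfl fun a _ => Finset.sum_congr rfl fun b _ => ?_
    rw [pd_comm S.hu]
  have g1 := key y₁ h1
  have g2 := key y₂ h2
  rw [ex, htr] at g1 g2 k0
  have es : ∑ b, ∑ a, T a b * (pd a (pd b u) y₁ - 2 * pd a (pd b u) x + pd a (pd b u) y₂) =
     (∑ b, ∑ a, T a b * pd a (pd b u) y₁) - 2 * (∑ b, ∑ a, T a b * pd a (pd b u) x) + ∑ b, ∑ a, T a b * pd a (pd b u) y₂ := by
    simp only [Finset.mul_sum, ← Finset.sum_sub_distrib, ← Finset.sum_add_distrib]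
    exact Finset.sum_congr rfl fun b _ => Finset.sum_congr rfl fun a _ => by ring
  rw [es]
  linarith

lemma pd_ddq {u : (Fin n → ℝ) → ℝ} (hu : Differentiable ℝ u) (a l : Fin n) (t : ℝ) :
    pd a (ddq l t u) = ddq l t (pd a u) := by
  ext x
  have e : ddq l t u = fun x => (t ^ 2)⁻¹ • (u (x + t • Pi.single l 1) - 2 * u x + u (x - t • Pi.single l 1)) := by
    ext x; simp only [ddq, smul_eq_mul]; rw [div_eq_inv_mul]
  have d1 : DifferentiableAt ℝ (fun x => u (x + t • Pi.single l 1)) x := by fun_prop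
  have d2 : DifferentiableAt ℝ (fun x => u (x - t • Pi.single l 1)) x := by fun_prop
  have d3 : DifferentiableAt ℝ (fun x => 2 * u x) x := by fun_prop
  have d4 : fderiv ℝ (fun x => u (x - t • Pi.single l 1)) x = fderiv ℝ u (x - t • Pi.single l 1) := by
    simp only [sub_eq_add_neg]
    rw [fderiv_comp_add_right]
  unfold pd
  rw [e, fderiv_fun_const_smul ((d1.fun_sub d3).fun_add d2), fderiv_fun_add (d1.fun_sub d3) d2, fderiv_fun_sub d1 d3, fderiv_comp_add_right,
    d4, fderiv_const_mul (hu x)]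
  simp only [ddq, FunLike.coe_smul, FunLike.coe_add, FunLike.coe_sub, Pi.smul_apply, Pi.add_apply, Pi.sub_apply, smul_eq_mul]
  rw [div_eq_inv_mul]

lemma ddq_contDiff {u : (Fin n → ℝ) → ℝ} {m : ℕ} (hu : ContDiff ℝ m u) (l : Fin n) (t : ℝ) :
    ContDiff ℝ m (ddq l t u) := by
  unfold ddq
  fun_prop

/-- difference quotient laplacian -/
noncomputable def wf (t C₁ : ℝ) (u : (Fin n → ℝ) → ℝ) (x : Fin n → ℝ) : ℝ := (∑ l, ddq l t u x) + C₁

lemma wf_contDiff {u : (Fin n → ℝ) → ℝ} (hu : ContDiff ℝ 2 u) (t C₁ : ℝ) : ContDiff ℝ 2 (wf t C₁ u) := by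
  unfold wf
  exact (ContDiff.sum fun l _ => ddq_contDiff (m := 2) hu l t).add contDiff_const

lemma pd_wf {u : (Fin n → ℝ) → ℝ} (hu : ContDiff ℝ 1 u) (t C₁ : ℝ) (a : Fin n) : pd a (wf t C₁ u) = wf t 0 (pd a u) := by
  ext x
  unfold wf
  have hd : ∀ l ∈ (Finset.univ : Finset (Fin n)), DifferentiableAt ℝ (ddq l t u) x := fun l _ =>
    ((ddq_contDiff (m := 1) hu l t).differentiable one_ne_zero) x
  rw [pd_add (DifferentiableAt.fun_sum hd) (differentiableAt_const _), pd_sum hd, pd_const]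
  simp only [pd_ddq (hu.differentiable one_ne_zero)]
end
end RH

namespace RH
section
variable {n : ℕ}

lemma AH_bound {κ : ℕ} {f : ((Fin n → ℝ) × ℝ × (Fin n → ℝ)) → ℝ} {H : ((Fin n → ℝ) × ℝ) → ℝ}
    {Q : Set ((Fin n → ℝ) × ℝ × (Fin n → ℝ))} {QH : Set ((Fin n → ℝ) × ℝ)} {C C₁ : ℝ}
    {U : Set (Fin n → ℝ)} {u h : (Fin n → ℝ) → ℝ} (D : Dat κ f H Q QH C) (S : Sol κ f H Q QH C C₁ U u h) {x} (hx : x ∈ U) :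
    |h x| ≤ n * C ^ 3 ∧ ∀ a b, |AH u h x a b| ≤ (1 + n * C ^ 3) * (lapl u x + C₁) := by
  have hC := D.C1
  have N0 : 0 ≤ normSq (grad u x) := Finset.sum_nonneg fun _ _ => sq_nonneg _
  have N1 : normSq (grad u x) ≤ n * C ^ 2 := by
    unfold normSq
    calc ∑ i, grad u x i ^ 2 ≤ ∑ _i : Fin n, C ^ 2 := Finset.sum_le_sum fun i _ =>
          sq_le_sq' (abs_le.1 (S.pb x hx i)).1 (abs_le.1 (S.pb x hx i)).2
      _ = n * C ^ 2 := by simp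
  have h1 : |h x| ≤ n * C ^ 3 := by
    rw [S.eh x hx, abs_mul, abs_of_nonneg N0]
    calc _ ≤ C * (n * C ^ 2) := mul_le_mul (D.HB _ (S.mQH x hx)) N1 N0 (by linarith)
      _ = n * C ^ 3 := by ring
  refine ⟨h1, fun a b => ?_⟩
  rw [AH_apply]
  have v1 := S.v1 x hx
  have h2 : |h x * (1 : Matrix (Fin n) (Fin n) ℝ) a b| ≤ n * C ^ 3 := by
    rw [abs_mul]
    have : |(1 : Matrix (Fin n) (Fin n) ℝ) a b| ≤ 1 := by rw [Matrix.one_apply]; split_ifs <;> simp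
    exact (mul_le_of_le_one_right (abs_nonneg _) this).trans h1
  refine (abs_sub _ _).trans ?_
  have h3 := S.hb x hx a b
  have h4 : n * C ^ 3 * 1 ≤ n * C ^ 3 * (lapl u x + C₁) := mul_le_mul_of_nonneg_left v1 (by positivity)
  linarith

lemma main_ineq (κ : ℕ) (hκ : κ + 2 ≤ n) (C c : ℝ) (hC : 1 ≤ C) (hc : 1 ≤ c) : ∃ C' : ℝ, 1 ≤ C' ∧
    ∀ (f : ((Fin n → ℝ) × ℝ × (Fin n → ℝ)) → ℝ) (H : ((Fin n → ℝ) × ℝ) → ℝ)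
    (Q : Set ((Fin n → ℝ) × ℝ × (Fin n → ℝ))) (QH : Set ((Fin n → ℝ) × ℝ)) (C₁ : ℝ)
    (U : Set (Fin n → ℝ)) (u h : (Fin n → ℝ) → ℝ), Dat κ f H Q QH C → Sol κ f H Q QH C C₁ U u h →
    ∀ (x : Fin n → ℝ) (t : ℝ), x ∈ U → 0 < t → 
    (∀ l : Fin n, x + t • Pi.single l 1 ∈ U ∧ x - t • Pi.single l 1 ∈ U) →
    (∀ l : Fin n, |u (x + t • Pi.single l 1) - u x| ≤ c * t ∧ |u (x - t • Pi.single l 1) - u x| ≤ c * t) →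
    (∀ l m : Fin n, |pd m u (x + t • Pi.single l 1) - pd m u x| ≤ c * (lapl u x + C₁) * t ∧
      |pd m u (x - t • Pi.single l 1) - pd m u x| ≤ c * (lapl u x + C₁) * t) →
    (∀ l : Fin n, |u (x + t • Pi.single l 1) - 2 * u x + u (x - t • Pi.single l 1)| ≤ c * (lapl u x + C₁) * t ^ 2) →
    2 * ((n : ℝ) - ((κ + 1 : ℕ) : ℝ)) * H (x, u x) * esymmMat (κ + 1) (AH u h x) * (∑ m, pd m u x * pd m (wf t C₁ u) x)
        + (∑ m, (((κ : ℝ) + 2) * f (x, u x, grad u x) ^ (κ + 1) * fderiv ℝ f (x, u x, grad u x) (0, 0, Pi.single m 1)) *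
          pd m (wf t C₁ u) x) - C' * ((lapl u x + C₁) ^ (κ + 1) * (lapl u x + C₁)) ≤
        ∑ b, ∑ a, newtonT (κ + 1) (AH u h x) a b * pd a (pd b (wf t C₁ u)) x := by
  obtain ⟨C2, hC2, hC2b⟩ := bound_newtonT (n := n) (κ + 1) (by omega)
  set B : ℝ := 1 + n * C ^ 3 with hB
  set E1 : ℝ := ((κ : ℝ) + 2) * C ^ (κ + 1) * (3 * C * c ^ 2) with hE1
  set E2 : ℝ := (n : ℝ) * (C2 * B ^ (κ + 1)) * (7 * n * C ^ 3 * c ^ 2) with hE2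
  have hE10 : 0 ≤ E1 := by positivity
  have hE20 : 0 ≤ E2 := by positivity
  refine ⟨1 + n * (E1 + E2), by have : 0 ≤ n * (E1 + E2) := by positivity
                                linarith, ?_⟩
  intro f H Q QH C₁ U u h D S x t hx ht hU d0 d1 d2
  set v := lapl u x + C₁ with hv
  have v1 : 1 ≤ v := S.v1 x hx
  set F := f (x, u x, grad u x) with hF
  set G := H (x, u x) with hG
  set σ := esymmMat (κ + 1) (AH u h x) with hσ
  set T := newtonT (κ + 1) (AH u h x) with hT
  have hσ0 : 0 < σ := S.gm x hx (κ + 1) (by omega) (by omega)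
  have hσb : σ ≤ C2 * B ^ (κ + 1) * v ^ (κ + 1) := by
    have := (hC2b (AH u h x) (B * v) (by positivity) (AH_bound D S hx).2).2
    rw [mul_pow, ← mul_assoc] at this
    exact (le_abs_self _).trans this
  have hF0 : 0 < F := D.f0 _ (S.mQ x hx)
  have hFC : F ≤ C := (le_abs_self _).trans (D.fB _ (S.mQ x hx))
  have hnk : 0 ≤ (n : ℝ) - ((κ + 1 : ℕ) : ℝ) := by
    rw [sub_nonneg]; exact_mod_cast (by omega : κ + 1 ≤ n)
  have hnk' : (n : ℝ) - ((κ + 1 : ℕ) : ℝ) ≤ n := by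
    have : (0:ℝ) ≤ ((κ + 1 : ℕ) : ℝ) := by positivity
    linarith
  set Dm : Fin n → ℝ := fun m => fderiv ℝ f (x, u x, grad u x) (0, 0, Pi.single m 1) with hDm
  -- per direction
  have per : ∀ l : Fin n, 2 * ((n : ℝ) - ((κ + 1 : ℕ) : ℝ)) * G * σ * (∑ m, pd m u x * ddq l t (pd m u) x)
      + ((κ : ℝ) + 2) * F ^ (κ + 1) * (∑ m, Dm m * ddq l t (pd m u) x) - (E1 + E2) * (v ^ (κ + 1) * v) ≤
      ∑ b, ∑ a, T a b * ddq l t (pd a (pd b u)) x := by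
    intro l
    have hn1 : ∀ y : Fin n → ℝ, (∀ m, |pd m u y - pd m u x| ≤ c * v * t) → ‖grad u y - grad u x‖ ≤ c * v * t := fun y hy =>
      (pi_norm_le_iff_of_nonneg (by positivity)).2 fun m => hy m
    have en : ‖t • (Pi.single l 1 : Fin n → ℝ)‖ ≤ t := by rw [norm_e, abs_of_pos ht]
    have ff := f_second hC D.fD D.fT (S.mQ x hx) (S.mQ _ (hU l).1) (S.mQ _ (hU l).2) ht hc v1 rfl rfl en
      (d0 l).1 (d0 l).2 (hn1 _ fun m => (d1 l m).1) (hn1 _ fun m => (d1 l m).2) (d2 l)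
    have hh := h_second hC D.HD D.HL D.HT D.H0 (S.mQH x hx) (S.mQH _ (hU l).1) (S.mQH _ (hU l).2) ht hc v1 rfl rfl en
      (d0 l).1 (d0 l).2 (hn1 _ fun m => (d1 l m).1) (hn1 _ fun m => (d1 l m).2) (d2 l) (S.pb x hx)
    rw [← S.eh _ hx, ← S.eh _ (hU l).1, ← S.eh _ (hU l).2] at hh
    have gg := S.garding hκ D hx (hU l).1 (hU l).2
    have hKF : 0 ≤ ((κ : ℝ) + 2) * F ^ (κ + 1) := by positivity
    have ff' := mul_le_mul_of_nonneg_left ff hKF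
    have hh' := mul_le_mul_of_nonneg_left hh (mul_nonneg hnk hσ0.le)
    have st := (add_le_add ff' hh').trans gg
    have ez : ∀ φ : (Fin n → ℝ) → ℝ, φ (x + t • Pi.single l 1) - 2 * φ x + φ (x - t • Pi.single l 1) = t ^ 2 * ddq l t φ x := by
      intro φ; simp only [ddq]; field_simp
    have s1 : ∑ m, fderiv ℝ f (x, u x, grad u x) (0, 0, Pi.single m 1) *
        (grad u (x + t • Pi.single l 1) m - 2 * grad u x m + grad u (x - t • Pi.single l 1) m) =
        t ^ 2 * ∑ m, Dm m * ddq l t (pd m u) x := by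
      rw [Finset.mul_sum]
      refine Finset.sum_congr rfl fun m _ => ?_
      simp only [grad]
      rw [ez]; ring
    have s2 : ∑ m, grad u x m * (grad u (x + t • Pi.single l 1) m - 2 * grad u x m + grad u (x - t • Pi.single l 1) m) =
        t ^ 2 * ∑ m, pd m u x * ddq l t (pd m u) x := by
      rw [Finset.mul_sum]
      refine Finset.sum_congr rfl fun m _ => ?_
      simp only [grad]
      rw [ez]; ring
    have s3 : ∑ b, ∑ a, T a b * (pd a (pd b u) (x + t • Pi.single l 1) - 2 * pd a (pd b u) x + pd a (pd b u) (x - t • Pi.single l 1)) =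
        t ^ 2 * ∑ b, ∑ a, T a b * ddq l t (pd a (pd b u)) x := by
      simp only [Finset.mul_sum]
      refine Finset.sum_congr rfl fun b _ => Finset.sum_congr rfl fun a _ => ?_
      rw [ez]; ring
    rw [s1, s2, s3] at st
    have ht2 : 0 < t ^ 2 := by positivity
    refine le_of_mul_le_mul_left ?_ ht2
    refine le_trans ?_ st
    have b1 : ((κ : ℝ) + 2) * F ^ (κ + 1) * (3 * C * c ^ 2 * (v ^ 2 * t ^ 2)) ≤ E1 * (v ^ (κ + 1) * v) * t ^ 2 := by
      have p1 : F ^ (κ + 1) ≤ C ^ (κ + 1) := pow_le_pow_left₀ hF0.le hFC _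
      have p2 : v ^ 2 ≤ v ^ (κ + 1) * v := by
        rw [← pow_succ]; exact pow_le_pow_right₀ v1 (by omega)
      have p3 : ((κ : ℝ) + 2) * F ^ (κ + 1) ≤ ((κ : ℝ) + 2) * C ^ (κ + 1) := mul_le_mul_of_nonneg_left p1 (by positivity)
      calc _ ≤ ((κ : ℝ) + 2) * C ^ (κ + 1) * (3 * C * c ^ 2 * ((v ^ (κ + 1) * v) * t ^ 2)) := by
            refine mul_le_mul p3 ?_ (by positivity) (by positivity)
            exact mul_le_mul_of_nonneg_left (mul_le_mul_of_nonneg_right p2 ht2.le) (by positivity)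
        _ = _ := by rw [hE1]; ring
    have b2 : ((n : ℝ) - ((κ + 1 : ℕ) : ℝ)) * σ * (7 * n * C ^ 3 * c ^ 2 * (v * t ^ 2)) ≤ E2 * (v ^ (κ + 1) * v) * t ^ 2 := by
      have p1 : ((n : ℝ) - ((κ + 1 : ℕ) : ℝ)) * σ ≤ n * (C2 * B ^ (κ + 1) * v ^ (κ + 1)) :=
        mul_le_mul hnk' hσb hσ0.le (by positivity)
      calc _ ≤ n * (C2 * B ^ (κ + 1) * v ^ (κ + 1)) * (7 * n * C ^ 3 * c ^ 2 * (v * t ^ 2)) :=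
            mul_le_mul_of_nonneg_right p1 (by positivity)
        _ = _ := by rw [hE2]; ring
    linarith
  have hs := Finset.sum_le_sum fun l (_ : l ∈ Finset.univ) => per l
  have w1 : ∀ m, pd m (wf t C₁ u) x = ∑ l, ddq l t (pd m u) x := fun m => by
    rw [pd_wf (S.hu.of_le (by norm_num))]; simp [wf]
  have w2 : ∀ a b, pd a (pd b (wf t C₁ u)) x = ∑ l, ddq l t (pd a (pd b u)) x := fun a b => by
    rw [pd_wf (S.hu.of_le (by norm_num)), pd_wf (pd_contDiff (m := 1) S.hu b)]; simp [wf]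
  simp only [Finset.sum_sub_distrib, Finset.sum_add_distrib, Finset.sum_const, Finset.card_univ, Fintype.card_fin, nsmul_eq_mul, ← Finset.mul_sum] at hs
  have r1 : ∑ l, ∑ m, pd m u x * ddq l t (pd m u) x = ∑ m, pd m u x * pd m (wf t C₁ u) x := by
    rw [Finset.sum_comm]
    exact Finset.sum_congr rfl fun m _ => by rw [w1, Finset.mul_sum]
  have r2 : ((κ : ℝ) + 2) * F ^ (κ + 1) * ∑ l, ∑ m, Dm m * ddq l t (pd m u) x =
      ∑ m, (((κ : ℝ) + 2) * F ^ (κ + 1) * Dm m) * pd m (wf t C₁ u) x := by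
    rw [Finset.sum_comm, Finset.mul_sum]
    exact Finset.sum_congr rfl fun m _ => by rw [w1, ← Finset.mul_sum]; ring
  have r3 : ∑ l, ∑ b, ∑ a, T a b * ddq l t (pd a (pd b u)) x = ∑ b, ∑ a, T a b * pd a (pd b (wf t C₁ u)) x := by
    rw [Finset.sum_comm]
    refine Finset.sum_congr rfl fun b _ => ?_
    rw [Finset.sum_comm]
    exact Finset.sum_congr rfl fun a _ => by rw [w2, Finset.mul_sum]
  rw [r1, r2, r3] at hs
  refine le_trans ?_ hs
  have : 0 ≤ v ^ (κ + 1) * v := by positivity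
  have e : (1 + n * (E1 + E2)) * (v ^ (κ + 1) * v) = v ^ (κ + 1) * v + n * ((E1 + E2) * (v ^ (κ + 1) * v)) := by ring
  rw [e]
  linarith
end
end RH

namespace RH
section
variable {n : ℕ}

lemma lip_const {u : (Fin n → ℝ) → ℝ} (hu : ContDiff ℝ 1 u) (hc : HasCompactSupport u) :
    ∃ L : ℝ, 0 ≤ L ∧ ∀ x y, |u x - u y| ≤ L * ‖x - y‖ := by
  obtain ⟨L, hL⟩ := hu.lipschitzWith_of_hasCompactSupport hc one_ne_zero
  refine ⟨L, L.2, fun x y => ?_⟩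
  have := hL.dist_le_mul x y
  rwa [dist_eq_norm, dist_eq_norm] at this

variable {κ : ℕ} {f : ((Fin n → ℝ) × ℝ × (Fin n → ℝ)) → ℝ} {H : ((Fin n → ℝ) × ℝ) → ℝ}
    {Q : Set ((Fin n → ℝ) × ℝ × (Fin n → ℝ))} {QH : Set ((Fin n → ℝ) × ℝ)} {C C₁ : ℝ}
    {U : Set (Fin n → ℝ)} {u h : (Fin n → ℝ) → ℝ}

/-- uniform difference quotient bounds for a localized solution -/
lemma Sol.dq (S : Sol κ f H Q QH C C₁ U u h) {ε : ℝ} (hε : 0 < ε) : ∃ t₀ : ℝ, 0 < t₀ ∧ ∀ x, ∀ l : Fin n, ∀ s : ℝ, |s| ≤ t₀ →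
    |u (x + s • Pi.single l 1) - u x - s * pd l u x| ≤ ε * |s| ∧
    ∀ m, |pd m u (x + s • Pi.single l 1) - pd m u x - s * pd l (pd m u) x| ≤ ε * |s| := by
  obtain ⟨t1, ht1, h1⟩ := dq_unif (S.hu.of_le (by norm_num)) S.huc hε
  have h2 := fun m => dq_unif (pd_contDiff (m := 1) S.hu m) (pd_hcs S.huc m) hε
  choose t2 ht2 h2 using h2
  rcases isEmpty_or_nonempty (Fin n) with he | he
  · exact ⟨t1, ht1, fun x l => he.elim l⟩
  · obtain ⟨l₀, hl₀⟩ := Finite.exists_min t2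
    refine ⟨min t1 (t2 l₀), lt_min ht1 (ht2 _), fun x l s hs => ⟨h1 x l s (hs.trans (min_le_left _ _)), fun m =>
      h2 m x l s (hs.trans ((min_le_right _ _).trans (hl₀ m)))⟩⟩

lemma Sol.step (hC : 1 ≤ C) (S : Sol κ f H Q QH C C₁ U u h) {ε : ℝ} (hε1 : ε ≤ 1) {x} (hx : x ∈ U) {l : Fin n} {s : ℝ}
    (hd : |u (x + s • Pi.single l 1) - u x - s * pd l u x| ≤ ε * |s| ∧
    ∀ m, |pd m u (x + s • Pi.single l 1) - pd m u x - s * pd l (pd m u) x| ≤ ε * |s|) :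
    |u (x + s • Pi.single l 1) - u x| ≤ 3 * C * |s| ∧
    ∀ m, |pd m u (x + s • Pi.single l 1) - pd m u x| ≤ 3 * C * (lapl u x + C₁) * |s| := by
  have v1 := S.v1 x hx
  have s0 := abs_nonneg s
  have es : ε * |s| ≤ 1 * |s| := mul_le_mul_of_nonneg_right hε1 s0
  constructor
  · have h1 : |s * pd l u x| ≤ |s| * C := by
      rw [abs_mul]; exact mul_le_mul_of_nonneg_left (S.pb x hx l) s0
    have e : u (x + s • Pi.single l 1) - u x = (u (x + s • Pi.single l 1) - u x - s * pd l u x) + s * pd l u x := by ring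
    rw [e]
    refine (abs_add_le _ _).trans ?_
    have h2 := hd.1
    have h3 : 1 * |s| ≤ C * |s| := mul_le_mul_of_nonneg_right hC s0
    have h4 : 0 ≤ C * |s| := by positivity
    linarith
  · intro m
    set v := lapl u x + C₁
    have h1 : |s * pd l (pd m u) x| ≤ |s| * v := by
      rw [abs_mul]; exact mul_le_mul_of_nonneg_left (S.hb x hx l m) s0
    have e : pd m u (x + s • Pi.single l 1) - pd m u x =
      (pd m u (x + s • Pi.single l 1) - pd m u x - s * pd l (pd m u) x) + s * pd l (pd m u) x := by ring
    rw [e]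
    refine (abs_add_le _ _).trans ?_
    have h2 := hd.2 m
    have h3 : 1 * |s| ≤ v * |s| := mul_le_mul_of_nonneg_right v1 s0
    have h4 : 1 * (v * |s|) ≤ C * (v * |s|) := mul_le_mul_of_nonneg_right hC (by positivity)
    have h5 : 0 ≤ v * |s| := by positivity
    linarith

lemma Sol.ext_lip (hC : 1 ≤ C) (S : Sol κ f H Q QH C C₁ U u h) {Φ : ((Fin n → ℝ) × ℝ × (Fin n → ℝ)) → ℝ} {L : ℝ} (hL : 0 ≤ L)
    (h1 : ∀ y ∈ Q, |Φ y| ≤ L) (h2 : ∀ y ∈ Q, ∀ z ∈ Q, |Φ y - Φ z| ≤ L * ‖y - z‖) :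
    ∃ X : (Fin n → ℝ) → ℝ, (∃ c, LipschitzWith c X) ∧ (∀ x ∈ U, X x = Φ (x, u x, grad u x)) ∧ (∀ x ∈ U, |X x| ≤ L) ∧
      ∀ x ∈ U, ∀ b, |lineDeriv ℝ X x (Pi.single b 1)| ≤ L * (3 * C) * (lapl u x + C₁) := by
  obtain ⟨c1, hc1, b1⟩ := lip_const (S.hu.of_le (by norm_num)) S.huc
  have hp := fun m => lip_const (pd_contDiff (m := 1) S.hu m) (pd_hcs S.huc m)
  choose c2 hc2 b2 using hp
  set c3 : ℝ := 1 + c1 + ∑ m, c2 m with hc3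
  have c2s : 0 ≤ ∑ m, c2 m := Finset.sum_nonneg fun m _ => hc2 m
  have hJ : ∀ x y : Fin n → ℝ, ‖((x, u x, grad u x) : (Fin n → ℝ) × ℝ × (Fin n → ℝ)) - (y, u y, grad u y)‖ ≤ c3 * ‖x - y‖ := by
    intro x y
    have n0 := norm_nonneg (x - y)
    rw [Prod.mk_sub_mk, Prod.mk_sub_mk, Prod.norm_mk, Prod.norm_mk]
    refine max_le ?_ (max_le ?_ ?_)
    · exact le_mul_of_one_le_left n0 (by linarith)
    · exact (b1 x y).trans (mul_le_mul_of_nonneg_right (by linarith) n0)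
    · refine (pi_norm_le_iff_of_nonneg (by positivity)).2 fun m => (b2 m x y).trans (mul_le_mul_of_nonneg_right ?_ n0)
      have := Finset.single_le_sum (fun m _ => hc2 m) (Finset.mem_univ m)
      linarith
  have hlip : LipschitzOnWith (Real.toNNReal (L * c3)) (fun x => Φ (x, u x, grad u x)) U := by
    refine LipschitzOnWith.of_dist_le_mul fun x hx y hy => ?_
    rw [Real.coe_toNNReal _ (by positivity), dist_eq_norm, dist_eq_norm, mul_assoc]
    exact (h2 _ (S.mQ x hx) _ (S.mQ y hy)).trans (mul_le_mul_of_nonneg_left (hJ x y) hL)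
  obtain ⟨X, hX, hXe⟩ := hlip.extend_real
  refine ⟨X, ⟨_, hX⟩, fun x hx => (hXe hx).symm, fun x hx => by rw [← hXe hx]; exact h1 _ (S.mQ x hx), fun x hx b => ?_⟩
  obtain ⟨t₀, ht₀, hd⟩ := S.dq one_pos
  have v1 := S.v1 x hx
  unfold lineDeriv
  rw [← Real.norm_eq_abs]
  refine norm_deriv_le_of_lip' (𝕜 := ℝ) (F := ℝ) (by positivity) ?_
  have hcont : Filter.Tendsto (fun s : ℝ => x + s • (Pi.single b 1 : Fin n → ℝ)) (nhds 0) (nhds x) := by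
    have : Continuous (fun s : ℝ => x + s • (Pi.single b 1 : Fin n → ℝ)) := by fun_prop
    simpa using this.tendsto 0
  filter_upwards [hcont (S.hU.mem_nhds hx), Metric.ball_mem_nhds (0:ℝ) ht₀] with s hs hs2
  have hs3 : |s| ≤ t₀ := by
    rw [mem_ball_zero_iff] at hs2; exact hs2.le
  have st := S.step hC le_rfl hx (hd x b s hs3)
  have hs' : x + s • (Pi.single b 1 : Fin n → ℝ) ∈ U := hs
  rw [zero_smul, add_zero, sub_zero, ← hXe hs', ← hXe hx, Real.norm_eq_abs, Real.norm_eq_abs]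
  refine (h2 _ (S.mQ _ hs') _ (S.mQ x hx)).trans ?_
  rw [mul_assoc, mul_assoc]
  refine mul_le_mul_of_nonneg_left ?_ hL
  rw [← mul_assoc]
  have s0 := abs_nonneg s
  have hv3 : 3 * C * |s| ≤ 3 * C * (lapl u x + C₁) * |s| :=
    mul_le_mul_of_nonneg_right (le_mul_of_one_le_right (by linarith) v1) s0
  rw [Prod.mk_sub_mk, Prod.mk_sub_mk, Prod.norm_mk, Prod.norm_mk]
  refine max_le ?_ (max_le (st.1.trans hv3) ((pi_norm_le_iff_of_nonneg (by positivity)).2 st.2))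
  rw [add_sub_cancel_left, norm_e]
  refine le_trans ?_ hv3
  exact le_mul_of_one_le_left s0 (by linarith)

lemma Sol.pd_h (D : Dat κ f H Q QH C) (S : Sol κ f H Q QH C C₁ U u h) {x} (hx : x ∈ U) (a : Fin n) :
    pd a h x = (normSq (grad u x) * fderiv ℝ H (x, u x) (Pi.single a 1, pd a u x) +
      2 * H (x, u x) * (H (x, u x) * normSq (grad u x)) * pd a u x) - 2 * H (x, u x) * h x * pd a u x
      + 2 * H (x, u x) * ∑ m, pd m u x * pd a (pd m u) x := by
  have e1 : h =ᶠ[nhds x] fun y => H (y, u y) * ∑ m, pd m u y * pd m u y := by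
    filter_upwards [S.hU.mem_nhds hx] with y hy
    rw [S.eh y hy]
    congr 1
    exact Finset.sum_congr rfl fun m _ => pow_two _
  have hud : DifferentiableAt ℝ u x := (S.hu.differentiable two_ne_zero) x
  have hin : HasFDerivAt (fun y : Fin n → ℝ => (y, u y)) ((ContinuousLinearMap.id ℝ _).prod (fderiv ℝ u x)) x :=
    (hasFDerivAt_id x).prodMk hud.hasFDerivAt
  have hG : HasFDerivAt (fun y => H (y, u y)) ((fderiv ℝ H (x, u x)).comp ((ContinuousLinearMap.id ℝ _).prod (fderiv ℝ u x))) x :=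
    HasFDerivAt.comp (g := H) x (D.Hd _ (S.mQH x hx)).hasFDerivAt hin
  have hpG : pd a (fun y => H (y, u y)) x = fderiv ℝ H (x, u x) (Pi.single a 1, pd a u x) := by
    unfold pd
    rw [hG.fderiv]; simp
  have hpd : ∀ m, DifferentiableAt ℝ (pd m u) x := fun m => ((pd_contDiff (m := 1) S.hu m).differentiable one_ne_zero) x
  have hmm : ∀ m ∈ (Finset.univ : Finset (Fin n)), DifferentiableAt ℝ (fun y => pd m u y * pd m u y) x := fun m _ =>
    (hpd m).fun_mul (hpd m)
  rw [pd_congr e1, pd_mul hG.differentiableAt (DifferentiableAt.fun_sum hmm), pd_sum hmm, hpG, S.eh x hx]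
  have e2 : ∑ m, pd a (fun y => pd m u y * pd m u y) x = 2 * ∑ m, pd m u x * pd a (pd m u) x := by
    rw [Finset.mul_sum]
    exact Finset.sum_congr rfl fun m _ => by rw [pd_mul (hpd m) (hpd m)]; ring
  have e3 : ∑ m, pd m u x * pd m u x = normSq (grad u x) := Finset.sum_congr rfl fun m _ => (pow_two _).symm
  rw [e2, e3]
  ring

lemma rp_up {v w q : ℝ} (hq : 2 < q) (hv : 1 ≤ v) (h : |w - v| ≤ 1 / (2 * q)) :
    v / 2 ≤ w ∧ w ^ q ≤ 2 * v ^ q ∧ v ^ (q - 1) ≤ 2 * w ^ (q - 1) := by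
  have hq0 : 0 < q := by linarith
  set d : ℝ := 1 / (2 * q) with hd
  have hd0 : 0 < d := by positivity
  have hdq : d * q = 1 / 2 := by rw [hd]; field_simp
  have hd1 : d ≤ 1 / 4 := by
    rw [hd, div_le_div_iff₀ (by positivity) (by norm_num)]; linarith
  have hdv : d * 1 ≤ d * v := mul_le_mul_of_nonneg_left hv hd0.le
  obtain ⟨h1, h2⟩ := abs_le.1 h
  have w0 : v / 2 ≤ w := by linarith
  refine ⟨w0, ?_, ?_⟩
  · have a1 : w ≤ v * (1 + d) := by linarith
    have a2 : (1 + d) ^ q ≤ 2 := by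
      have : 1 + d ≤ Real.exp d := by linarith [Real.add_one_le_exp d]
      calc (1 + d) ^ q ≤ (Real.exp d) ^ q := Real.rpow_le_rpow (by positivity) this hq0.le
        _ = Real.exp (1 / 2) := by rw [← Real.exp_mul, hdq]
        _ ≤ 2 := by
          have h3 : Real.exp (1 / 2) ^ 2 = Real.exp 1 := by rw [← Real.exp_nat_mul]; norm_num
          have h4 := Real.exp_one_lt_d9
          nlinarith [Real.exp_pos (1 / 2 : ℝ)]
    calc w ^ q ≤ (v * (1 + d)) ^ q := Real.rpow_le_rpow (by linarith) a1 hq0.le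
      _ = v ^ q * (1 + d) ^ q := Real.mul_rpow (by linarith) (by linarith)
      _ ≤ v ^ q * 2 := mul_le_mul_of_nonneg_left a2 (Real.rpow_nonneg (by linarith) _)
      _ = 2 * v ^ q := mul_comm _ _
  · have a1 : v * (1 + -d) ≤ w := by linarith
    have a2 := one_add_mul_self_le_rpow_one_add (s := -d) (by linarith) (p := q - 1) (by linarith)
    have a3 : 1 / 2 ≤ (1 + -d) ^ (q - 1) := by linarith
    have a4 : v ^ (q - 1) * (1 + -d) ^ (q - 1) ≤ w ^ (q - 1) := by
      rw [← Real.mul_rpow (by linarith) (by linarith)]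
      exact Real.rpow_le_rpow (mul_nonneg (by linarith) (by linarith)) a1 (by linarith)
    have a5 : v ^ (q - 1) * (1 / 2) ≤ v ^ (q - 1) * (1 + -d) ^ (q - 1) :=
      mul_le_mul_of_nonneg_left a3 (Real.rpow_nonneg (by linarith) _)
    linarith
end
end RH

namespace RH
section
variable {n : ℕ}

/-- coefficient in the gradient of `h` -/
noncomputable def ΦX (H : ((Fin n → ℝ) × ℝ) → ℝ) (a : Fin n) (y : (Fin n → ℝ) × ℝ × (Fin n → ℝ)) : ℝ :=
  normSq y.2.2 * fderiv ℝ H (y.1, y.2.1) (Pi.single a 1, y.2.2 a) +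
    2 * H (y.1, y.2.1) * (H (y.1, y.2.1) * normSq y.2.2) * y.2.2 a

/-- coefficient from the right hand side -/
noncomputable def Φg (κ : ℕ) (f : ((Fin n → ℝ) × ℝ × (Fin n → ℝ)) → ℝ) (m : Fin n) (y : (Fin n → ℝ) × ℝ × (Fin n → ℝ)) : ℝ :=
  ((κ : ℝ) + 2) * f y ^ (κ + 1) * fderiv ℝ f y (0, 0, Pi.single m 1)

lemma core_of_sol (hn : 1 ≤ n) (κ : ℕ) (hκ : κ + 2 ≤ n) (C L : ℝ) (hC : 1 ≤ C) (hL : 0 ≤ L) : ∃ C' : ℝ, 1 ≤ C' ∧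
    ∀ (f : ((Fin n → ℝ) × ℝ × (Fin n → ℝ)) → ℝ) (H : ((Fin n → ℝ) × ℝ) → ℝ)
    (Q : Set ((Fin n → ℝ) × ℝ × (Fin n → ℝ))) (QH : Set ((Fin n → ℝ) × ℝ)) (C₁ : ℝ)
    (U : Set (Fin n → ℝ)) (u h : (Fin n → ℝ) → ℝ), Dat κ f H Q QH C → Sol κ f H Q QH C C₁ U u h →
    (∀ a, (∀ y ∈ Q, |ΦX H a y| ≤ L) ∧ ∀ y ∈ Q, ∀ z ∈ Q, |ΦX H a y - ΦX H a z| ≤ L * ‖y - z‖) →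
    (∀ a, (∀ y ∈ Q, |Φg κ f a y| ≤ L) ∧ ∀ y ∈ Q, ∀ z ∈ Q, |Φg κ f a y - Φg κ f a z| ≤ L * ‖y - z‖) →
    ∀ (q : ℝ) (K : Set (Fin n → ℝ)), 2 < q → IsCompact K → K ⊆ U →
    ∃ (w : (Fin n → ℝ) → ℝ) (X g : Fin n → (Fin n → ℝ) → ℝ),
      Core κ C' q K u h (fun x => lapl u x + C₁) w (fun x => H (x, u x)) X g ∧
      ∀ x ∈ K, (lapl u x + C₁) ^ (q - 1) ≤ 2 * w x ^ (q - 1) := by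
  obtain ⟨C2, hC2, hmain⟩ := main_ineq (n := n) κ hκ C (3 * C) hC (by linarith)
  set C' : ℝ := C2 + L * (3 * C) + L + C + (1 + n * C ^ 3) + (2 * C * (n * C ^ 3) * C + 2 * C * (n * C)) with hC'
  have hLC : 0 ≤ L * (3 * C) := by positivity
  have hnC : 0 ≤ n * C ^ 3 := by positivity
  have hnD : 0 ≤ 2 * C * (n * C ^ 3) * C + 2 * C * (n * C) := by positivity
  refine ⟨C', by linarith, ?_⟩
  intro f H Q QH C₁ U u h D S hX hg q K hq hK hKU
  have hX' := fun a => S.ext_lip hC hL (hX a).1 (hX a).2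
  have hg' := fun a => S.ext_lip hC hL (hg a).1 (hg a).2
  choose X X1 X2 X3 X4 using hX'
  choose g g1 g2 g3 g4 using hg'
  have hn0 : (0:ℝ) < n := by exact_mod_cast hn
  have hn1 : (1:ℝ) ≤ n := by exact_mod_cast hn
  set ε : ℝ := 1 / (4 * n * q) with hε
  have hε0 : 0 < ε := by positivity
  have hε1 : ε ≤ 1 := by
    rw [hε, div_le_one (by positivity)]
    nlinarith
  obtain ⟨t₀, ht₀, hd⟩ := S.dq hε0
  obtain ⟨δ, hδ, hδU⟩ := hK.exists_cthickening_subset_open S.hU hKU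
  set t : ℝ := min t₀ δ with ht
  have ht0 : 0 < t := lt_min ht₀ hδ
  have htt : t ≤ t₀ := min_le_left _ _
  have htδ : t ≤ δ := min_le_right _ _
  have hmem : ∀ x ∈ K, ∀ l : Fin n, x + t • Pi.single l 1 ∈ U ∧ x - t • Pi.single l 1 ∈ U := by
    intro x hx l
    constructor <;> refine hδU (mem_cthickening_of_dist_le _ x δ K hx ?_)
    · rw [dist_eq_norm, add_sub_cancel_left, norm_e, abs_of_pos ht0]; exact htδ
    · rw [dist_eq_norm, sub_sub_cancel_left, norm_neg, norm_e, abs_of_pos ht0]; exact htδ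
  have neg_e : ∀ (x : Fin n → ℝ) (l : Fin n), x - t • (Pi.single l 1 : Fin n → ℝ) = x + (-t) • Pi.single l 1 := fun x l => by
    rw [neg_smul, sub_eq_add_neg]
  have hat : |t| = t := abs_of_pos ht0
  have stp : ∀ x ∈ K, ∀ l : Fin n, (|u (x + t • Pi.single l 1) - u x| ≤ 3 * C * t ∧
      ∀ m, |pd m u (x + t • Pi.single l 1) - pd m u x| ≤ 3 * C * (lapl u x + C₁) * t) ∧
      (|u (x - t • Pi.single l 1) - u x| ≤ 3 * C * t ∧
      ∀ m, |pd m u (x - t • Pi.single l 1) - pd m u x| ≤ 3 * C * (lapl u x + C₁) * t) := by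
    intro x hx l
    have a1 := S.step hC hε1 (hKU hx) (hd x l t (by rw [hat]; exact htt))
    have a2 := S.step hC hε1 (hKU hx) (hd x l (-t) (by rw [abs_neg, hat]; exact htt))
    rw [hat] at a1
    rw [abs_neg, hat, ← neg_e] at a2
    exact ⟨a1, a2⟩
  have sec : ∀ x, ∀ l : Fin n, |u (x + t • Pi.single l 1) - 2 * u x + u (x - t • Pi.single l 1) - t ^ 2 * pd l (pd l u) x| ≤ 2 * ε * t ^ 2 := by
    intro x l
    exact ddq_unif S.hu (fun x l s hs => (hd x l s hs).2 l) hε0.le x l ht0 htt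
  have sec2 : ∀ x ∈ K, ∀ l : Fin n, |u (x + t • Pi.single l 1) - 2 * u x + u (x - t • Pi.single l 1)| ≤ 3 * C * (lapl u x + C₁) * t ^ 2 := by
    intro x hx l
    have a1 := sec x l
    have a2 := S.hb x (hKU hx) l l
    have v1 := S.v1 x (hKU hx)
    set v := lapl u x + C₁
    set A := u (x + t • Pi.single l 1) - 2 * u x + u (x - t • Pi.single l 1)
    have e : A = (A - t ^ 2 * pd l (pd l u) x) + t ^ 2 * pd l (pd l u) x := by ring
    rw [e]
    refine (abs_add_le _ _).trans ?_
    have ht2 : 0 < t ^ 2 := by positivity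
    have a3 : |t ^ 2 * pd l (pd l u) x| ≤ t ^ 2 * v := by
      rw [abs_mul, abs_of_pos ht2]; exact mul_le_mul_of_nonneg_left a2 ht2.le
    have a4 : ε * t ^ 2 ≤ 1 * t ^ 2 := mul_le_mul_of_nonneg_right hε1 ht2.le
    have a5 : 1 * t ^ 2 ≤ v * t ^ 2 := mul_le_mul_of_nonneg_right v1 ht2.le
    have a6 : 1 * (v * t ^ 2) ≤ C * (v * t ^ 2) := mul_le_mul_of_nonneg_right hC (by positivity)
    linarith
  have wvd : ∀ x, |wf t C₁ u x - (lapl u x + C₁)| ≤ 1 / (2 * q) := by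
    intro x
    have e : wf t C₁ u x - (lapl u x + C₁) = ∑ l, (ddq l t u x - pd l (pd l u) x) := by
      rw [Finset.sum_sub_distrib]; simp only [wf, lapl]; ring
    rw [e]
    calc _ ≤ ∑ l, |ddq l t u x - pd l (pd l u) x| := Finset.abs_sum_le_sum_abs _ _
      _ ≤ ∑ _l : Fin n, 2 * ε := Finset.sum_le_sum fun l _ => by
          have ht2 : 0 < t ^ 2 := by positivity
          have e2 : ddq l t u x - pd l (pd l u) x = (u (x + t • Pi.single l 1) - 2 * u x + u (x - t • Pi.single l 1) - t ^ 2 * pd l (pd l u) x) / t ^ 2 := by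
            simp only [ddq]; field_simp
          rw [e2, abs_div, abs_of_pos ht2, div_le_iff₀ ht2]
          exact sec x l
      _ = 1 / (2 * q) := by
          simp only [Finset.sum_const, Finset.card_univ, Fintype.card_fin, nsmul_eq_mul, hε]
          field_simp; norm_num
  have rp := fun x (hx : x ∈ K) => rp_up hq (S.v1 x (hKU hx)) (wvd x)
  have vpos : ∀ x ∈ K, 0 ≤ lapl u x + C₁ := fun x hx => by linarith [S.v1 x (hKU hx)]
  have up : ∀ A : ℝ, A ≤ C' → ∀ x ∈ K, A * (lapl u x + C₁) ≤ C' * (lapl u x + C₁) := fun A hA x hx =>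
    mul_le_mul_of_nonneg_right hA (vpos x hx)
  refine ⟨wf t C₁ u, X, g, ?_, fun x hx => (rp x hx).2.2⟩
  have ehx : ∀ x ∈ K, ∀ a, pd a h x = X a x - 2 * H (x, u x) * h x * pd a u x
        + 2 * H (x, u x) * ∑ m, pd m u x * pd a (pd m u) x := by
    intro x hx a
    rw [S.pd_h D (hKU hx) a, X2 a x (hKU hx)]
    rfl
  refine
    { hu := S.hu
      huc := S.huc
      hh := S.hh
      hw := wf_contDiff S.hu t C₁
      hK := hK
      hv := ?_
      hX := X1
      hg := g1
      hv1 := fun x hx => S.v1 x (hKU hx)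
      bX := fun x hx a => (X3 a x (hKU hx)).trans (by linarith)
      bg := fun x hx a => (g3 a x (hKU hx)).trans (by linarith)
      bG := fun x hx => (D.HB _ (S.mQH x (hKU hx))).trans (by linarith)
      bp := fun x hx a => (S.pb x (hKU hx) a).trans (by linarith)
      lX := fun x hx a b => (X4 a x (hKU hx) b).trans (up _ (by linarith) x hx)
      lg := fun x hx a b => (g4 a x (hKU hx) b).trans (up _ (by linarith) x hx)
      bh := ?_
      bA := fun x hx a b => ((AH_bound D S (hKU hx)).2 a b).trans (up _ (by linarith) x hx)
      eh := ehx
      gam := fun x hx => S.gm x (hKU hx)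
      sig := ?_
      main := ?_
      wv := fun x hx => (rp x hx).1
      wq := fun x hx => (rp x hx).2.1 }
  · have : Continuous (fun x => lapl u x + C₁) := by
      unfold lapl
      exact (continuous_finsetSum _ fun l _ => (pd_contDiff (m := 0) (pd_contDiff (m := 1) S.hu l) l).continuous).add continuous_const
    exact this.continuousOn
  · intro x hx a
    have v1 := S.v1 x (hKU hx)
    rw [ehx x hx a]
    set v := lapl u x + C₁
    have b1 := X3 a x (hKU hx)
    have bH := D.HB _ (S.mQH x (hKU hx))
    have bp := S.pb x (hKU hx)
    have b2 : |2 * H (x, u x) * h x * pd a u x| ≤ 2 * C * (n * C ^ 3) * C := by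
      rw [abs_mul, abs_mul, abs_mul, abs_two]
      refine mul_le_mul (mul_le_mul (mul_le_mul_of_nonneg_left bH (by norm_num)) (AH_bound D S (hKU hx)).1 (abs_nonneg _) (by positivity)) (bp a) (abs_nonneg _) (by positivity)
    have b3 : |2 * H (x, u x) * ∑ m, pd m u x * pd a (pd m u) x| ≤ 2 * C * (n * (C * v)) := by
      rw [abs_mul, abs_mul, abs_two]
      refine mul_le_mul (mul_le_mul_of_nonneg_left bH (by norm_num)) ?_ (abs_nonneg _) (by positivity)
      calc _ ≤ ∑ m, |pd m u x * pd a (pd m u) x| := Finset.abs_sum_le_sum_abs _ _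
        _ ≤ ∑ _m : Fin n, C * v := Finset.sum_le_sum fun m _ => by
            rw [abs_mul]
            exact mul_le_mul (bp m) (S.hb x (hKU hx) a m) (abs_nonneg _) (by linarith)
        _ = n * (C * v) := by simp
    refine le_trans (b := (L + 2 * C * (n * C ^ 3) * C + 2 * C * (n * C)) * v) ?_ (up _ (by linarith) x hx)
    have b4 : L * 1 ≤ L * v := mul_le_mul_of_nonneg_left v1 hL
    have b5 : 2 * C * (n * C ^ 3) * C * 1 ≤ 2 * C * (n * C ^ 3) * C * v := mul_le_mul_of_nonneg_left v1 (by positivity)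
    have b6 := abs_add_le (X a x - 2 * H (x, u x) * h x * pd a u x) (2 * H (x, u x) * ∑ m, pd m u x * pd a (pd m u) x)
    have b7 := abs_sub (X a x) (2 * H (x, u x) * h x * pd a u x)
    have b8 : (L + 2 * C * (n * C ^ 3) * C + 2 * C * (n * C)) * v = L * v + 2 * C * (n * C ^ 3) * C * v + 2 * C * (n * (C * v)) := by ring
    rw [b8]
    linarith
  · intro x hx
    rw [S.sg x (hKU hx)]
    refine (D.fc _ (S.mQ x (hKU hx))).trans (mul_le_mul_of_nonneg_right (by linarith) ?_)
    have := D.f0 _ (S.mQ x (hKU hx))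
    positivity
  · intro x hx
    have := hmain f H Q QH C₁ U u h D S x t (hKU hx) ht0 (hmem x hx) (fun l => ⟨(stp x hx l).1.1, (stp x hx l).2.1⟩)
      (fun l m => ⟨(stp x hx l).1.2 m, (stp x hx l).2.2 m⟩) (sec2 x hx)
    refine le_trans ?_ this
    have e : ∑ m, g m x * pd m (wf t C₁ u) x = ∑ m, (((κ : ℝ) + 2) * f (x, u x, grad u x) ^ (κ + 1) * fderiv ℝ f (x, u x, grad u x) (0, 0, Pi.single m 1)) *
          pd m (wf t C₁ u) x := Finset.sum_congr rfl fun m _ => by rw [g2 m x (hKU hx)]; rfl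
    rw [e]
    have v0 := vpos x hx
    have : C2 * ((lapl u x + C₁) ^ (κ + 1) * (lapl u x + C₁)) ≤ C' * ((lapl u x + C₁) ^ (κ + 1) * (lapl u x + C₁)) :=
      mul_le_mul_of_nonneg_right (by linarith) (by positivity)
    linarith
end
end RH

namespace RH
section
variable {n : ℕ}

lemma BL.common {E : Type*} [NormedAddCommGroup E] {Q : Set E} {ι : Type*} [Fintype ι] {φ : ι → E → ℝ} (h : ∀ i, BL Q (φ i)) :
    ∃ L : ℝ, 0 ≤ L ∧ ∀ i, (∀ y ∈ Q, |φ i y| ≤ L) ∧ ∀ y ∈ Q, ∀ z ∈ Q, |φ i y - φ i z| ≤ L * ‖y - z‖ := by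
  choose c hc using h
  refine ⟨∑ i, |c i|, Finset.sum_nonneg fun i _ => abs_nonneg _, fun i => ?_⟩
  have hi : c i ≤ ∑ i, |c i| :=
    (le_abs_self _).trans (Finset.single_le_sum (f := fun i => |c i|) (fun i _ => abs_nonneg _) (Finset.mem_univ i))
  refine ⟨fun y hy => ((hc i).1 y hy).trans hi, fun y hy z hz => ((hc i).2 y hy z hz).trans ?_⟩
  gcongr

/-- a fixed direction of a bounded Lipschitz derivative -/
lemma BL.dir {E F : Type*} [NormedAddCommGroup E] [NormedAddCommGroup F] [NormedSpace ℝ F] {Q : Set E} {D : E → F →L[ℝ] ℝ} {C : ℝ}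
    (h1 : ∀ y ∈ Q, ‖D y‖ ≤ C) (h2 : ∀ y ∈ Q, ∀ z ∈ Q, ‖D y - D z‖ ≤ C * ‖y - z‖) (e : F) : BL Q (fun y => D y e) := by
  refine BL.mk' (C * ‖e‖) (C * ‖e‖) (fun y hy => ?_) (fun y hy z hz => ?_)
  · rw [← Real.norm_eq_abs]
    exact ((D y).le_opNorm e).trans (by gcongr; exact h1 y hy)
  · have : D y e - D z e = (D y - D z) e := by simp
    rw [this, ← Real.norm_eq_abs]
    refine ((D y - D z).le_opNorm e).trans ?_
    calc ‖D y - D z‖ * ‖e‖ ≤ (C * ‖y - z‖) * ‖e‖ := by gcongr; exact h2 y hy z hz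
      _ = _ := by ring

lemma proj_le (y z : (Fin n → ℝ) × ℝ × (Fin n → ℝ)) : ‖((y.1, y.2.1) : (Fin n → ℝ) × ℝ) - (z.1, z.2.1)‖ ≤ ‖y - z‖ := by
  rw [Prod.norm_def, Prod.norm_def (y - z), Prod.norm_def (y - z).2]
  simp only [Prod.fst_sub, Prod.snd_sub]
  exact max_le_max le_rfl (le_max_left _ _)

lemma data_exists (κ : ℕ) {Ω : Set (Fin n → ℝ)} (hΩ : IsOpen Ω)
    {f : ((Fin n → ℝ) × ℝ × (Fin n → ℝ)) → ℝ}
    (hfpos : ∀ y ∈ Ω ×ˢ ((univ : Set ℝ) ×ˢ (univ : Set (Fin n → ℝ))), 0 < f y)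
    (hf : C11On f (Ω ×ˢ ((univ : Set ℝ) ×ˢ (univ : Set (Fin n → ℝ)))))
    {H : ((Fin n → ℝ) × ℝ) → ℝ}
    (hH0 : ∀ y ∈ Ω ×ˢ (univ : Set ℝ), 0 ≤ H y)
    (hH : C11On H (Ω ×ˢ (univ : Set ℝ)))
    (x₀ : Fin n → ℝ) (r M : ℝ) (hM : 0 < M) (hball : closedBall x₀ r ⊆ Ω) (hr : 0 ≤ r) :
    ∃ C L : ℝ, M ≤ C ∧ 0 ≤ L ∧
      Dat κ f H (closedBall x₀ r ×ˢ (Icc (-M) M ×ˢ closedBall (0 : Fin n → ℝ) M)) (closedBall x₀ r ×ˢ Icc (-M) M) C ∧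
      (∀ a, (∀ y ∈ closedBall x₀ r ×ˢ (Icc (-M) M ×ˢ closedBall (0 : Fin n → ℝ) M), |ΦX H a y| ≤ L) ∧
        ∀ y ∈ closedBall x₀ r ×ˢ (Icc (-M) M ×ˢ closedBall (0 : Fin n → ℝ) M),
        ∀ z ∈ closedBall x₀ r ×ˢ (Icc (-M) M ×ˢ closedBall (0 : Fin n → ℝ) M), |ΦX H a y - ΦX H a z| ≤ L * ‖y - z‖) ∧
      (∀ a, (∀ y ∈ closedBall x₀ r ×ˢ (Icc (-M) M ×ˢ closedBall (0 : Fin n → ℝ) M), |Φg κ f a y| ≤ L) ∧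
        ∀ y ∈ closedBall x₀ r ×ˢ (Icc (-M) M ×ˢ closedBall (0 : Fin n → ℝ) M),
        ∀ z ∈ closedBall x₀ r ×ˢ (Icc (-M) M ×ˢ closedBall (0 : Fin n → ℝ) M), |Φg κ f a y - Φg κ f a z| ≤ L * ‖y - z‖) := by
  set Q : Set ((Fin n → ℝ) × ℝ × (Fin n → ℝ)) := closedBall x₀ r ×ˢ (Icc (-M) M ×ˢ closedBall (0 : Fin n → ℝ) M) with hQ
  set QH : Set ((Fin n → ℝ) × ℝ) := closedBall x₀ r ×ˢ Icc (-M) M with hQH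
  have cQ : IsCompact Q := (isCompact_closedBall _ _).prod (isCompact_Icc.prod (isCompact_closedBall _ _))
  have cQH : IsCompact QH := (isCompact_closedBall _ _).prod isCompact_Icc
  have vQ : Convex ℝ Q := (convex_closedBall _ _).prod ((convex_Icc _ _).prod (convex_closedBall _ _))
  have vQH : Convex ℝ QH := (convex_closedBall _ _).prod (convex_Icc _ _)
  have sQ : Q ⊆ Ω ×ˢ ((univ : Set ℝ) ×ˢ (univ : Set (Fin n → ℝ))) :=
    fun y hy => ⟨hball hy.1, mem_univ _, mem_univ _⟩
  have sQH : QH ⊆ Ω ×ˢ (univ : Set ℝ) := fun y hy => ⟨hball hy.1, mem_univ _⟩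
  have pr : ∀ y ∈ Q, (y.1, y.2.1) ∈ QH := fun y hy => ⟨hy.1, hy.2.1⟩
  obtain ⟨Cf, hCf1, fd, fB, fD, fDL, fL, fT⟩ := c11_data (hΩ.prod (isOpen_univ.prod isOpen_univ)) hf cQ vQ sQ
  obtain ⟨CH, hCH1, Hd, HB, HD, HDL, HL, HT⟩ := c11_data (hΩ.prod isOpen_univ) hH cQH vQH sQH
  have hne : Q.Nonempty := ⟨(x₀, 0, 0), mem_closedBall_self hr, ⟨by linarith, hM.le⟩, mem_closedBall_self hM.le⟩
  obtain ⟨y₀, hy₀, hmin⟩ := cQ.exists_isMinOn hne (hf.1.continuousOn.mono sQ)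
  have hc0 : 0 < f y₀ := hfpos _ (sQ hy₀)
  set m := f y₀ ^ (κ + 2) with hm
  have hm0 : 0 < m := by positivity
  have hm1 : 0 < m⁻¹ := by positivity
  set C := Cf + CH + M + m⁻¹ with hC
  have e1 : Cf ≤ C := by linarith
  have e2 : CH ≤ C := by linarith
  have hD : Dat κ f H Q QH C :=
    { C1 := by linarith
      f0 := fun y hy => hfpos y (sQ hy)
      fc := by
        intro y hy
        have h1 : m ≤ f y ^ (κ + 2) := pow_le_pow_left₀ hc0.le (hmin hy) _
        calc (1:ℝ) = m⁻¹ * m := by field_simp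
          _ ≤ C * f y ^ (κ + 2) := by gcongr; linarith
      fB := fun y hy => (fB y hy).trans e1
      fD := fun y hy => (fD y hy).trans e1
      fT := fun y hy z hz => (fT y hy z hz).trans (by gcongr)
      H0 := fun y hy => hH0 y (sQH hy)
      Hd := Hd
      HB := fun y hy => (HB y hy).trans e2
      HD := fun y hy => (HD y hy).trans e2
      HL := fun y hy z hz => (HL y hy z hz).trans (by gcongr)
      HT := fun y hy z hz => (HT y hy z hz).trans (by gcongr) }
  have bξ : ∀ a : Fin n, BL Q (fun y => y.2.2 a) := by
    intro a
    refine BL.mk' M 1 (fun y hy => ?_) (fun y hy z hz => ?_)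
    · have := hy.2.2
      rw [mem_closedBall_zero_iff] at this
      rw [← Real.norm_eq_abs]
      exact (norm_le_pi_norm _ a).trans this
    · rw [one_mul, ← Real.norm_eq_abs]
      have h1 : ‖(y - z).2.2 a‖ ≤ ‖(y - z).2.2‖ := norm_le_pi_norm _ a
      have h2 : ‖(y - z).2.2‖ ≤ ‖(y - z).2‖ := norm_snd_le _
      have h3 : ‖(y - z).2‖ ≤ ‖y - z‖ := norm_snd_le _
      exact (h1.trans h2).trans h3
  have bN : BL Q (fun y => normSq y.2.2) := by
    unfold normSq
    exact BL.sum _ fun i => (bξ i).pow 2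
  have bH : BL Q (fun y => H (y.1, y.2.1)) :=
    BL.mk' CH CH (fun y hy => HB _ (pr y hy)) (fun y hy z hz => (HL _ (pr y hy) _ (pr z hz)).trans
      (by gcongr; exact proj_le y z))
  have bDH : ∀ e, BL Q (fun y => fderiv ℝ H (y.1, y.2.1) e) := fun e =>
    BL.dir (D := fun y : (Fin n → ℝ) × ℝ × (Fin n → ℝ) => fderiv ℝ H (y.1, y.2.1)) (C := CH) (fun y hy => HD _ (pr y hy)) (fun y hy z hz => (HDL _ (pr y hy) _ (pr z hz)).trans
      (by gcongr; exact proj_le y z)) e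
  have bf : BL Q f := BL.mk' Cf Cf fB fL
  have bX : ∀ a, BL Q (ΦX H a) := by
    intro a
    have e : ΦX H a = fun y => normSq y.2.2 * (fderiv ℝ H (y.1, y.2.1) (Pi.single a 1, 0) + y.2.2 a * fderiv ℝ H (y.1, y.2.1) (0, 1)) +
        2 * H (y.1, y.2.1) * (H (y.1, y.2.1) * normSq y.2.2) * y.2.2 a := by
      funext y
      have : ((Pi.single a 1, y.2.2 a) : (Fin n → ℝ) × ℝ) = (Pi.single a 1, 0) + y.2.2 a • ((0, 1) : (Fin n → ℝ) × ℝ) := by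
        ext <;> simp
      simp only [ΦX]
      rw [this, map_add, map_smul, smul_eq_mul]
    rw [e]
    exact (bN.mul ((bDH _).add ((bξ a).mul (bDH _)))).add ((((BL.const 2).mul bH).mul (bH.mul bN)).mul (bξ a))
  have bg : ∀ a, BL Q (Φg κ f a) := fun a =>
    ((BL.const _).mul (bf.pow _)).mul (BL.dir fD fDL _)
  obtain ⟨L1, hL1, h1⟩ := BL.common bX
  obtain ⟨L2, hL2, h2⟩ := BL.common bg
  refine ⟨C, L1 + L2, by linarith, by linarith, hD, fun a => ⟨fun y hy => ((h1 a).1 y hy).trans (by linarith), fun y hy z hz => ((h1 a).2 y hy z hz).trans ?_⟩,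
    fun a => ⟨fun y hy => ((h2 a).1 y hy).trans (by linarith), fun y hy z hz => ((h2 a).2 y hy z hz).trans ?_⟩⟩
  · gcongr; linarith
  · gcongr; linarith

end
end RH

namespace RH
section
variable {n : ℕ}

lemma abs_entry_le (A : Matrix (Fin n) (Fin n) ℝ) (i j : Fin n) : |A i j| ≤ matNorm A := by
  have h := (LinearMap.toContinuousLinearMap (Matrix.toEuclideanLin A)).le_opNorm (EuclideanSpace.single j (1:ℝ))
  rw [EuclideanSpace.norm_single, norm_one, mul_one] at h
  have h2 : ‖(LinearMap.toContinuousLinearMap (Matrix.toEuclideanLin A) (EuclideanSpace.single j (1:ℝ))) i‖ ≤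
    ‖LinearMap.toContinuousLinearMap (Matrix.toEuclideanLin A) (EuclideanSpace.single j (1:ℝ))‖ := PiLp.norm_apply_le _ i
  have h3 : (LinearMap.toContinuousLinearMap (Matrix.toEuclideanLin A) (EuclideanSpace.single j (1:ℝ))) i = A i j := by
    simp [Matrix.toEuclideanLin, Matrix.toLpLin_apply]
  rw [h3, Real.norm_eq_abs] at h2
  exact h2.trans h

lemma abs_le_vnorm (ξ : Fin n → ℝ) (i : Fin n) : |ξ i| ≤ vnorm ξ := by
  rw [vnorm, ← Real.sqrt_sq_eq_abs]
  exact Real.sqrt_le_sqrt (Finset.single_le_sum (f := fun i => ξ i ^ 2) (fun i _ => sq_nonneg _) (Finset.mem_univ i))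

lemma vnorm_nonneg (ξ : Fin n → ℝ) : 0 ≤ vnorm ξ := Real.sqrt_nonneg _

/-- multiplying by a cutoff gives a global function -/
lemma cutoff_contDiff {Ω : Set (Fin n → ℝ)} (hΩ : IsOpen Ω) {χ g : (Fin n → ℝ) → ℝ} {m : ℕ} (hχ : ContDiff ℝ m χ) (hg : ContDiffOn ℝ m g Ω)
    (hs : tsupport χ ⊆ Ω) : ContDiff ℝ m (fun x => χ x * g x) := by
  rw [contDiff_iff_contDiffAt]
  intro x
  by_cases hx : x ∈ tsupport χ
  · exact hχ.contDiffAt.mul (hg.contDiffAt (hΩ.mem_nhds (hs hx)))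
  · have : (fun x => χ x * g x) =ᶠ[nhds x] fun _ => 0 := by
      filter_upwards [(isClosed_tsupport χ).isOpen_compl.mem_nhds hx] with y hy
      rw [image_eq_zero_of_notMem_tsupport hy, zero_mul]
    exact contDiffAt_const.congr_of_eventuallyEq this

lemma pd_contDiffOn {Ω : Set (Fin n → ℝ)} (hΩ : IsOpen Ω) {g : (Fin n → ℝ) → ℝ} {m : ℕ} (hg : ContDiffOn ℝ (m + 1 : ℕ) g Ω) (a : Fin n) :
    ContDiffOn ℝ m (pd a g) Ω := by
  have h1 : ContDiffOn ℝ m (fderiv ℝ g) Ω := hg.fderiv_of_isOpen hΩ (by norm_cast)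
  exact h1.clm_apply contDiffOn_const

lemma sol_exists {κ : ℕ} {Ω : Set (Fin n → ℝ)} (hΩ : IsOpen Ω)
    {f : ((Fin n → ℝ) × ℝ × (Fin n → ℝ)) → ℝ} {H : ((Fin n → ℝ) × ℝ) → ℝ}
    (hH : C11On H (Ω ×ˢ (univ : Set ℝ)))
    {x₀ : Fin n → ℝ} {r s M C C₁ : ℝ} (hs : 0 < s) (hsr : s < r) (hM : M ≤ C) (hball : closedBall x₀ r ⊆ Ω)
    {u : (Fin n → ℝ) → ℝ} (hu : ContDiffOn ℝ 2 u Ω)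
    (heq : ∀ x ∈ Ω,
        esymmMat (κ + 2) (hess u x -
            (H (x, u x) * normSq (grad u x)) • (1 : Matrix (Fin n) (Fin n) ℝ))
          = f (x, u x, grad u x) ^ (κ + 2) ∧
        GammaPlus (κ + 2) (hess u x -
            (H (x, u x) * normSq (grad u x)) • (1 : Matrix (Fin n) (Fin n) ℝ)))
    (hv : ∀ x ∈ ball x₀ r, 1 ≤ lapl u x + C₁ ∧ matNorm (hess u x) ≤ lapl u x + C₁)
    (hb : ∀ x ∈ ball x₀ r, |u x| + vnorm (grad u x) ≤ M) :
    ∃ u' h : (Fin n → ℝ) → ℝ, Sol κ f H (closedBall x₀ r ×ˢ (Icc (-M) M ×ˢ closedBall (0 : Fin n → ℝ) M)) (closedBall x₀ r ×ˢ Icc (-M) M)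
      C C₁ (ball x₀ s) u' h ∧ ∀ x ∈ ball x₀ s, lapl u' x = lapl u x := by
  let χ : ContDiffBump x₀ := ⟨s, (s + r) / 2, hs, by linarith⟩
  have hts : tsupport χ ⊆ Ω := by
    rw [χ.tsupport_eq]
    exact (closedBall_subset_closedBall (by show (s + r) / 2 ≤ r; linarith)).trans hball
  have hUr : ball x₀ s ⊆ ball x₀ r := ball_subset_ball hsr.le
  have hUΩ : ball x₀ s ⊆ Ω := (hUr.trans ball_subset_closedBall).trans hball
  have hχ1 : ∀ x ∈ ball x₀ s, χ x = 1 := fun x hx => χ.one_of_mem_closedBall (ball_subset_closedBall hx)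
  set u' : (Fin n → ℝ) → ℝ := fun x => χ x * u x with hu'
  set h : (Fin n → ℝ) → ℝ := fun x => χ x * (H (x, u x) * normSq (grad u x)) with hh
  have cu : ContDiff ℝ (2 : ℕ) u' := cutoff_contDiff hΩ χ.contDiff (by exact_mod_cast hu) hts
  have hu1 : ContDiffOn ℝ 1 u Ω := hu.of_le (by norm_num)
  have cgr : ∀ a, ContDiffOn ℝ 1 (pd a u) Ω := fun a => by
    have := pd_contDiffOn hΩ (m := 1) (g := u) (by exact_mod_cast hu) a
    exact_mod_cast this
  have cn : ContDiffOn ℝ 1 (fun x => normSq (grad u x)) Ω := by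
    unfold normSq grad
    exact ContDiffOn.sum fun i _ => (cgr i).pow 2
  have cH : ContDiffOn ℝ 1 (fun x => H (x, u x)) Ω :=
    hH.1.comp (contDiffOn_id.prodMk hu1) fun x hx => ⟨hx, mem_univ _⟩
  have ch : ContDiff ℝ (1 : ℕ) h := cutoff_contDiff hΩ χ.contDiff (by exact_mod_cast cH.mul cn) hts
  have ev : ∀ x ∈ ball x₀ s, u' =ᶠ[nhds x] u := by
    intro x hx
    filter_upwards [isOpen_ball.mem_nhds hx] with y hy
    simp [hu', hχ1 y hy]
  have ev1 : ∀ x ∈ ball x₀ s, ∀ a, pd a u' =ᶠ[nhds x] pd a u := by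
    intro x hx a
    filter_upwards [isOpen_ball.mem_nhds hx] with y hy
    exact pd_congr (ev y hy) a
  have e0 : ∀ x ∈ ball x₀ s, u' x = u x := fun x hx => (ev x hx).self_of_nhds
  have e1 : ∀ x ∈ ball x₀ s, grad u' x = grad u x := fun x hx => funext fun a => (ev1 x hx a).self_of_nhds
  have e2 : ∀ x ∈ ball x₀ s, ∀ a b, pd a (pd b u') x = pd a (pd b u) x := fun x hx a b => pd_congr (ev1 x hx b) a
  have e3 : ∀ x ∈ ball x₀ s, hess u' x = hess u x := by
    intro x hx
    ext a b
    simp only [hess, of_apply]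
    exact e2 x hx a b
  have e4 : ∀ x ∈ ball x₀ s, lapl u' x = lapl u x := fun x hx => Finset.sum_congr rfl fun a _ => e2 x hx a a
  have eh : ∀ x ∈ ball x₀ s, h x = H (x, u x) * normSq (grad u x) := by
    intro x hx
    simp [hh, hχ1 x hx]
  have eA : ∀ x ∈ ball x₀ s, AH u' h x = hess u x - (H (x, u x) * normSq (grad u x)) • (1 : Matrix (Fin n) (Fin n) ℝ) := by
    intro x hx
    rw [AH, e3 x hx, eh x hx]
  have bu : ∀ x ∈ ball x₀ s, |u x| ≤ M := fun x hx => by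
    have := hb x (hUr hx); have := vnorm_nonneg (grad u x); linarith
  have bg : ∀ x ∈ ball x₀ s, ∀ a, |grad u x a| ≤ M := fun x hx a => by
    have := hb x (hUr hx); have := abs_le_vnorm (grad u x) a; have := abs_nonneg (u x); linarith
  have cb : ∀ x ∈ ball x₀ s, x ∈ closedBall x₀ r := fun x hx => ball_subset_closedBall (hUr hx)
  refine ⟨u', h, ?_, e4⟩
  exact
    { hu := by exact_mod_cast cu
      huc := χ.hasCompactSupport.mul_right
      hh := by exact_mod_cast ch
      hU := isOpen_ball
      mQ := by
        intro x hx
        rw [e0 x hx, e1 x hx]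
        refine ⟨cb x hx, abs_le.1 (bu x hx), ?_⟩
        rw [mem_closedBall_zero_iff]
        refine (pi_norm_le_iff_of_nonneg ((abs_nonneg _).trans (bu x hx))).2 fun a => bg x hx a
      mQH := by
        intro x hx
        rw [e0 x hx]
        exact ⟨cb x hx, abs_le.1 (bu x hx)⟩
      pb := by
        intro x hx a
        have : pd a u' x = grad u x a := congrFun (e1 x hx) a
        rw [this]
        exact (bg x hx a).trans hM
      sg := by
        intro x hx
        rw [eA x hx, e0 x hx, e1 x hx]
        exact (heq x (hUΩ hx)).1
      gm := by
        intro x hx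
        rw [eA x hx]
        exact (heq x (hUΩ hx)).2
      v1 := by
        intro x hx
        rw [e4 x hx]
        exact (hv x (hUr hx)).1
      hb := by
        intro x hx a b
        rw [e4 x hx, e2 x hx]
        exact (abs_entry_le (hess u x) a b).trans (hv x (hUr hx)).2
      eh := by
        intro x hx
        rw [eh x hx, e0 x hx, e1 x hx] }

end
end RH

/-- Reverse Hölder inequality, Case 1 (estimate (41) in the proof
of Theorem 1.4, Case 1, for classical solutions). -/
theorem reverse_holder_case1
    {n : ℕ} (hn : 3 ≤ n) (k : ℕ) (hk2 : 2 ≤ k) (hkn : k ≤ n)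
    (Ω : Set (Fin n → ℝ)) (hΩ : IsOpen Ω)
    (f : ((Fin n → ℝ) × ℝ × (Fin n → ℝ)) → ℝ)
    (hfpos : ∀ y ∈ Ω ×ˢ ((univ : Set ℝ) ×ˢ (univ : Set (Fin n → ℝ))), 0 < f y)
    (hf : C11On f (Ω ×ˢ ((univ : Set ℝ) ×ˢ (univ : Set (Fin n → ℝ)))))
    (H₁ : ((Fin n → ℝ) × ℝ) → ℝ)
    (hH₁nonneg : ∀ y ∈ Ω ×ˢ (univ : Set ℝ), 0 ≤ H₁ y)
    (hH₁ : C11On H₁ (Ω ×ˢ (univ : Set ℝ)))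
    (x₀ : Fin n → ℝ) (R : ℝ) (hR : 0 < R)
    (hball : closure (ball x₀ (2 * R)) ⊆ Ω)
    (M : ℝ) (hM : 0 < M) :
    ∃ C : ℝ, ∀ (u : (Fin n → ℝ) → ℝ) (C₁ q ρ : ℝ),
      ContDiffOn ℝ 2 u Ω →
      (∀ x ∈ Ω,
        esymmMat k (hess u x -
            (H₁ (x, u x) * normSq (grad u x)) • (1 : Matrix (Fin n) (Fin n) ℝ))
          = f (x, u x, grad u x) ^ k ∧
        GammaPlus k (hess u x -
            (H₁ (x, u x) * normSq (grad u x)) • (1 : Matrix (Fin n) (Fin n) ℝ))) →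
      0 ≤ C₁ → C₁ ≤ M →
      (∀ x ∈ ball x₀ (2 * R), 1 ≤ lapl u x + C₁ ∧ matNorm (hess u x) ≤ lapl u x + C₁) →
      (∀ x ∈ ball x₀ (2 * R), |u x| + vnorm (grad u x) ≤ M) →
      (∫ x in ball x₀ (2 * R), (lapl u x + C₁) ^ ((k : ℝ) * n / 2)) ≤ M →
      (k : ℝ) * n / 2 - k + 1 < q →
      0 < ρ → ρ ≤ R / 3 →
      (∫ x in ball x₀ (R + ρ),
          (lapl u x + C₁) ^ (((k : ℝ) * n / ((k : ℝ) * n - 2 * k + 2)) * q))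
            ^ (((k : ℝ) * n / ((k : ℝ) * n - 2 * k + 2))⁻¹)
        ≤ C * q / ρ ^ 2 *
            ∫ x in ball x₀ (R + 3 * ρ), (lapl u x + C₁) ^ (q + (k : ℝ) - 1) := by
  obtain ⟨κ, rfl⟩ : ∃ κ, k = κ + 2 := ⟨k - 2, by omega⟩
  have hcb : closedBall x₀ (2 * R) ⊆ Ω := by
    rwa [closure_ball x₀ (by positivity)] at hball
  obtain ⟨C, L, hMC, hL, hDat, hX, hg⟩ := RH.data_exists κ hΩ hfpos hf hH₁nonneg hH₁ x₀ (2 * R) M hM hcb (by positivity)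
  obtain ⟨C2, hC2, hcore⟩ := RH.core_of_sol (n := n) (by omega) κ hkn C L hDat.C1 hL
  obtain ⟨C3, hC3, hrev⟩ := RH.reverse_w hn κ hkn C2 hC2
  obtain ⟨c, hc, hcut⟩ := RH.cutoff (n := n)
  refine ⟨C3 * (c + R) ^ 2 * M ^ (2 / (((κ + 2 : ℕ) : ℝ) * n)), ?_⟩
  intro u C₁ q ρ hu heq hC₁0 hC₁M hv hb hInt0 hq hρ hρR
  have hn3 : (3:ℝ) ≤ n := by exact_mod_cast hn
  have hk2' : (2:ℝ) ≤ ((κ + 2 : ℕ) : ℝ) := by exact_mod_cast hk2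
  have hq2 : 2 < q := by
    have : 0 ≤ (((κ + 2 : ℕ) : ℝ) - 2) * ((n:ℝ) - 3) := mul_nonneg (by linarith) (by linarith)
    nlinarith
  obtain ⟨u', h, hS, hlap⟩ := RH.sol_exists hΩ hH₁ (f := f) (κ := κ) (r := 2 * R) (s := R + 5 / 2 * ρ) (C := C) (C₁ := C₁)
    (by positivity) (by linarith) hMC hcb hu heq hv hb
  set v : (Fin n → ℝ) → ℝ := fun x => lapl u x + C₁ with hvdef
  set v' : (Fin n → ℝ) → ℝ := fun x => lapl u' x + C₁ with hvdef'
  set K := closedBall x₀ (R + 2 * ρ) with hK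
  set B := ball x₀ (R + ρ) with hB
  have hKU : K ⊆ ball x₀ (R + 5 / 2 * ρ) := closedBall_subset_ball (by linarith)
  have hBK : B ⊆ K := ball_subset_closedBall.trans (closedBall_subset_closedBall (by linarith))
  have hcK : IsCompact K := isCompact_closedBall _ _
  have hmB : MeasurableSet B := measurableSet_ball
  have hmK : MeasurableSet K := measurableSet_closedBall
  obtain ⟨w, X, g, hC, hvw⟩ := hcore f H₁ _ _ C₁ _ u' h hDat hS hX hg q K hq2 hcK hKU
  obtain ⟨η, hη, hη0, hη1, hηs, hηD, hηB⟩ := hcut x₀ (R + ρ) ρ (by positivity) hρ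
  have hD0 : ∀ x a, |pd a η x| ≤ (c + R) / ρ := fun x a => (hηD x a).trans (by gcongr; linarith)
  have hD1 : 1 ≤ (c + R) / ρ := by rw [le_div_iff₀ hρ]; linarith
  have hηK : tsupport η ⊆ K := hηs.trans (closedBall_subset_closedBall (by linarith))
  have hr := hrev q K B u' h v' w _ X g hC hq2 η ((c + R) / ρ) hη hη0 hη1 hηK hD0 hD1 hmB hBK hηB hvw
  have evK : ∀ x ∈ K, v' x = v x := fun x hx => by simp only [hvdef, hvdef', hlap x (hKU hx)]
  have cv : ContinuousOn v (closedBall x₀ (2 * R)) := by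
    have h1 : ∀ a, ContinuousOn (pd a (pd a u)) Ω := fun a => by
      have h2 := RH.pd_contDiffOn hΩ (m := 1) (g := u) (by exact_mod_cast hu) a
      exact (RH.pd_contDiffOn hΩ (m := 0) (by exact_mod_cast h2) a).continuousOn
    have h3 : ContinuousOn (lapl u) Ω := by
      unfold lapl
      exact continuousOn_finsetSum _ fun a _ => h1 a
    exact (h3.mono hcb).add continuousOn_const
  have hInt : ∀ p : ℝ, 0 ≤ p → IntegrableOn (fun x => v x ^ p) (ball x₀ (2 * R)) := fun p hp =>
    ((cv.rpow_const fun x _ => Or.inr hp).integrableOn_compact (isCompact_closedBall _ _)).mono_set ball_subset_closedBall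
  have hK2 : K ⊆ ball x₀ (R + 3 * ρ) := closedBall_subset_ball (by linarith)
  have h32 : ball x₀ (R + 3 * ρ) ⊆ ball x₀ (2 * R) := ball_subset_ball (by linarith)
  have hv1 : ∀ x ∈ ball x₀ (2 * R), 1 ≤ v x := fun x hx => (hv x hx).1
  have hv1K : ∀ x ∈ K, 1 ≤ v x := fun x hx => hv1 x (h32 (hK2 hx))
  have mono : ∀ (p : ℝ) (S T : Set (Fin n → ℝ)), 0 ≤ p → S ⊆ T → T ⊆ ball x₀ (2 * R) → MeasurableSet T →
      ∫ x in S, v x ^ p ≤ ∫ x in T, v x ^ p := by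
    intro p S T hp hST hT hmT
    refine setIntegral_mono_set ((hInt p hp).mono_set hT) ?_ hST.eventuallyLE
    filter_upwards [ae_restrict_mem hmT] with x hx
    exact Real.rpow_nonneg (by linarith [hv1 x (hT hx)]) _
  have hMB : ∫ x in B, v x ^ (((κ + 2 : ℕ) : ℝ) * n / 2) ≤ M :=
    (mono _ _ _ (by positivity) ((hBK.trans hK2).trans h32) subset_rfl measurableSet_ball).trans hInt0
  have hi := RH.interp hn (κ + 2) hk2 (q := q) hcK hmB hBK (cv.mono ((hK2.trans h32).trans ball_subset_closedBall)) hv1K hMB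
  have eB : ∫ x in B, v' x ^ ((q - 1) * ((n:ℝ) / (n - 2))) = ∫ x in B, v x ^ ((q - 1) * ((n:ℝ) / (n - 2))) :=
    setIntegral_congr_fun hmB fun x hx => by simp only [evK x (hBK hx)]
  have eK : ∫ x in K, v' x ^ (κ + 1) * v' x ^ q = ∫ x in K, v x ^ (q + ((κ + 2 : ℕ) : ℝ) - 1) := by
    refine setIntegral_congr_fun hmK fun x hx => ?_
    have h0 : 0 < v x := by linarith [hv1K x hx]
    simp only [evK x hx]
    rw [← Real.rpow_natCast, ← Real.rpow_add h0]
    congr 1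
    push_cast
    ring
  rw [eB, eK] at hr
  have hKm : ∫ x in K, v x ^ (q + ((κ + 2 : ℕ) : ℝ) - 1) ≤ ∫ x in ball x₀ (R + 3 * ρ), v x ^ (q + ((κ + 2 : ℕ) : ℝ) - 1) :=
    mono _ _ _ (by linarith) hK2 h32 measurableSet_ball
  have hMp : 0 ≤ M ^ (2 / (((κ + 2 : ℕ) : ℝ) * n)) := by positivity
  have hcoef : 0 ≤ C3 * q * ((c + R) / ρ) ^ 2 := by positivity
  calc _ ≤ _ := hi
    _ ≤ (C3 * q * ((c + R) / ρ) ^ 2 * ∫ x in K, v x ^ (q + ((κ + 2 : ℕ) : ℝ) - 1)) * M ^ (2 / (((κ + 2 : ℕ) : ℝ) * n)) := by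
      gcongr
    _ ≤ (C3 * q * ((c + R) / ρ) ^ 2 * ∫ x in ball x₀ (R + 3 * ρ), v x ^ (q + ((κ + 2 : ℕ) : ℝ) - 1)) * M ^ (2 / (((κ + 2 : ℕ) : ℝ) * n)) := by
      gcongr
    _ = _ := by
      rw [div_pow]
      ring
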